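/- arXiv:2103.05089 — 5 statements merged into one kernel-verified Lean document; each statement's English description precedes it below -/
import Mathlib

section
/- Let K : (0,∞) → ℝ be locally integrable, positive, eventually decreasing, with K(t) → 0 as t → ∞, and suppose t·K(t) → c₁ for some c₁ ∈ (0,∞) as t → ∞. Let 𝒦cos, 𝒦sin : (0,∞) → ℝ satisfy, for every ω > 0, ∫₀^A K(t)cos(ωt)dt → 𝒦cos(ω) and ∫₀^A K(t)sin(ωt)dt → 𝒦sin(ω) as A → ∞, and assume 𝒦cos(ω) > 0 for all ω > 0. Let m, λ, β, γ > 0 and set r₁₁(ω) = 2(λ + β·𝒦cos(ω)) / ((γ − m·ω² + β·ω·𝒦sin(ω))² + ω²·(λ + β·𝒦cos(ω))²). Then there exists c ∈ (0,∞) such that (1/(t·log t))·∫₀^∞ (1 − cos(tω))·ω⁻²·r₁₁(ω) dω → c as t → ∞. (This expresses that the mean squared displacement of the integrated position grows like t·log t in the critical case K(t) ∼ t⁻¹.) -/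
open MeasureTheory Filter Set

lemma osc_bound (K : ℝ → ℝ) (T : ℝ) (hdec : AntitoneOn K (Ici T)) (hpos : ∀ t ≥ T, 0 < K t)
    (f : ℝ → ℝ) (hf : Continuous f) (hf1 : ∀ t, |f t| ≤ 1) (h : ℝ) (hh : 0 < h)
    (hfh : ∀ t, f (t + h) = - f t) (S A : ℝ) (hS : T ≤ S) (hA : S ≤ A) :
    |∫ t in S..A, K t * f t| ≤ 2 * h * K S := by
  have hK : ∀ a b, T ≤ a → T ≤ b → IntervalIntegrable K volume a b := fun a b ha hb =>
    (hdec.mono (fun x hx => le_trans (le_min ha hb) hx.1)).intervalIntegrable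
  have hKf : ∀ a b, T ≤ a → T ≤ b → IntervalIntegrable (fun t => K t * f t) volume a b :=
    fun a b ha hb => (hK a b ha hb).mul_continuousOn hf.continuousOn
  have hKh : ∀ a b, T ≤ a → T ≤ b → IntervalIntegrable (fun t => K (t + h)) volume a b := by
    intro a b ha hb
    have : AntitoneOn (fun t => K (t + h)) (uIcc a b) := by
      intro x hx y hy hxy
      have hx1 : T ≤ x := le_trans (le_min ha hb) hx.1
      have hy1 : T ≤ y := le_trans (le_min ha hb) hy.1
      exact hdec (by simp; linarith) (by simp; linarith) (by linarith)
    exact this.intervalIntegrable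
  have short : ∀ a, S ≤ a → |∫ t in a..(a+h), K t * f t| ≤ h * K S := by
    intro a ha
    have := intervalIntegral.norm_integral_le_of_norm_le_const (a := a) (b := a + h)
      (f := fun t => K t * f t) (C := K S) (by
        intro x hx
        rw [uIoc_of_le (by linarith)] at hx
        have h1 : K x ≤ K S := hdec hS (by simp; linarith [hx.1]) (by linarith [hx.1])
        have h2 := hpos x (by linarith [hx.1])
        rw [norm_mul, Real.norm_eq_abs, Real.norm_eq_abs, abs_of_pos h2]
        nlinarith [hf1 x, abs_nonneg (f x)])
    simpa [abs_of_pos hh, mul_comm] using this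
  have shortK : ∀ a, S ≤ a → 0 ≤ ∫ t in a..(a+h), K t := by
    intro a ha
    apply intervalIntegral.integral_nonneg (by linarith)
    intro u hu
    exact (hpos u (by linarith [hu.1])).le
  have shortK2 : ∫ t in S..(S+h), K t ≤ h * K S := by
    have := intervalIntegral.integral_mono_on (a := S) (b := S + h) (by linarith)
      (hK S (S+h) hS (by linarith)) (intervalIntegrable_const (c := K S)) (by
        intro x hx; exact hdec hS (by simp; linarith [hx.1]) hx.1)
    simpa using this
  have e1 : ∫ t in (S+h)..(A+h), K t * f t = - ∫ t in S..A, K (t + h) * f t := by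
    rw [← intervalIntegral.integral_comp_add_right (fun t => K t * f t) h,
      ← intervalIntegral.integral_neg]
    congr 1; ext t; rw [hfh]; ring
  have e1' : ∫ t in (S+h)..(A+h), K t = ∫ t in S..A, K (t + h) := by
    rw [← intervalIntegral.integral_comp_add_right (fun t => K t) h]
  have iA : T ≤ A := by linarith
  have iSh : T ≤ S + h := by linarith
  have iAh : T ≤ A + h := by linarith
  have e2 := intervalIntegral.integral_add_adjacent_intervals (hKf S (S+h) hS iSh)
    (hKf (S+h) (A+h) iSh iAh)
  have e3 := intervalIntegral.integral_add_adjacent_intervals (hKf S A hS iA)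
    (hKf A (A+h) iA iAh)
  have e2' := intervalIntegral.integral_add_adjacent_intervals (hK S (S+h) hS iSh)
    (hK (S+h) (A+h) iSh iAh)
  have e3' := intervalIntegral.integral_add_adjacent_intervals (hK S A hS iA)
    (hK A (A+h) iA iAh)
  have main : |∫ t in S..A, (K t - K (t + h)) * f t| ≤ ∫ t in S..A, (K t - K (t + h)) := by
    have := intervalIntegral.norm_integral_le_of_norm_le (μ := volume) (a := S) (b := A)
      (f := fun t => (K t - K (t + h)) * f t) (g := fun t => K t - K (t + h)) hA (by
        refine ae_of_all _ fun x hx => ?_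
        have h1 : K (x + h) ≤ K x :=
          hdec (by simp; linarith [hx.1]) (by simp; linarith [hx.1]) (by linarith)
        rw [norm_mul, Real.norm_eq_abs, Real.norm_eq_abs, abs_of_nonneg (by linarith)]
        nlinarith [hf1 x, abs_nonneg (f x)]) ((hK S A hS iA).sub (hKh S A hS iA))
    exact this
  have e4 : ∫ t in S..A, (K t - K (t + h)) = (∫ t in S..A, K t) - ∫ t in S..A, K (t + h) :=
    intervalIntegral.integral_sub (hK S A hS iA) (hKh S A hS iA)
  have e5 : ∫ t in S..A, (K t - K (t + h)) * f t
      = (∫ t in S..A, K t * f t) - ∫ t in S..A, K (t + h) * f t := by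
    rw [← intervalIntegral.integral_sub (hKf S A hS iA)
      ((hKh S A hS iA).mul_continuousOn hf.continuousOn)]
    congr 1; ext t; ring
  have s1 := abs_le.1 (short S le_rfl)
  have s2 := abs_le.1 (short A hA)
  have s3 := shortK A hA
  rw [e5, e4] at main
  have s4 := abs_le.1 main
  rw [abs_le]
  constructor <;> linarith [s1.1, s1.2, s2.1, s2.2, s4.1, s4.2]

lemma cesaro_log (K : ℝ → ℝ) (hKloc : ∀ A > 0, IntegrableOn K (Ioc 0 A))
    (c₁ : ℝ) (hK1 : Tendsto (fun t => t * K t) atTop (nhds c₁)) :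
    Tendsto (fun x => (∫ t in (0:ℝ)..x, K t) / Real.log x) atTop (nhds c₁) := by
  have hI : ∀ a b, 0 < a → 0 < b → IntervalIntegrable K volume a b := by
    intro a b ha hb
    have h0 : ∀ a, 0 < a → IntervalIntegrable K volume 0 a := fun a ha =>
      (intervalIntegrable_iff_integrableOn_Ioc_of_le ha.le).2 (hKloc a ha)
    exact (h0 a ha).symm.trans (h0 b hb)
  have hI0 : ∀ a, 0 < a → IntervalIntegrable K volume 0 a := fun a ha =>
      (intervalIntegrable_iff_integrableOn_Ioc_of_le ha.le).2 (hKloc a ha)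
  rw [Metric.tendsto_atTop]
  intro ε hε
  obtain ⟨S', hS'⟩ := (Metric.tendsto_atTop.1 hK1) (ε/2) (by linarith)
  set S := max S' 1 with hSd
  have hS1 : 1 ≤ S := le_max_right _ _
  have hS0 : 0 < S := by linarith
  set D := |(∫ t in (0:ℝ)..S, K t)| + |c₁| * Real.log S with hD
  have hlogS : 0 ≤ Real.log S := Real.log_nonneg hS1
  have hev : ∀ᶠ x in atTop, 2 * D / ε < Real.log x :=
    Real.tendsto_log_atTop.eventually (eventually_gt_atTop _)
  obtain ⟨N, hN⟩ := eventually_atTop.1 hev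
  refine ⟨max N (S + 1), fun x hx => ?_⟩
  have hx1 := hN x (le_trans (le_max_left _ _) hx)
  have hx2 : S + 1 ≤ x := le_trans (le_max_right _ _) hx
  have hx0 : 0 < x := by linarith
  have hlx : 0 < Real.log x := Real.log_pos (by linarith)
  have key : |∫ t in S..x, (K t - c₁ * t⁻¹)| ≤ ∫ t in S..x, (ε / 2) * t⁻¹ := by
    have hinv : IntervalIntegrable (fun t : ℝ => t⁻¹) volume S x := by
      apply intervalIntegral.intervalIntegrable_inv (fun t ht => ?_) continuousOn_id
      rw [uIcc_of_le (by linarith)] at ht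
      have := ht.1
      simp; linarith
    have := intervalIntegral.norm_integral_le_of_norm_le (μ := volume) (a := S) (b := x)
      (f := fun t => K t - c₁ * t⁻¹) (g := fun t => (ε / 2) * t⁻¹) (by linarith) (by
        refine ae_of_all _ fun t ht => ?_
        have ht0 : 0 < t := by linarith [ht.1]
        have h1 := hS' t (le_trans (le_max_left _ _) ht.1.le)
        rw [Real.dist_eq] at h1
        have : K t - c₁ * t⁻¹ = (t * K t - c₁) * t⁻¹ := by field_simp
        rw [this, norm_mul, Real.norm_eq_abs, Real.norm_eq_abs, abs_of_pos (inv_pos.2 ht0)]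
        gcongr) (hinv.const_mul _)
    exact this
  have hinv : IntervalIntegrable (fun t : ℝ => t⁻¹) volume S x := by
    apply intervalIntegral.intervalIntegrable_inv (fun t ht => ?_) continuousOn_id
    rw [uIcc_of_le (by linarith)] at ht
    have := ht.1
    simp; linarith
  rw [intervalIntegral.integral_sub (hI S x hS0 hx0) (hinv.const_mul _),
    intervalIntegral.integral_const_mul, intervalIntegral.integral_const_mul,
    integral_inv_of_pos hS0 hx0, Real.log_div hx0.ne' hS0.ne'] at key
  have e := intervalIntegral.integral_add_adjacent_intervals (hI0 S hS0) (hI S x hS0 hx0)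
  rw [Real.dist_eq, ← e]
  have h2 : 2 * D < Real.log x * ε := by rwa [div_lt_iff₀ hε] at hx1
  have : ((∫ t in (0:ℝ)..S, K t) + ∫ t in S..x, K t) / Real.log x - c₁
    = ((∫ t in (0:ℝ)..S, K t) - c₁ * Real.log S +
      ((∫ t in S..x, K t) - c₁ * (Real.log x - Real.log S))) / Real.log x := by
    field_simp; ring
  rw [this, abs_div, abs_of_pos hlx, div_lt_iff₀ hlx]
  have t1 := abs_add_le ((∫ t in (0:ℝ)..S, K t) - c₁ * Real.log S)
    ((∫ t in S..x, K t) - c₁ * (Real.log x - Real.log S))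
  have t2 := abs_sub (∫ t in (0:ℝ)..S, K t) (c₁ * Real.log S)
  rw [abs_mul, abs_of_nonneg hlogS] at t2
  nlinarith

lemma tail_bound (K : ℝ → ℝ) (hKloc : ∀ A > 0, IntegrableOn K (Ioc 0 A))
    (T M : ℝ) (hT : 0 < T) (hdec : AntitoneOn K (Ici T)) (hpos : ∀ t > 0, 0 < K t)
    (hM : ∀ t ≥ T, t * K t ≤ M) (x : ℝ) (hx : T ≤ x)
    (f : ℝ → ℝ) (hf : Continuous f) (hf1 : ∀ t, |f t| ≤ 1)
    (hfh : ∀ t, f (t + Real.pi * x) = - f t) (L : ℝ)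
    (hL : Tendsto (fun A => ∫ t in (0:ℝ)..A, K t * f t) atTop (nhds L)) :
    |L - ∫ t in (0:ℝ)..x, K t * f t| ≤ 2 * Real.pi * M := by
  have hx0 : 0 < x := by linarith
  have hI0 : ∀ a, 0 < a → IntervalIntegrable (fun t => K t * f t) volume 0 a := fun a ha =>
      ((intervalIntegrable_iff_integrableOn_Ioc_of_le ha.le).2 (hKloc a ha)).mul_continuousOn
        hf.continuousOn
  have h1 := (hL.sub_const (∫ t in (0:ℝ)..x, K t * f t)).abs
  refine le_of_tendsto h1 ?_
  filter_upwards [eventually_ge_atTop x] with A hA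
  rw [intervalIntegral.integral_interval_sub_left (hI0 A (by linarith)) (hI0 x hx0)]
  have := osc_bound K T hdec (fun t ht => hpos t (by linarith)) f hf hf1 (Real.pi * x)
    (by positivity) hfh x A hx hA
  refine this.trans ?_
  have := hM x hx
  nlinarith [Real.pi_pos]

lemma transform_bound (K : ℝ → ℝ) (hKloc : ∀ A > 0, IntegrableOn K (Ioc 0 A))
    (hKpos : ∀ t > 0, 0 < K t)
    (hKdec : ∃ T > 0, AntitoneOn K (Ici T))
    (c₁ : ℝ) 
    (hK1 : Tendsto (fun t => t * K t) atTop (nhds c₁))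
    (Kcos Ksin : ℝ → ℝ)
    (hKcos : ∀ ω > 0, Tendsto (fun A => ∫ t in (0:ℝ)..A, K t * Real.cos (ω * t))
      atTop (nhds (Kcos ω)))
    (hKsin : ∀ ω > 0, Tendsto (fun A => ∫ t in (0:ℝ)..A, K t * Real.sin (ω * t))
      atTop (nhds (Ksin ω))) :
    ∃ S > 0, ∃ D, ∀ x ≥ S, |Kcos x⁻¹ - ∫ t in (0:ℝ)..x, K t| ≤ D ∧
      |Ksin x⁻¹| ≤ D + ∫ t in (0:ℝ)..x, K t := by
  obtain ⟨T, hT, hdec⟩ := hKdec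
  obtain ⟨S', hS'⟩ := eventually_atTop.1 (hK1.eventually (eventually_le_nhds (lt_add_one c₁)))
  set S := max S' T with hSd
  have hTS : T ≤ S := le_max_right _ _
  have hS0 : 0 < S := by linarith
  have hM : ∀ t ≥ S, t * K t ≤ c₁ + 1 := fun t ht => hS' t (le_trans (le_max_left _ _) ht)
  have hM0 : 0 ≤ c₁ + 1 := (mul_pos hS0 (hKpos S hS0)).le.trans (hM S le_rfl)
  have hdecS : AntitoneOn K (Ici S) := hdec.mono (Ici_subset_Ici.2 hTS)
  have hI0 : ∀ a, 0 < a → IntervalIntegrable K volume 0 a := fun a ha =>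
      (intervalIntegrable_iff_integrableOn_Ioc_of_le ha.le).2 (hKloc a ha)
  have hIS : 0 ≤ ∫ t in (0:ℝ)..S, K t :=
    intervalIntegral.integral_nonneg_of_ae_restrict hS0.le (by
      have : volume.restrict (Icc 0 S) = volume.restrict (Ioc 0 S) :=
        (restrict_Ioc_eq_restrict_Icc).symm
      rw [this]
      filter_upwards [ae_restrict_mem measurableSet_Ioc] with t ht
      exact (hKpos t ht.1).le)
  refine ⟨S, hS0, 2 * Real.pi * (c₁ + 1) + (2 * (∫ t in (0:ℝ)..S, K t) + (c₁ + 1)), fun x hx => ?_⟩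
  have hx0 : 0 < x := by linarith
  have hIx := hI0 x hx0
  constructor
  · have hc : Continuous (fun t => Real.cos (x⁻¹ * t)) := by fun_prop
    have h1 := tail_bound K hKloc S (c₁+1) hS0 hdecS hKpos hM x hx
      (fun t => Real.cos (x⁻¹ * t)) hc (fun t => Real.abs_cos_le_one _) (by
        intro t
        have : x⁻¹ * (t + Real.pi * x) = x⁻¹ * t + Real.pi := by field_simp
        simp only [this, Real.cos_add_pi]) _ (hKcos x⁻¹ (inv_pos.2 hx0))
    have hIc : ∀ a, 0 < a → IntervalIntegrable (fun t => K t * (Real.cos (x⁻¹ * t) - 1)) volume 0 a := fun a ha => (hI0 a ha).mul_continuousOn (by fun_prop)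
    have h2 : |∫ t in (0:ℝ)..S, K t * (Real.cos (x⁻¹ * t) - 1)| ≤ 2 * ∫ t in (0:ℝ)..S, K t := by
      rw [← intervalIntegral.integral_const_mul]
      have := intervalIntegral.norm_integral_le_of_norm_le (μ := volume) (a := 0) (b := S)
        (f := fun t => K t * (Real.cos (x⁻¹ * t) - 1)) (g := fun t => 2 * K t) hS0.le (by
        refine ae_of_all _ fun t ht => ?_
        have hk := hKpos t ht.1
        rw [norm_mul, Real.norm_eq_abs, Real.norm_eq_abs, abs_of_pos hk]
        have : |Real.cos (x⁻¹ * t) - 1| ≤ 2 := by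
          rw [abs_le]; constructor <;> linarith [Real.cos_le_one (x⁻¹ * t), Real.neg_one_le_cos (x⁻¹ * t)]
        nlinarith) ((hI0 S hS0).const_mul _)
      exact this
    have h3 : |∫ t in S..x, K t * (Real.cos (x⁻¹ * t) - 1)| ≤ c₁ + 1 := by
      have := intervalIntegral.norm_integral_le_of_norm_le_const (a := S) (b := x)
        (f := fun t => K t * (Real.cos (x⁻¹ * t) - 1)) (C := (c₁ + 1) * x⁻¹) (by
        intro t ht
        rw [uIoc_of_le hx] at ht
        have ht0 : 0 < t := by linarith [ht.1]
        have hk := hKpos t ht0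
        have hm := hM t ht.1.le
        rw [norm_mul, Real.norm_eq_abs, Real.norm_eq_abs, abs_of_pos hk]
        have hxi : 0 < x⁻¹ := inv_pos.2 hx0
        have : |Real.cos (x⁻¹ * t) - 1| ≤ x⁻¹ * t := by
          have a0 : 0 ≤ x⁻¹ * t := by positivity
          have a1 : x⁻¹ * t ≤ 1 := by rw [inv_mul_le_iff₀ hx0]; linarith [ht.2]
          have := Real.one_sub_sq_div_two_le_cos (x := x⁻¹ * t)
          rw [abs_le]; constructor <;> nlinarith [Real.cos_le_one (x⁻¹ * t)]
        calc K t * |Real.cos (x⁻¹ * t) - 1| ≤ K t * (x⁻¹ * t) := by gcongr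
          _ = (t * K t) * x⁻¹ := by ring
          _ ≤ _ := by gcongr)
      refine this.trans ?_
      rw [abs_of_nonneg (by linarith), mul_assoc]
      have : x⁻¹ * (x - S) ≤ 1 := by rw [inv_mul_le_iff₀ hx0]; linarith
      nlinarith
    have e := intervalIntegral.integral_add_adjacent_intervals (hIc S hS0)
      ((hIc S hS0).symm.trans (hIc x hx0))
    have e2 : ∫ t in (0:ℝ)..x, K t * (Real.cos (x⁻¹ * t) - 1) =
      (∫ t in (0:ℝ)..x, K t * Real.cos (x⁻¹ * t)) - ∫ t in (0:ℝ)..x, K t := by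
      rw [← intervalIntegral.integral_sub (hIx.mul_continuousOn hc.continuousOn) hIx]
      congr 1; ext t; ring
    rw [abs_le] at *
    constructor <;> linarith [h1.1, h1.2, h2.1, h2.2, h3.1, h3.2]
  · have hc : Continuous (fun t => Real.sin (x⁻¹ * t)) := by fun_prop
    have h1 := tail_bound K hKloc S (c₁+1) hS0 hdecS hKpos hM x hx
      (fun t => Real.sin (x⁻¹ * t)) hc (fun t => Real.abs_sin_le_one _) (by
        intro t
        have : x⁻¹ * (t + Real.pi * x) = x⁻¹ * t + Real.pi := by field_simp
        simp only [this, Real.sin_add_pi]) _ (hKsin x⁻¹ (inv_pos.2 hx0))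
    have h2 : |∫ t in (0:ℝ)..x, K t * Real.sin (x⁻¹ * t)| ≤ ∫ t in (0:ℝ)..x, K t := by
      have := intervalIntegral.norm_integral_le_of_norm_le (μ := volume) (a := 0) (b := x)
        (f := fun t => K t * Real.sin (x⁻¹ * t)) (g := fun t => K t) hx0.le (by
        refine ae_of_all _ fun t ht => ?_
        have hk := hKpos t ht.1
        rw [norm_mul, Real.norm_eq_abs, Real.norm_eq_abs, abs_of_pos hk]
        have := Real.abs_sin_le_one (x⁻¹ * t)
        nlinarith) hIx
      exact this
    rw [abs_le] at *
    constructor <;> linarith [h1.1, h1.2, h2.1, h2.2]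

lemma r11_asymp (K : ℝ → ℝ) (hKloc : ∀ A > 0, IntegrableOn K (Ioc 0 A))
    (hKpos : ∀ t > 0, 0 < K t)
    (hKdec : ∃ T > 0, AntitoneOn K (Ici T))
    (c₁ : ℝ)
    (hK1 : Tendsto (fun t => t * K t) atTop (nhds c₁))
    (Kcos Ksin : ℝ → ℝ)
    (hKcos : ∀ ω > 0, Tendsto (fun A => ∫ t in (0:ℝ)..A, K t * Real.cos (ω * t))
      atTop (nhds (Kcos ω)))
    (hKsin : ∀ ω > 0, Tendsto (fun A => ∫ t in (0:ℝ)..A, K t * Real.sin (ω * t))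
      atTop (nhds (Ksin ω)))
    (m lam β γ : ℝ) (hγ : 0 < γ)
    (r11 : ℝ → ℝ)
    (hr11 : ∀ ω > 0, r11 ω =
      2 * (lam + β * Kcos ω) /
        ((γ - m * ω ^ 2 + β * ω * Ksin ω) ^ 2 + ω ^ 2 * (lam + β * Kcos ω) ^ 2)) :
    Tendsto (fun x => r11 x⁻¹ / Real.log x) atTop (nhds (2 * (β * c₁) / γ ^ 2)) := by
  obtain ⟨S, hS0, D, hD⟩ := transform_bound K hKloc hKpos hKdec c₁ hK1 Kcos Ksin hKcos hKsin
  have hJ := cesaro_log K hKloc c₁ hK1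
  have hlog := Real.tendsto_log_atTop
  have hli : Tendsto (fun x => (Real.log x)⁻¹) atTop (nhds 0) := hlog.inv_tendsto_atTop
  have hxi : Tendsto (fun x : ℝ => x⁻¹) atTop (nhds 0) := tendsto_inv_atTop_zero
  have hlx : Tendsto (fun x => Real.log x * x⁻¹) atTop (nhds 0) := by
    have := Real.isLittleO_log_id_atTop.tendsto_div_nhds_zero
    simpa [div_eq_mul_inv] using this
  have hC : Tendsto (fun x => Kcos x⁻¹ * (Real.log x)⁻¹) atTop (nhds c₁) := by
    have h1 : Tendsto (fun x => (Kcos x⁻¹ - ∫ t in (0:ℝ)..x, K t) * (Real.log x)⁻¹)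
        atTop (nhds 0) := by
      have hb : Tendsto (fun x => D * (Real.log x)⁻¹) atTop (nhds 0) := by
        simpa using hli.const_mul D
      refine squeeze_zero_norm' ?_ hb
      filter_upwards [eventually_ge_atTop S, eventually_gt_atTop 1] with x hx hx1
      have hl := inv_pos.2 (Real.log_pos hx1)
      rw [norm_mul, Real.norm_eq_abs, Real.norm_eq_abs, abs_of_pos hl]
      have := (hD x hx).1
      gcongr
    have h2 := h1.add hJ
    rw [zero_add] at h2
    refine h2.congr fun x => ?_
    rw [div_eq_mul_inv]; ring
  have hSn : Tendsto (fun x => x⁻¹ * Ksin x⁻¹) atTop (nhds 0) := by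
    have hb : Tendsto (fun x => x⁻¹ * D + ((∫ t in (0:ℝ)..x, K t) / Real.log x) * (Real.log x * x⁻¹))
        atTop (nhds 0) := by
      simpa using (hxi.mul_const D).add (hJ.mul hlx)
    refine squeeze_zero_norm' ?_ hb
    filter_upwards [eventually_ge_atTop S, eventually_gt_atTop 1] with x hx hx1
    have hl := Real.log_pos hx1
    have hx0 : 0 < x⁻¹ := inv_pos.2 (by linarith)
    rw [norm_mul, Real.norm_eq_abs, Real.norm_eq_abs, abs_of_pos hx0]
    have := (hD x hx).2
    calc x⁻¹ * |Ksin x⁻¹| ≤ x⁻¹ * (D + ∫ t in (0:ℝ)..x, K t) := by gcongr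
      _ = _ := by field_simp
  have hCx : Tendsto (fun x => x⁻¹ * (lam + β * Kcos x⁻¹)) atTop (nhds 0) := by
    have : Tendsto (fun x => x⁻¹ * lam + β * ((Kcos x⁻¹ * (Real.log x)⁻¹) * (Real.log x * x⁻¹)))
        atTop (nhds 0) := by
      simpa using (hxi.mul_const lam).add ((hC.mul hlx).const_mul β)
    refine this.congr' ?_
    filter_upwards [eventually_gt_atTop 1] with x hx1
    have hl := Real.log_pos hx1
    field_simp
  have num : Tendsto (fun x => 2 * (lam * (Real.log x)⁻¹ + β * (Kcos x⁻¹ * (Real.log x)⁻¹))) atTop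
      (nhds (2 * (β * c₁))) := by
    simpa using (((hli.const_mul lam).add (hC.const_mul β)).const_mul 2)
  have den : Tendsto (fun x => (γ - m * x⁻¹ ^ 2 + β * (x⁻¹ * Ksin x⁻¹)) ^ 2
      + (x⁻¹ * (lam + β * Kcos x⁻¹)) ^ 2) atTop (nhds (γ ^ 2)) := by
    have := ((((hxi.pow 2).const_mul m).const_sub γ).add (hSn.const_mul β)).pow 2 |>.add (hCx.pow 2)
    simpa using this
  refine (num.div den (by positivity)).congr' ?_
  filter_upwards [eventually_gt_atTop 1] with x hx1
  rw [hr11 x⁻¹ (inv_pos.2 (by linarith))]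
  simp only [Pi.div_apply]
  have hl := Real.log_pos hx1
  rw [div_div, mul_comm (_ + _) (Real.log x), ← div_div]
  congr 1
  · field_simp
  · ring

lemma r11_bound (Kcos Ksin : ℝ → ℝ) (hKcospos : ∀ ω > 0, 0 < Kcos ω)
    (m lam β γ : ℝ) (hlam : 0 < lam) (hβ : 0 < β)
    (r11 : ℝ → ℝ)
    (hr11 : ∀ ω > 0, r11 ω =
      2 * (lam + β * Kcos ω) /
        ((γ - m * ω ^ 2 + β * ω * Ksin ω) ^ 2 + ω ^ 2 * (lam + β * Kcos ω) ^ 2))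
    (c : ℝ) (hc : Tendsto (fun x => r11 x⁻¹ / Real.log x) atTop (nhds c)) :
    ∃ C > 0, ∀ ω > 0, |r11 ω| ≤ C * (1 + |Real.log ω|) := by
  obtain ⟨N', hN'⟩ := eventually_atTop.1 (hc.abs.eventually (eventually_le_nhds (lt_add_one |c|)))
  set N := max N' 2
  have hN2 : 2 ≤ N := le_max_right _ _
  refine ⟨max (|c| + 1) (2 / lam * N ^ 2), lt_max_of_lt_left (by positivity), fun ω hω => ?_⟩
  by_cases h : N ≤ ω⁻¹
  · have h1 := hN' ω⁻¹ (le_trans (le_max_left _ _) h)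
    have hl : 0 < Real.log ω⁻¹ := Real.log_pos (by linarith)
    rw [inv_inv, abs_div, div_le_iff₀ (abs_pos.2 hl.ne')] at h1
    rw [Real.log_inv, abs_neg] at h1
    refine h1.trans ?_
    gcongr
    · exact le_max_left _ _
    · linarith
  · push Not at h
    have ha : 0 < lam + β * Kcos ω := by have := hKcospos ω hω; positivity
    have hal : lam ≤ lam + β * Kcos ω := by
      have := mul_pos hβ (hKcospos ω hω); linarith
    have hr : |r11 ω| ≤ 2 / lam * N ^ 2 := by
      rw [hr11 ω hω]
      set a := lam + β * Kcos ω
      set b := γ - m * ω ^ 2 + β * ω * Ksin ω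
      rw [abs_of_nonneg (by positivity)]
      calc 2 * a / (b ^ 2 + ω ^ 2 * a ^ 2) ≤ 2 * a / (ω ^ 2 * a ^ 2) := by
            gcongr; nlinarith [sq_nonneg b]
        _ = 2 / a * (ω⁻¹) ^ 2 := by field_simp
        _ ≤ _ := by gcongr
    calc |r11 ω| ≤ max (|c| + 1) (2 / lam * N ^ 2) * 1 := by
          rw [mul_one]; exact hr.trans (le_max_right _ _)
      _ ≤ _ := by
          gcongr
          linarith [abs_nonneg (Real.log ω)]

lemma transform_meas (K : ℝ → ℝ) (hKloc : ∀ A > 0, IntegrableOn K (Ioc 0 A))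
    (f : ℝ → ℝ) (hf : Continuous f) (hf1 : ∀ t, |f t| ≤ 1) (L : ℝ → ℝ)
    (hL : ∀ ω > 0, Tendsto (fun A => ∫ t in (0:ℝ)..A, K t * f (ω * t)) atTop (nhds (L ω))) :
    AEMeasurable L (volume.restrict (Ioi 0)) := by
  have hc : ∀ n : ℕ, Continuous (fun ω => ∫ t in (0:ℝ)..(n + 1 : ℝ), K t * f (ω * t)) := by
    intro n
    have hn : (0:ℝ) < n + 1 := by positivity
    have hI : IntervalIntegrable K volume 0 (n + 1 : ℝ) :=
      (intervalIntegrable_iff_integrableOn_Ioc_of_le hn.le).2 (hKloc _ hn)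
    refine intervalIntegral.continuous_of_dominated_interval (bound := fun t => |K t|) ?_ ?_
      hI.abs ?_
    · intro ω
      have : IntervalIntegrable (fun t => K t * f (ω * t)) volume 0 (n + 1 : ℝ) :=
        hI.mul_continuousOn (by fun_prop)
      exact (intervalIntegrable_iff.1 this).aestronglyMeasurable
    · intro ω
      refine ae_of_all _ fun t _ => ?_
      rw [norm_mul, Real.norm_eq_abs, Real.norm_eq_abs]
      have := hf1 (ω * t)
      nlinarith [abs_nonneg (K t)]
    · refine ae_of_all _ fun t _ => ?_
      fun_prop
  refine aemeasurable_of_tendsto_metrizable_ae' (f := fun (n : ℕ) ω => ∫ t in (0:ℝ)..(n + 1 : ℝ), K t * f (ω * t))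
    (fun n => (hc n).measurable.aemeasurable) ?_
  filter_upwards [ae_restrict_mem measurableSet_Ioi] with ω hω
  exact (hL ω hω).comp (tendsto_atTop_add_const_right _ _ tendsto_natCast_atTop_atTop)

lemma kern_bound (u : ℝ) : 0 ≤ (1 - Real.cos u) / u ^ 2 ∧ (1 - Real.cos u) / u ^ 2 ≤ 1 ∧
    (1 - Real.cos u) / u ^ 2 ≤ 2 / u ^ 2 := by
  have h1 := Real.cos_le_one u
  have h2 := Real.neg_one_le_cos u
  have h3 := Real.one_sub_sq_div_two_le_cos (x := u)
  refine ⟨div_nonneg (by linarith) (sq_nonneg u), ?_, ?_⟩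
  · apply div_le_one_of_le₀ _ (sq_nonneg u); nlinarith [sq_nonneg u]
  · gcongr; linarith

lemma dom_integrable :
    IntegrableOn (fun u : ℝ => (1 - Real.cos u) / u ^ 2 * (2 + |Real.log u|)) (Ioi 0) := by
  have hm : Measurable (fun u : ℝ => (1 - Real.cos u) / u ^ 2 * (2 + |Real.log u|)) := by
    have : Measurable (fun u : ℝ => |Real.log u|) := Real.measurable_log.abs
    fun_prop
  have hu : Ioi (0:ℝ) = Ioc 0 1 ∪ Ioi 1 := (Ioc_union_Ioi_eq_Ioi zero_le_one).symm
  rw [hu]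
  refine IntegrableOn.union ?_ ?_
  · have h1 : IntegrableOn (fun u : ℝ => 2 + |Real.log u|) (Ioc 0 1) := by
      rw [← intervalIntegrable_iff_integrableOn_Ioc_of_le zero_le_one]
      exact intervalIntegrable_const.add intervalIntegral.intervalIntegrable_log'.abs
    refine Integrable.mono' h1 hm.aestronglyMeasurable ?_
    refine ae_of_all _ fun u => ?_
    obtain ⟨a, b, _⟩ := kern_bound u
    rw [Real.norm_eq_abs, abs_mul, abs_of_nonneg a, abs_of_nonneg (a := 2 + |Real.log u|) (by positivity)]
    nlinarith [abs_nonneg (Real.log u)]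
  · have h1 : IntegrableOn (fun u : ℝ => 8 * u ^ (-(3/2) : ℝ)) (Ioi 1) :=
      (integrableOn_Ioi_rpow_of_lt (by norm_num) zero_lt_one).const_mul _
    refine Integrable.mono' h1 hm.aestronglyMeasurable ?_
    filter_upwards [ae_restrict_mem measurableSet_Ioi] with u hu
    have hu1 : (1:ℝ) < u := hu
    have hu0 : 0 < u := by linarith
    obtain ⟨a, _, b⟩ := kern_bound u
    have hl : 0 ≤ Real.log u := Real.log_nonneg hu1.le
    rw [Real.norm_eq_abs, abs_mul, abs_of_nonneg a, abs_of_nonneg (a := 2 + |Real.log u|) (by positivity),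
      abs_of_nonneg hl]
    have hlog := Real.log_le_rpow_div hu0.le (ε := 1/2) (by norm_num)
    have h1r : 1 ≤ u ^ (1/2 : ℝ) := Real.one_le_rpow hu1.le (by norm_num)
    have e : u ^ (-(3/2) : ℝ) = u ^ (1/2 : ℝ) / u ^ 2 := by
      rw [← Real.rpow_natCast u 2, ← Real.rpow_sub hu0]; norm_num
    rw [e]
    calc (1 - Real.cos u) / u ^ 2 * (2 + Real.log u) ≤ 2 / u ^ 2 * (4 * u ^ (1/2 : ℝ)) := by
          gcongr
          linarith
      _ = _ := by ring

lemma kern_integral_pos : 0 < ∫ u in Ioi (0:ℝ), (1 - Real.cos u) / u ^ 2 := by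
  have hm : Measurable (fun u : ℝ => (1 - Real.cos u) / u ^ 2) := by fun_prop
  have hi : IntegrableOn (fun u : ℝ => (1 - Real.cos u) / u ^ 2) (Ioi 0) := by
    refine Integrable.mono' dom_integrable hm.aestronglyMeasurable (ae_of_all _ fun u => ?_)
    obtain ⟨a, _, _⟩ := kern_bound u
    rw [Real.norm_eq_abs, abs_of_nonneg a]
    nlinarith [abs_nonneg (Real.log u)]
  rw [setIntegral_pos_iff_support_of_nonneg_ae (ae_of_all _ fun u => (kern_bound u).1) hi]
  refine lt_of_lt_of_le (b := volume (Ioo (0:ℝ) 1)) (by simp) (measure_mono ?_)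
  intro u hu
  refine ⟨?_, hu.1⟩
  have : Real.cos u < 1 := by
    have := Real.cos_lt_cos_of_nonneg_of_le_pi (x := 0) (y := u) le_rfl
      (by linarith [hu.2, Real.pi_gt_three]) hu.1
    simpa using this
  have h2 : 0 < (1 - Real.cos u) / u ^ 2 := div_pos (by linarith) (pow_pos hu.1 2)
  exact h2.ne'

/-- Diffusive growth of the mean squared displacement of the integrated
position for the harmonically bounded GLE in the critical case `K(t) ∼ c₁/t`:
`(1/(t log t)) ∫₀^∞ (1 − cos(tω)) ω⁻² r₁₁(ω) dω → c ∈ (0,∞)` as `t → ∞`,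
when `t·K(t) → c₁ ∈ (0,∞)`. -/
theorem msd_critical_kernel
    (K : ℝ → ℝ)
    (hKloc : ∀ A > 0, IntegrableOn K (Ioc 0 A))
    (hKpos : ∀ t > 0, 0 < K t)
    (hKdec : ∃ T > 0, AntitoneOn K (Ici T))
    (hK0 : Tendsto K atTop (nhds 0))
    (c₁ : ℝ) (hc₁ : 0 < c₁)
    (hK1 : Tendsto (fun t => t * K t) atTop (nhds c₁))
    (Kcos Ksin : ℝ → ℝ)
    (hKcos : ∀ ω > 0, Tendsto (fun A => ∫ t in (0:ℝ)..A, K t * Real.cos (ω * t))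
      atTop (nhds (Kcos ω)))
    (hKsin : ∀ ω > 0, Tendsto (fun A => ∫ t in (0:ℝ)..A, K t * Real.sin (ω * t))
      atTop (nhds (Ksin ω)))
    (hKcospos : ∀ ω > 0, 0 < Kcos ω)
    (m lam β γ : ℝ) (hm : 0 < m) (hlam : 0 < lam) (hβ : 0 < β) (hγ : 0 < γ)
    (r11 : ℝ → ℝ)
    (hr11 : ∀ ω > 0, r11 ω =
      2 * (lam + β * Kcos ω) /
        ((γ - m * ω ^ 2 + β * ω * Ksin ω) ^ 2 + ω ^ 2 * (lam + β * Kcos ω) ^ 2)) :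
    ∃ c > 0, Tendsto
      (fun t => (1 / (t * Real.log t)) * ∫ ω in Ioi (0:ℝ), (1 - Real.cos (t * ω)) / ω ^ 2 * r11 ω)
      atTop (nhds c) := by
  have hr := r11_asymp K hKloc hKpos hKdec c₁ hK1 Kcos Ksin hKcos hKsin m lam β γ hγ r11 hr11
  set c₀ := 2 * (β * c₁) / γ ^ 2 with hc₀
  have hc₀pos : 0 < c₀ := by positivity
  obtain ⟨C, hC, hb⟩ := r11_bound Kcos Ksin hKcospos m lam β γ hlam hβ r11 hr11 c₀ hr
  have hmc := transform_meas K hKloc Real.cos Real.continuous_cos Real.abs_cos_le_one Kcos hKcos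
  have hms := transform_meas K hKloc Real.sin Real.continuous_sin Real.abs_sin_le_one Ksin hKsin
  have hmr : AEMeasurable r11 (volume.restrict (Ioi 0)) := by
    have h1 : AEMeasurable (fun ω => 2 * (lam + β * Kcos ω) /
        ((γ - m * ω ^ 2 + β * ω * Ksin ω) ^ 2 + ω ^ 2 * (lam + β * Kcos ω) ^ 2))
        (volume.restrict (Ioi 0)) := by
      fun_prop
    refine h1.congr ?_
    filter_upwards [ae_restrict_mem measurableSet_Ioi] with ω hω
    exact (hr11 ω hω).symm
  have hscale : ∀ t : ℝ, 1 < t →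
      (1 / (t * Real.log t)) * ∫ ω in Ioi (0:ℝ), (1 - Real.cos (t * ω)) / ω ^ 2 * r11 ω
      = ∫ u in Ioi (0:ℝ), (1 - Real.cos u) / u ^ 2 * (r11 (t⁻¹ * u) / Real.log t) := by
    intro t ht
    have ht0 : 0 < t := by linarith
    have hl := Real.log_pos ht
    have h := integral_comp_mul_left_Ioi
      (fun ω => (1 - Real.cos (t * ω)) / ω ^ 2 * r11 ω) 0 (inv_pos.2 ht0)
    rw [mul_zero, inv_inv, smul_eq_mul] at h
    have h' : ∫ ω in Ioi (0:ℝ), (1 - Real.cos (t * ω)) / ω ^ 2 * r11 ω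
      = t⁻¹ * ∫ (x : ℝ) in Ioi 0, (1 - Real.cos (t * (t⁻¹ * x))) / (t⁻¹ * x) ^ 2 * r11 (t⁻¹ * x) := by
      rw [h]; field_simp
    rw [h', ← mul_assoc, ← integral_const_mul]
    refine setIntegral_congr_fun measurableSet_Ioi fun u hu => ?_
    have hu0 : (0:ℝ) < u := hu
    have : t * (t⁻¹ * u) = u := by field_simp
    simp only [this]
    field_simp
  refine ⟨∫ u in Ioi (0:ℝ), (1 - Real.cos u) / u ^ 2 * c₀, ?_, ?_⟩
  · rw [integral_mul_const]
    exact mul_pos kern_integral_pos hc₀pos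
  have hmain : Tendsto (fun t : ℝ => ∫ u in Ioi (0:ℝ), (1 - Real.cos u) / u ^ 2 *
      (r11 (t⁻¹ * u) / Real.log t)) atTop
      (nhds (∫ u in Ioi (0:ℝ), (1 - Real.cos u) / u ^ 2 * c₀)) := by
    refine tendsto_integral_filter_of_dominated_convergence
      (fun u => C * ((1 - Real.cos u) / u ^ 2 * (2 + |Real.log u|))) ?_ ?_
      (dom_integrable.const_mul C) ?_
    · filter_upwards [eventually_gt_atTop 1] with t ht
      have ht0 : 0 < t⁻¹ := inv_pos.2 (by linarith)
      have hq : Measure.QuasiMeasurePreserving (fun u : ℝ => t⁻¹ * u)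
          (volume.restrict (Ioi 0)) (volume.restrict (Ioi 0)) := by
        refine ⟨by fun_prop, ?_⟩
        have e : Ioi (0:ℝ) = (fun u : ℝ => t⁻¹ * u) ⁻¹' (Ioi 0) := by
          ext u; simp [ht0]
        nth_rewrite 1 [e]
        rw [← Measure.restrict_map (by fun_prop) measurableSet_Ioi,
          Real.map_volume_mul_left ht0.ne']
        rw [Measure.restrict_smul]
        exact Measure.smul_absolutelyContinuous
      have h1 : AEMeasurable (fun u => r11 (t⁻¹ * u)) (volume.restrict (Ioi 0)) :=
        hmr.comp_quasiMeasurePreserving hq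
      have h2 : AEMeasurable (fun u => (1 - Real.cos u) / u ^ 2 *
        (r11 (t⁻¹ * u) / Real.log t)) (volume.restrict (Ioi 0)) := by
        fun_prop
      exact h2.aestronglyMeasurable
    · filter_upwards [eventually_ge_atTop (Real.exp 1)] with t ht
      filter_upwards [ae_restrict_mem measurableSet_Ioi] with u hu
      have hu0 : (0:ℝ) < u := hu
      have ht0 : 0 < t := lt_of_lt_of_le (Real.exp_pos 1) ht
      have hl : 1 ≤ Real.log t := (Real.le_log_iff_exp_le ht0).2 ht
      obtain ⟨a, _, _⟩ := kern_bound u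
      have h1 := hb (t⁻¹ * u) (by positivity)
      have h2 : |Real.log (t⁻¹ * u)| ≤ Real.log t + |Real.log u| := by
        rw [Real.log_mul (inv_pos.2 ht0).ne' hu0.ne', Real.log_inv]
        refine (abs_add_le _ _).trans ?_
        rw [abs_neg, abs_of_nonneg (by linarith : 0 ≤ Real.log t)]
      rw [norm_mul, Real.norm_eq_abs, Real.norm_eq_abs, abs_of_nonneg a, mul_left_comm C]
      gcongr
      rw [abs_div, abs_of_nonneg (by linarith : 0 ≤ Real.log t), div_le_iff₀ (by linarith)]
      refine h1.trans ?_
      rw [mul_assoc]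
      gcongr
      nlinarith [abs_nonneg (Real.log u)]
    · filter_upwards [ae_restrict_mem measurableSet_Ioi] with u hu
      have hu0 : (0:ℝ) < u := hu
      refine Tendsto.const_mul _ ?_
      have h1 : Tendsto (fun t : ℝ => t * u⁻¹) atTop atTop :=
        tendsto_id.atTop_mul_const (inv_pos.2 hu0)
      have h2 := hr.comp h1
      have h3 : Tendsto (fun t : ℝ => 1 - Real.log u * (Real.log t)⁻¹) atTop (nhds 1) := by
        simpa using (Real.tendsto_log_atTop.inv_tendsto_atTop.const_mul (Real.log u)).const_sub 1
      have h4 := h2.mul h3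
      rw [mul_one] at h4
      refine h4.congr' ?_
      filter_upwards [eventually_gt_atTop 1, eventually_gt_atTop u] with t ht htu
      have ht0 : 0 < t := by linarith
      have hl := Real.log_pos ht
      have hl2 : Real.log (t * u⁻¹) = Real.log t - Real.log u := by
        rw [← div_eq_mul_inv, Real.log_div ht0.ne' hu0.ne']
      have hl3 : 0 < Real.log t - Real.log u := sub_pos.2 (Real.log_lt_log hu0 htu)
      simp only [Function.comp, hl2, mul_inv, inv_inv]
      field_simp
  refine hmain.congr' ?_
  filter_upwards [eventually_gt_atTop 1] with t ht
  exact (hscale t ht).symm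
end

section
/- Let α ∈ (0,1) and let K : (0,∞) → ℝ be locally integrable, positive, eventually decreasing, with K(t) → 0 as t → ∞, and suppose t^α·K(t) → c_α for some c_α ∈ (0,∞) as t → ∞. Let 𝒦cos, 𝒦sin : (0,∞) → ℝ satisfy, for every ω > 0, ∫₀^A K(t)cos(ωt)dt → 𝒦cos(ω) and ∫₀^A K(t)sin(ωt)dt → 𝒦sin(ω) as A → ∞, and assume 𝒦cos(ω) > 0 for all ω > 0. Let m, λ, β, γ > 0 and set r₁₁(ω) = 2(λ + β·𝒦cos(ω)) / ((γ − m·ω² + β·ω·𝒦sin(ω))² + ω²·(λ + β·𝒦cos(ω))²). Then there exists c ∈ (0,∞) such that t^{α−2}·∫₀^∞ (1 − cos(tω))·ω⁻²·r₁₁(ω) dω → c as t → ∞. (This expresses superdiffusive growth t^{2−α} of the mean squared displacement of the integrated position when K(t) ∼ t^{−α}.) -/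
open MeasureTheory Filter Set

lemma tail_bound_s6 (K g : ℝ → ℝ) (B h : ℝ) (hh : 0 < h) (hK : AntitoneOn K (Ici B))
    (hK0 : ∀ t ≥ B, 0 ≤ K t) (hg : Continuous g) (hg1 : ∀ t, |g t| ≤ 1)
    (hgh : ∀ t, g (t + h) = - g t) (A : ℝ) (hA : B + h ≤ A) :
    |∫ t in B..A, K t * g t| ≤ 3 * h * K B := by
  have hKi : ∀ a b, B ≤ a → a ≤ b → IntervalIntegrable K volume a b := by
    intro a b ha hab
    apply AntitoneOn.intervalIntegrable
    apply hK.mono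
    rw [uIcc_of_le hab]
    intro x hx
    exact ha.trans hx.1
  have hKg : ∀ a b, B ≤ a → a ≤ b → IntervalIntegrable (fun t => K t * g t) volume a b := by
    intro a b ha hab
    exact (hKi a b ha hab).mul_continuousOn hg.continuousOn
  have hshort : ∀ a, B ≤ a → |∫ t in a..(a+h), K t * g t| ≤ h * K B := by
    intro a ha
    have := intervalIntegral.norm_integral_le_of_norm_le_const (a := a) (b := a + h)
      (f := fun t => K t * g t) (C := K B) (by
        intro x hx
        rw [uIoc_of_le (by linarith)] at hx
        have hx1 : B ≤ x := by linarith [hx.1]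
        rw [Real.norm_eq_abs, abs_mul, abs_of_nonneg (hK0 x hx1)]
        have h1 := hK (mem_Ici.2 le_rfl) (mem_Ici.2 hx1) hx1
        calc K x * |g x| ≤ K x * 1 := mul_le_mul_of_nonneg_left (hg1 x) (hK0 x hx1)
          _ ≤ K B := by linarith)
    simpa [abs_of_pos hh, mul_comm] using this
  have hKs : IntervalIntegrable (fun t => K (t + h)) volume B (A - h) := by
    apply AntitoneOn.intervalIntegrable
    rw [uIcc_of_le (by linarith)]
    intro x hx y hy hxy
    exact hK (mem_Ici.2 (by linarith [hx.1])) (mem_Ici.2 (by linarith [hy.1])) (by linarith)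
  have e1 := intervalIntegral.integral_add_adjacent_intervals (hKg B (A-h) le_rfl (by linarith))
    (hKg (A-h) A (by linarith) (by linarith))
  have e2 := intervalIntegral.integral_add_adjacent_intervals (hKg B (B+h) le_rfl (by linarith))
    (hKg (B+h) A (by linarith) (by linarith))
  have e3 : ∫ t in (B+h)..A, K t * g t = - ∫ t in B..(A-h), K (t+h) * g t := by
    have := intervalIntegral.integral_comp_add_right (a := B) (b := A - h)
      (fun t => K t * g t) h
    rw [sub_add_cancel] at this
    rw [← this, ← intervalIntegral.integral_neg]
    congr 1
    ext t
    rw [hgh]; ring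
  have e4 : ∫ t in (B+h)..A, K t = ∫ t in B..(A-h), K (t+h) := by
    have := intervalIntegral.integral_comp_add_right (a := B) (b := A - h) K h
    rw [sub_add_cancel] at this
    rw [← this]
  have f1 := intervalIntegral.integral_add_adjacent_intervals (hKi B (A-h) le_rfl (by linarith))
    (hKi (A-h) A (by linarith) (by linarith))
  have f2 := intervalIntegral.integral_add_adjacent_intervals (hKi B (B+h) le_rfl (by linarith))
    (hKi (B+h) A (by linarith) (by linarith))
  have s1 := hshort B le_rfl
  have s2 := hshort (A - h) (by linarith)
  rw [sub_add_cancel] at s2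
  have s3 : ∫ t in B..(B+h), K t ≤ h * K B := by
    have := intervalIntegral.integral_mono_on (a := B) (b := B + h) (by linarith)
      (hKi B (B+h) le_rfl (by linarith)) (intervalIntegrable_const (c := K B))
      (fun x hx => hK (mem_Ici.2 le_rfl) (mem_Ici.2 hx.1) hx.1)
    simpa using this
  have s4 : 0 ≤ ∫ t in (A-h)..A, K t :=
    intervalIntegral.integral_nonneg (by linarith) (fun u hu => hK0 u (by linarith [hu.1]))
  have d1 : |∫ t in B..(A-h), (K t - K (t+h)) * g t| ≤ ∫ t in B..(A-h), (K t - K (t+h)) := by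
    have := intervalIntegral.norm_integral_le_of_norm_le (a := B) (b := A - h) (μ := volume)
      (f := fun t => (K t - K (t+h)) * g t) (g := fun t => K t - K (t+h)) (by linarith)
      (ae_of_all _ (by
        intro x hx
        have hx1 : B ≤ x := hx.1.le
        have := hK (mem_Ici.2 hx1) (mem_Ici.2 (by linarith : B ≤ x + h)) (by linarith)
        rw [Real.norm_eq_abs, abs_mul, abs_of_nonneg (by linarith)]
        nlinarith [hg1 x])) ((hKi B (A-h) le_rfl (by linarith)).sub hKs)
    simpa using this
  rw [intervalIntegral.integral_sub (hKi B (A-h) le_rfl (by linarith)) hKs] at d1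
  have d2 : ∫ t in B..(A-h), (K t - K (t+h)) * g t
      = (∫ t in B..(A-h), K t * g t) - ∫ t in B..(A-h), K (t+h) * g t := by
    rw [← intervalIntegral.integral_sub (hKg B (A-h) le_rfl (by linarith))
      (hKs.mul_continuousOn hg.continuousOn)]
    congr 1; ext t; ring
  rw [d2] at d1
  rw [abs_le] at *
  constructor <;> linarith [s1.1, s1.2, s2.1, s2.2, d1.1, d1.2]

lemma oneSubCos (p : ℝ) (hp1 : 1 < p) (hp3 : p < 3) :
    IntegrableOn (fun u : ℝ => (1 - Real.cos u) * u ^ (-p)) (Ioi 0) ∧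
    0 < ∫ u in Ioi (0:ℝ), (1 - Real.cos u) * u ^ (-p) := by
  have hmeas : Measurable (fun u : ℝ => (1 - Real.cos u) * u ^ (-p)) := by fun_prop
  have hi : IntegrableOn (fun u : ℝ => (1 - Real.cos u) * u ^ (-p)) (Ioi 0) := by
    rw [← Ioc_union_Ioi_eq_Ioi (zero_le_one (α := ℝ))]
    apply IntegrableOn.union
    · have h1 : IntegrableOn (fun u : ℝ => u ^ (2 - p)) (Ioc 0 1) := by
        rw [← intervalIntegrable_iff_integrableOn_Ioc_of_le zero_le_one]
        exact intervalIntegral.intervalIntegrable_rpow' (by linarith)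
      refine Integrable.mono' h1 hmeas.aestronglyMeasurable ?_
      refine (ae_restrict_iff' measurableSet_Ioc).2 (ae_of_all _ ?_)
      intro u hu
      have hu0 : 0 < u := hu.1
      rw [Real.norm_eq_abs, abs_of_nonneg (mul_nonneg (by linarith [Real.cos_le_one u])
        (Real.rpow_nonneg hu0.le _))]
      have : u ^ (2 - p) = u ^ 2 * u ^ (-p) := by
        rw [sub_eq_add_neg, Real.rpow_add hu0, Real.rpow_two]
      rw [this]
      apply mul_le_mul_of_nonneg_right _ (Real.rpow_nonneg hu0.le _)
      nlinarith [Real.one_sub_sq_div_two_le_cos (x := u)]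
    · have h1 : IntegrableOn (fun u : ℝ => 2 * u ^ (-p)) (Ioi 1) :=
        (integrableOn_Ioi_rpow_of_lt (by linarith) one_pos).const_mul 2
      refine Integrable.mono' h1 hmeas.aestronglyMeasurable ?_
      refine (ae_restrict_iff' measurableSet_Ioi).2 (ae_of_all _ ?_)
      intro u hu
      have hu0 : 0 < u := lt_trans one_pos hu
      rw [Real.norm_eq_abs, abs_of_nonneg (mul_nonneg (by linarith [Real.cos_le_one u])
        (Real.rpow_nonneg hu0.le _))]
      apply mul_le_mul_of_nonneg_right _ (Real.rpow_nonneg hu0.le _)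
      linarith [Real.neg_one_le_cos u]
  refine ⟨hi, ?_⟩
  rw [setIntegral_pos_iff_support_of_nonneg_ae _ hi]
  · have : Ioo (0:ℝ) 1 ⊆ Function.support (fun u : ℝ => (1 - Real.cos u) * u ^ (-p)) ∩ Ioi 0 := by
      intro u hu
      refine ⟨?_, hu.1⟩
      have h1 : Real.cos u < 1 := by
        have := Real.cos_lt_cos_of_nonneg_of_le_pi (x := 0) (y := u) le_rfl
          (by linarith [Real.pi_gt_three, hu.2]) hu.1
        simpa using this
      have : 0 < (1 - Real.cos u) * u ^ (-p) :=
        mul_pos (by linarith) (Real.rpow_pos_of_pos hu.1 _)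
      exact this.ne'
    refine lt_of_lt_of_le ?_ (measure_mono this)
    simp
  · refine (ae_restrict_iff' measurableSet_Ioi).2 (ae_of_all _ ?_)
    intro u hu
    exact mul_nonneg (by linarith [Real.cos_le_one u]) (Real.rpow_nonneg (le_of_lt hu) _)

lemma cosLimit (α : ℝ) (h0 : 0 < α) (h1 : α < 1) : ∃ I > 0,
    Tendsto (fun M : ℝ => ∫ u in (0:ℝ)..M, u ^ (-α) * Real.cos u) atTop (nhds I) := by
  obtain ⟨hi, hpos⟩ := oneSubCos (α + 2) (by linarith) (by linarith)
  refine ⟨α * (α + 1) * ∫ u in Ioi (0:ℝ), (1 - Real.cos u) * u ^ (-(α+2)), by positivity, ?_⟩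
  set F : ℝ → ℝ := fun u => u ^ (-α) * Real.sin u + α * (u ^ (-α - 1) * (1 - Real.cos u)) with hF
  have hF0 : Tendsto F (nhdsWithin 0 (Ioi 0)) (nhds 0) := by
    have hb : Tendsto (fun u : ℝ => u ^ (1 - α) + α * u ^ (1 - α)) (nhdsWithin 0 (Ioi 0)) (nhds 0) := by
      have : ContinuousAt (fun u : ℝ => u ^ (1 - α) + α * u ^ (1 - α)) 0 := by
        have := Real.continuousAt_rpow_const 0 (1 - α) (Or.inr (by linarith))
        exact this.add (this.const_mul _)
      have h := this.tendsto.mono_left (nhdsWithin_le_nhds (s := Ioi 0))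
      simpa [Real.zero_rpow (by linarith : (1:ℝ) - α ≠ 0)] using h
    refine squeeze_zero_norm' ?_ hb
    filter_upwards [self_mem_nhdsWithin] with u hu
    have hu0 : 0 < u := hu
    rw [Real.norm_eq_abs]
    refine (abs_add_le _ _).trans (add_le_add ?_ ?_)
    · rw [abs_mul, abs_of_nonneg (Real.rpow_nonneg hu0.le _)]
      have : u ^ (1 - α) = u ^ (-α) * u := by
        rw [show 1 - α = -α + 1 by ring, Real.rpow_add hu0, Real.rpow_one]
      rw [this]
      apply mul_le_mul_of_nonneg_left _ (Real.rpow_nonneg hu0.le _)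
      have := Real.abs_sin_le_abs (x := u)
      rwa [abs_of_pos hu0] at this
    · rw [abs_mul, abs_of_pos h0]
      apply mul_le_mul_of_nonneg_left _ h0.le
      rw [abs_mul, abs_of_nonneg (Real.rpow_nonneg hu0.le _),
        abs_of_nonneg (by linarith [Real.cos_le_one u])]
      have : u ^ (1 - α) = u ^ (-α - 1) * u ^ 2 := by
        rw [show 1 - α = (-α - 1) + 2 by ring, Real.rpow_add hu0, Real.rpow_two]
      rw [this]
      apply mul_le_mul_of_nonneg_left _ (Real.rpow_nonneg hu0.le _)
      nlinarith [Real.one_sub_sq_div_two_le_cos (x := u)]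
  have hFtop : Tendsto F atTop (nhds 0) := by
    have hb : Tendsto (fun u : ℝ => u ^ (-α) + α * (u ^ (-(α + 1)) * 2)) atTop (nhds 0) := by
      have a1 := tendsto_rpow_neg_atTop h0
      have a2 := tendsto_rpow_neg_atTop (by linarith : 0 < α + 1)
      simpa using a1.add ((a2.mul_const 2).const_mul α)
    refine squeeze_zero_norm' ?_ hb
    filter_upwards [eventually_gt_atTop 0] with u hu0
    rw [Real.norm_eq_abs]
    refine (abs_add_le _ _).trans (add_le_add ?_ ?_)
    · rw [abs_mul, abs_of_nonneg (Real.rpow_nonneg hu0.le _)]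
      exact mul_le_of_le_one_right (Real.rpow_nonneg hu0.le _) (Real.abs_sin_le_one u)
    · rw [abs_mul, abs_of_pos h0]
      apply mul_le_mul_of_nonneg_left _ h0.le
      rw [abs_mul, abs_of_nonneg (Real.rpow_nonneg hu0.le _),
        abs_of_nonneg (by linarith [Real.cos_le_one u]), show -α - 1 = -(α+1) by ring]
      apply mul_le_mul_of_nonneg_left _ (Real.rpow_nonneg hu0.le _)
      linarith [Real.neg_one_le_cos u]
  have hderiv : ∀ u : ℝ, 0 < u → HasDerivAt F
      (u ^ (-α) * Real.cos u - α * (α + 1) * ((1 - Real.cos u) * u ^ (-(α+2)))) u := by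
    intro u hu
    have d1 := (Real.hasDerivAt_rpow_const (x := u) (p := -α) (Or.inl hu.ne')).mul
      (Real.hasDerivAt_sin u)
    have d2 := ((Real.hasDerivAt_rpow_const (x := u) (p := -α - 1) (Or.inl hu.ne')).mul
      ((Real.hasDerivAt_cos u).const_sub 1)).const_mul α
    refine (d1.add d2).congr_deriv ?_
    rw [show -α - 1 - 1 = -(α + 2) by ring]
    ring
  have hcosI : ∀ M > 0, IntervalIntegrable (fun u : ℝ => u ^ (-α) * Real.cos u) volume 0 M := by
    intro M hM
    exact (intervalIntegral.intervalIntegrable_rpow' (by linarith)).mul_continuousOn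
      Real.continuous_cos.continuousOn
  have hoI : ∀ M > 0, IntervalIntegrable (fun u : ℝ => (1 - Real.cos u) * u ^ (-(α+2))) volume 0 M := by
    intro M hM
    rw [intervalIntegrable_iff_integrableOn_Ioc_of_le hM.le]
    exact hi.mono_set Ioc_subset_Ioi_self
  have key : ∀ M > 0, ∫ u in (0:ℝ)..M, u ^ (-α) * Real.cos u =
      F M + α * (α + 1) * ∫ u in (0:ℝ)..M, (1 - Real.cos u) * u ^ (-(α+2)) := by
    intro M hM
    have := intervalIntegral.integral_eq_sub_of_hasDerivAt_of_tendsto (f := F) hM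
      (fun u hu => hderiv u hu.1) ((hcosI M hM).sub ((hoI M hM).const_mul (α * (α+1)))) hF0
      ((hderiv M hM).continuousAt.tendsto.mono_left nhdsWithin_le_nhds)
    rw [intervalIntegral.integral_sub (hcosI M hM) ((hoI M hM).const_mul (α * (α+1))),
      intervalIntegral.integral_const_mul] at this
    linarith
  have hlim := intervalIntegral_tendsto_integral_Ioi 0 hi tendsto_id
  have := hFtop.add (hlim.const_mul (α * (α + 1)))
  rw [zero_add] at this
  refine this.congr' ?_
  filter_upwards [eventually_gt_atTop 0] with M hM
  exact (key M hM).symm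

lemma tail_lim (K g : ℝ → ℝ) (hKloc : ∀ A > 0, IntegrableOn K (Ioc 0 A))
    (B h : ℝ) (hB : 0 < B) (hh : 0 < h) (hK : AntitoneOn K (Ici B))
    (hK0 : ∀ t > 0, 0 < K t) (hg : Continuous g) (hg1 : ∀ t, |g t| ≤ 1)
    (hgh : ∀ t, g (t + h) = - g t) (G : ℝ)
    (hG : Tendsto (fun A => ∫ t in (0:ℝ)..A, K t * g t) atTop (nhds G)) :
    |G - ∫ t in (0:ℝ)..B, K t * g t| ≤ 3 * h * K B := by
  have hI : ∀ A > 0, IntervalIntegrable (fun t => K t * g t) volume 0 A := by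
    intro A hA
    exact ((intervalIntegrable_iff_integrableOn_Ioc_of_le hA.le).2 (hKloc A hA)).mul_continuousOn
      hg.continuousOn
  have h1 := (hG.sub_const (∫ t in (0:ℝ)..B, K t * g t)).abs
  refine le_of_tendsto h1 ?_
  filter_upwards [eventually_ge_atTop (B + h)] with A hA
  rw [intervalIntegral.integral_interval_sub_left (hI A (by linarith)) (hI B hB)]
  exact tail_bound_s6 K g B h hh hK (fun t ht => (hK0 t (by linarith)).le) hg hg1 hgh A hA

lemma head_bound (K g : ℝ → ℝ) (B : ℝ) (hB : 0 ≤ B)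
    (hKi : IntervalIntegrable K volume 0 B) (hg1 : ∀ t, |g t| ≤ 1) :
    |∫ t in (0:ℝ)..B, K t * g t| ≤ ∫ t in (0:ℝ)..B, |K t| := by
  have := intervalIntegral.norm_integral_le_of_norm_le (a := 0) (b := B) (μ := volume)
      (f := fun t => K t * g t) (g := fun t => |K t|) hB
      (ae_of_all _ (by
        intro x hx
        rw [Real.norm_eq_abs, abs_mul]
        exact mul_le_of_le_one_right (abs_nonneg _) (hg1 x))) hKi.abs
  simpa using this

lemma sin_small (K Ksin : ℝ → ℝ)
    (hKloc : ∀ A > 0, IntegrableOn K (Ioc 0 A))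
    (hKpos : ∀ t > 0, 0 < K t)
    (hKdec : ∃ T > 0, AntitoneOn K (Ici T))
    (hK0 : Tendsto K atTop (nhds 0))
    (hKsin : ∀ ω > 0, Tendsto (fun A => ∫ t in (0:ℝ)..A, K t * Real.sin (ω * t))
      atTop (nhds (Ksin ω))) :
    Tendsto (fun ω => ω * Ksin ω) (nhdsWithin 0 (Ioi 0)) (nhds 0) := by
  obtain ⟨T, hT, hdec⟩ := hKdec
  rw [Metric.tendsto_nhds]
  intro ε hε
  have hπ := Real.pi_pos
  obtain ⟨B, hB1, hBT⟩ := ((hK0.eventually (gt_mem_nhds (show 0 < ε / (6 * Real.pi) by positivity))).and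
    (eventually_ge_atTop T)).exists
  have hB : 0 < B := by linarith
  have hKi := (intervalIntegrable_iff_integrableOn_Ioc_of_le hB.le).2 (hKloc B hB)
  set C := ∫ t in (0:ℝ)..B, |K t| with hC
  have hlim : Tendsto (fun ω : ℝ => ω * C) (nhdsWithin 0 (Ioi 0)) (nhds 0) := by
    have : Continuous (fun ω : ℝ => ω * C) := by fun_prop
    have := (this.tendsto 0).mono_left (nhdsWithin_le_nhds (s := Ioi 0))
    simpa using this
  filter_upwards [self_mem_nhdsWithin, hlim.eventually (gt_mem_nhds (half_pos hε))] with ω hω hωC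
  have hω0 : 0 < ω := hω
  have t1 := tail_lim K (fun t => Real.sin (ω * t)) hKloc B (Real.pi / ω) hB (by positivity)
    (hdec.mono (Ici_subset_Ici.2 hBT)) hKpos (by fun_prop) (fun t => Real.abs_sin_le_one _)
    (fun t => by
      show Real.sin (ω * (t + Real.pi / ω)) = _
      rw [mul_add, mul_div_cancel₀ _ hω0.ne', Real.sin_add_pi]) _ (hKsin ω hω0)
  have t2 := head_bound K (fun t => Real.sin (ω * t)) B hB.le hKi (fun t => Real.abs_sin_le_one _)
  have t3 : |Ksin ω| ≤ 3 * (Real.pi / ω) * K B + C := by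
    have := abs_add_le (Ksin ω - ∫ t in (0:ℝ)..B, K t * Real.sin (ω * t))
      (∫ t in (0:ℝ)..B, K t * Real.sin (ω * t))
    rw [sub_add_cancel] at this
    linarith
  rw [Real.dist_eq, sub_zero, abs_mul, abs_of_pos hω0]
  calc ω * |Ksin ω| ≤ ω * (3 * (Real.pi / ω) * K B + C) := by gcongr
    _ = 3 * Real.pi * K B + ω * C := by field_simp
    _ < 3 * Real.pi * (ε / (6 * Real.pi)) + ε / 2 := by gcongr
    _ = ε := by field_simp; ring

lemma cos_asymp (K Kcos : ℝ → ℝ)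
    (hKloc : ∀ A > 0, IntegrableOn K (Ioc 0 A))
    (hKpos : ∀ t > 0, 0 < K t)
    (hKdec : ∃ T > 0, AntitoneOn K (Ici T))
    (α : ℝ) (hα0 : 0 < α) (hα1 : α < 1) (cα : ℝ) (hcα : 0 < cα)
    (hKα : Tendsto (fun t => t ^ α * K t) atTop (nhds cα))
    (hKcos : ∀ ω > 0, Tendsto (fun A => ∫ t in (0:ℝ)..A, K t * Real.cos (ω * t))
      atTop (nhds (Kcos ω))) :
    ∃ C > 0, Tendsto (fun ω => ω ^ (1 - α) * Kcos ω) (nhdsWithin 0 (Ioi 0)) (nhds C) := by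
  obtain ⟨T, hT, hdec⟩ := hKdec
  obtain ⟨I, hI, hJ⟩ := cosLimit α hα0 hα1
  refine ⟨cα * I, by positivity, ?_⟩
  rw [Metric.tendsto_nhds]
  intro η hη
  have hπ := Real.pi_pos
  -- choose `M`
  have hM1 : Tendsto (fun M : ℝ => 3 * Real.pi * (M ^ (-α) * (2 * cα))) atTop (nhds 0) := by
    simpa using ((tendsto_rpow_neg_atTop hα0).mul_const (2 * cα)).const_mul (3 * Real.pi)
  have hM2 : Tendsto (fun M : ℝ => |cα * (∫ u in (0:ℝ)..M, u ^ (-α) * Real.cos u) - cα * I|) atTop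
      (nhds 0) := by
    simpa using ((hJ.const_mul cα).sub_const (cα * I)).abs
  have hη4 : 0 < η / 4 := by positivity
  obtain ⟨M, hMa, hMb, hM⟩ := ((hM1.eventually (gt_mem_nhds hη4)).and
    ((hM2.eventually (gt_mem_nhds hη4)).and (eventually_gt_atTop 0))).exists
  -- choose `ε`
  have hMα : 0 < M ^ (1 - α) := Real.rpow_pos_of_pos hM _
  have h1α : 0 < 1 - α := by linarith
  set ε := η / 4 * (1 - α) / M ^ (1 - α) with hε
  have hεpos : 0 < ε := by positivity
  obtain ⟨S, hS⟩ := eventually_atTop.1 (((Metric.tendsto_nhds.1 hKα) ε hεpos).and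
    (hKα.eventually (gt_mem_nhds (show cα < 2 * cα by linarith))))
  set B := max S T with hBdef
  have hBT : T ≤ B := le_max_right _ _
  have hBS : S ≤ B := le_max_left _ _
  have hB : 0 < B := by linarith
  set d : ℝ → ℝ := fun t => K t - cα * t ^ (-α) with hd
  have hrI : ∀ a b : ℝ, IntervalIntegrable (fun t : ℝ => t ^ (-α)) volume a b := fun a b =>
    intervalIntegral.intervalIntegrable_rpow' (by linarith)
  have hKi : ∀ A > 0, IntervalIntegrable K volume 0 A := fun A hA =>
    (intervalIntegrable_iff_integrableOn_Ioc_of_le hA.le).2 (hKloc A hA)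
  have hdi : ∀ A > 0, IntervalIntegrable d volume 0 A := fun A hA =>
    (hKi A hA).sub ((hrI 0 A).const_mul cα)
  have hdb : ∀ t, B ≤ t → |d t| ≤ ε * t ^ (-α) := by
    intro t ht
    have ht0 : 0 < t := by linarith
    have h := (hS t (by linarith)).1
    rw [Real.dist_eq] at h
    have hp := Real.rpow_pos_of_pos ht0 (-α)
    have hmul : t ^ (-α) * t ^ α = 1 := by
      rw [← Real.rpow_add ht0]; simp
    have : d t = t ^ (-α) * (t ^ α * K t - cα) := by
      rw [mul_sub, ← mul_assoc, hmul]; simp only [hd]; ring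
    rw [this, abs_mul, abs_of_pos hp, mul_comm ε]
    exact mul_le_mul_of_nonneg_left h.le hp.le
  set C := ∫ t in (0:ℝ)..B, |d t| with hC
  have hlim : Tendsto (fun ω : ℝ => ω ^ (1 - α) * C) (nhdsWithin 0 (Ioi 0)) (nhds 0) := by
    have := (Real.continuousAt_rpow_const 0 (1 - α) (Or.inr (by linarith))).tendsto.mul_const C
    have := this.mono_left (nhdsWithin_le_nhds (s := Ioi 0))
    simpa [Real.zero_rpow h1α.ne'] using this
  have hlarge : ∀ᶠ ω in nhdsWithin (0:ℝ) (Ioi 0), ω < M / B :=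
    (gt_mem_nhds (show 0 < M / B by positivity)).filter_mono nhdsWithin_le_nhds
  filter_upwards [self_mem_nhdsWithin, hlim.eventually (gt_mem_nhds hη4), hlarge] with ω hω hωC hωB
  have hω0 : 0 < ω := hω
  have hN : B < M / ω := by
    rw [lt_div_iff₀ hB] at hωB
    rw [lt_div_iff₀ hω0]; linarith
  set N := M / ω with hNdef
  have hN0 : 0 < N := by positivity
  have hωp : 0 < ω ^ (1 - α) := Real.rpow_pos_of_pos hω0 _
  have t1 := tail_lim K (fun t => Real.cos (ω * t)) hKloc N (Real.pi / ω) hN0 (by positivity)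
    (hdec.mono (Ici_subset_Ici.2 (by linarith))) hKpos (by fun_prop) (fun t => Real.abs_cos_le_one _)
    (fun t => by
      show Real.cos (ω * (t + Real.pi / ω)) = _
      rw [mul_add, mul_div_cancel₀ _ hω0.ne', Real.cos_add_pi]) _ (hKcos ω hω0)
  have hωα : ω ^ (1 - α) = ω * ω ^ (-α) := by
    rw [sub_eq_add_neg, Real.rpow_add hω0, Real.rpow_one]
  have t1' : ω ^ (1 - α) * (3 * (Real.pi / ω) * K N) < η / 4 := by
    refine lt_of_le_of_lt ?_ hMa
    have h2 := (hS N (by linarith)).2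
    have e : ω ^ (1 - α) * (3 * (Real.pi / ω) * K N) = 3 * Real.pi * (M ^ (-α) * (N ^ α * K N)) := by
      have : M ^ (-α) * N ^ α = ω ^ (-α) := by
        rw [hNdef, Real.div_rpow hM.le hω0.le, Real.rpow_neg hM.le, Real.rpow_neg hω0.le]
        have := (Real.rpow_pos_of_pos hM α).ne'
        field_simp
      rw [← mul_assoc (M ^ (-α)), this, hωα]
      field_simp
    rw [e]
    have := Real.rpow_pos_of_pos hM (-α)
    gcongr
  -- main term by substitution
  have t2 : ω ^ (1 - α) * ∫ t in (0:ℝ)..N, t ^ (-α) * Real.cos (ω * t)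
      = ∫ u in (0:ℝ)..M, u ^ (-α) * Real.cos u := by
    have := intervalIntegral.mul_integral_comp_mul_left (a := 0) (b := N)
      (f := fun u : ℝ => u ^ (-α) * Real.cos u) ω
    rw [mul_zero, hNdef, mul_div_cancel₀ _ hω0.ne', ← hNdef] at this
    rw [← this, hωα, mul_assoc, ← intervalIntegral.integral_const_mul (ω ^ (-α))]
    congr 1
    apply intervalIntegral.integral_congr
    intro t ht
    rw [uIcc_of_le hN0.le] at ht
    show ω ^ (-α) * (t ^ (-α) * Real.cos (ω * t)) = (ω * t) ^ (-α) * Real.cos (ω * t)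
    rw [Real.mul_rpow hω0.le ht.1]; ring
  have t3 : |∫ t in (0:ℝ)..N, d t * Real.cos (ω * t)| ≤ C + ε * (N ^ (1 - α) / (1 - α)) := by
    refine (head_bound d (fun t => Real.cos (ω * t)) N hN0.le (hdi N hN0)
      (fun t => Real.abs_cos_le_one _)).trans ?_
    have hdBN : IntervalIntegrable d volume B N := (hdi B hB).symm.trans (hdi N hN0)
    rw [← intervalIntegral.integral_add_adjacent_intervals (hdi B hB).abs hdBN.abs]
    gcongr
    calc ∫ t in B..N, |d t| ≤ ∫ t in B..N, ε * t ^ (-α) :=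
          intervalIntegral.integral_mono_on hN.le hdBN.abs ((hrI B N).const_mul ε)
            (fun t ht => hdb t ht.1)
      _ = ε * ((N ^ (1 - α) - B ^ (1 - α)) / (1 - α)) := by
          rw [intervalIntegral.integral_const_mul, integral_rpow (Or.inl (by linarith)),
            show -α + 1 = 1 - α by ring]
      _ ≤ ε * (N ^ (1 - α) / (1 - α)) := by
          have := Real.rpow_pos_of_pos hB (1 - α)
          gcongr; linarith
  have t3' : ω ^ (1 - α) * (ε * (N ^ (1 - α) / (1 - α))) = η / 4 := by
    rw [hNdef, Real.div_rpow hM.le hω0.le, hε]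
    field_simp
  have t4 : ∫ t in (0:ℝ)..N, d t * Real.cos (ω * t) = (∫ t in (0:ℝ)..N, K t * Real.cos (ω * t))
      - cα * ∫ t in (0:ℝ)..N, t ^ (-α) * Real.cos (ω * t) := by
    have hc : ContinuousOn (fun t : ℝ => Real.cos (ω * t)) (uIcc 0 N) := by fun_prop
    rw [← intervalIntegral.integral_const_mul, ← intervalIntegral.integral_sub
      ((hKi N hN0).mul_continuousOn hc) (((hrI 0 N).mul_continuousOn hc).const_mul cα)]
    congr 1; ext t; simp only [hd]; ring
  rw [Real.dist_eq]
  have split : ω ^ (1 - α) * Kcos ω - cα * I =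
      ω ^ (1 - α) * (Kcos ω - ∫ t in (0:ℝ)..N, K t * Real.cos (ω * t))
      + ω ^ (1 - α) * (∫ t in (0:ℝ)..N, d t * Real.cos (ω * t))
      + (cα * (∫ u in (0:ℝ)..M, u ^ (-α) * Real.cos u) - cα * I) := by
    rw [t4, ← t2]; ring
  rw [split]
  have b1 : |ω ^ (1 - α) * (Kcos ω - ∫ t in (0:ℝ)..N, K t * Real.cos (ω * t))| < η / 4 := by
    rw [abs_mul, abs_of_pos hωp]
    exact lt_of_le_of_lt (mul_le_mul_of_nonneg_left t1 hωp.le) t1'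
  have b2 : |ω ^ (1 - α) * (∫ t in (0:ℝ)..N, d t * Real.cos (ω * t))| < η / 4 + η / 4 := by
    rw [abs_mul, abs_of_pos hωp]
    refine lt_of_le_of_lt (mul_le_mul_of_nonneg_left t3 hωp.le) ?_
    rw [mul_add, t3']
    linarith
  have := abs_add_three (ω ^ (1 - α) * (Kcos ω - ∫ t in (0:ℝ)..N, K t * Real.cos (ω * t)))
    (ω ^ (1 - α) * (∫ t in (0:ℝ)..N, d t * Real.cos (ω * t)))
    (cα * (∫ u in (0:ℝ)..M, u ^ (-α) * Real.cos u) - cα * I)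
  linarith

lemma ind_meas (K G g : ℝ → ℝ) (hg : Continuous g) (hg1 : ∀ t, |g t| ≤ 1)
    (hKloc : ∀ A > 0, IntegrableOn K (Ioc 0 A))
    (hG : ∀ ω > 0, Tendsto (fun A => ∫ t in (0:ℝ)..A, K t * g (ω * t))
      atTop (nhds (G ω))) : Measurable (indicator (Ioi 0) G) := by
  have hc : ∀ n : ℕ, Continuous (fun ω => ∫ t in (0:ℝ)..((n:ℝ)+1), K t * g (ω * t)) := by
    intro n
    have hn : (0:ℝ) < n + 1 := by positivity
    have hKi := (intervalIntegrable_iff_integrableOn_Ioc_of_le hn.le).2 (hKloc _ hn)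
    apply intervalIntegral.continuous_of_dominated_interval (bound := fun t => |K t|)
    · intro ω
      have hcc : Continuous (fun t : ℝ => g (ω * t)) := by fun_prop
      exact (intervalIntegrable_iff.1 (hKi.mul_continuousOn hcc.continuousOn)).aestronglyMeasurable
    · intro ω
      refine ae_of_all _ (fun t _ => ?_)
      rw [Real.norm_eq_abs, abs_mul]
      exact mul_le_of_le_one_right (abs_nonneg _) (hg1 _)
    · exact hKi.abs
    · refine ae_of_all _ (fun t _ => ?_)
      fun_prop
  refine measurable_of_tendsto_metrizable
    (f := fun n : ℕ => indicator (Ioi 0) (fun ω => ∫ t in (0:ℝ)..((n:ℝ)+1), K t * g (ω * t)))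
    (fun n => (hc n).measurable.indicator measurableSet_Ioi) ?_
  rw [tendsto_pi_nhds]
  intro ω
  by_cases hω : 0 < ω
  · simp only [indicator_of_mem (mem_Ioi.2 hω)]
    exact (hG ω hω).comp (tendsto_atTop_add_const_right _ 1 tendsto_natCast_atTop_atTop)
  · simp only [indicator_of_notMem (s := Ioi (0:ℝ)) hω]
    exact tendsto_const_nhds

/-- Diffusive growth of the mean squared displacement of the integrated
position for the harmonically bounded GLE when `K(t) ∼ c_α t^{−α}`, `α ∈ (0,1)`:
`t^{α−2} ∫₀^∞ (1 − cos(tω)) ω⁻² r₁₁(ω) dω → c ∈ (0,∞)` as `t → ∞`,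
i.e. superdiffusive growth `t^{2−α}` of the MSD. -/
theorem msd_superdiffusive_kernel
    (K : ℝ → ℝ)
    (hKloc : ∀ A > 0, IntegrableOn K (Ioc 0 A))
    (hKpos : ∀ t > 0, 0 < K t)
    (hKdec : ∃ T > 0, AntitoneOn K (Ici T))
    (hK0 : Tendsto K atTop (nhds 0))
    (α : ℝ) (hα : α ∈ Set.Ioo (0:ℝ) 1) (cα : ℝ) (hcα : 0 < cα)
    (hKα : Tendsto (fun t => t ^ α * K t) atTop (nhds cα))
    (Kcos Ksin : ℝ → ℝ)
    (hKcos : ∀ ω > 0, Tendsto (fun A => ∫ t in (0:ℝ)..A, K t * Real.cos (ω * t))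
      atTop (nhds (Kcos ω)))
    (hKsin : ∀ ω > 0, Tendsto (fun A => ∫ t in (0:ℝ)..A, K t * Real.sin (ω * t))
      atTop (nhds (Ksin ω)))
    (hKcospos : ∀ ω > 0, 0 < Kcos ω)
    (m lam β γ : ℝ) (hm : 0 < m) (hlam : 0 < lam) (hβ : 0 < β) (hγ : 0 < γ)
    (r11 : ℝ → ℝ)
    (hr11 : ∀ ω > 0, r11 ω =
      2 * (lam + β * Kcos ω) /
        ((γ - m * ω ^ 2 + β * ω * Ksin ω) ^ 2 + ω ^ 2 * (lam + β * Kcos ω) ^ 2)) :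
    ∃ c > 0, Tendsto
      (fun t => t ^ (α - 2) * ∫ ω in Ioi (0:ℝ), (1 - Real.cos (t * ω)) / ω ^ 2 * r11 ω)
      atTop (nhds c) := by
  obtain ⟨hα0, hα1⟩ := hα
  have h1α : 0 < 1 - α := by linarith
  obtain ⟨C, hC, hCl⟩ := cos_asymp K Kcos hKloc hKpos hKdec α hα0 hα1 cα hcα hKα hKcos
  have hS := sin_small K Ksin hKloc hKpos hKdec hK0 hKsin
  have hrp : ∀ p : ℝ, 0 < p → Tendsto (fun ω : ℝ => ω ^ p) (nhdsWithin 0 (Ioi 0)) (nhds 0) := by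
    intro p hp
    have := (Real.continuousAt_rpow_const 0 p (Or.inr hp.le)).tendsto.mono_left
      (nhdsWithin_le_nhds (s := Ioi 0))
    simpa [Real.zero_rpow hp.ne'] using this
  have hid : Tendsto (fun ω : ℝ => ω) (nhdsWithin 0 (Ioi 0)) (nhds 0) := nhdsWithin_le_nhds
  have hKc : Tendsto (fun ω => ω * Kcos ω) (nhdsWithin 0 (Ioi 0)) (nhds 0) := by
    have := (hrp α hα0).mul hCl
    rw [zero_mul] at this
    refine this.congr' ?_
    filter_upwards [self_mem_nhdsWithin] with ω hω
    rw [← mul_assoc, ← Real.rpow_add hω]; simp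
  set D := 2 * (β * C) / γ ^ 2 with hD
  have hDpos : 0 < D := by positivity
  have hr : Tendsto (fun ω => ω ^ (1 - α) * r11 ω) (nhdsWithin 0 (Ioi 0)) (nhds D) := by
    have num := (((hrp _ h1α).const_mul lam).add (hCl.const_mul β)).const_mul 2
    have den := ((((hid.pow 2).const_mul m).const_sub γ).add (hS.const_mul β)).pow 2 |>.add
      (((hid.const_mul lam).add (hKc.const_mul β)).pow 2)
    have := num.div den (by simp; positivity)
    have e : 2 * (lam * 0 + β * C) / ((γ - m * 0 ^ 2 + β * 0) ^ 2 + (lam * 0 + β * 0) ^ 2) = D := by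
      rw [hD]; simp
    rw [e] at this
    refine this.congr' ?_
    filter_upwards [self_mem_nhdsWithin] with ω hω
    rw [hr11 ω hω, Pi.div_apply, ← mul_div_assoc]
    congr 1 <;> ring
  have hb0 : ∀ ω > 0, 0 < lam + β * Kcos ω := fun ω hω => by
    have := hKcospos ω hω; positivity
  have hrnn : ∀ ω > 0, 0 ≤ r11 ω := fun ω hω => by
    rw [hr11 ω hω]; have := hb0 ω hω; positivity
  have hrle : ∀ ω > 0, r11 ω ≤ 2 / (lam * ω ^ 2) := fun ω hω => by
    have h1 := hb0 ω hω
    have h2 : lam ≤ lam + β * Kcos ω := by have := hKcospos ω hω; nlinarith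
    rw [hr11 ω hω]
    generalize lam + β * Kcos ω = b at *
    rw [div_le_div_iff₀ (by positivity) (by positivity)]
    have h3 : lam * b * ω ^ 2 ≤ ω ^ 2 * b ^ 2 := by
      have : lam * b ≤ b * b := by gcongr
      nlinarith [sq_nonneg ω]
    nlinarith [sq_nonneg (γ - m * ω ^ 2 + β * ω * Ksin ω)]
  -- global bound
  obtain ⟨E, hE⟩ : ∃ E, ∀ ω > 0, r11 ω ≤ E * ω ^ (α - 1) := by
    have hev := hr.eventually (gt_mem_nhds (show D < D + 1 by linarith))
    obtain ⟨δ, hδ, hδs⟩ := mem_nhdsGT_iff_exists_Ioo_subset.1 hev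
    have hδ0 : 0 < δ := hδ
    refine ⟨max (D + 1) (2 / lam * δ ^ (-1 - α)), fun ω hω => ?_⟩
    have hp := Real.rpow_pos_of_pos hω (α - 1)
    rcases lt_or_ge ω δ with h | h
    · have h2 : ω ^ (1 - α) * r11 ω < D + 1 := hδs ⟨hω, h⟩
      have : r11 ω = (ω ^ (1 - α) * r11 ω) * ω ^ (α - 1) := by
        rw [mul_right_comm, ← Real.rpow_add hω]; simp
      rw [this]
      exact mul_le_mul_of_nonneg_right (h2.le.trans (le_max_left _ _)) hp.le
    · calc r11 ω ≤ 2 / (lam * ω ^ 2) := hrle ω hω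
        _ = 2 / lam * ω ^ (-1 - α) * ω ^ (α - 1) := by
          rw [mul_assoc, ← Real.rpow_add hω, show -1 - α + (α - 1) = -2 by ring,
            Real.rpow_neg hω.le, Real.rpow_two]
          field_simp
        _ ≤ 2 / lam * δ ^ (-1 - α) * ω ^ (α - 1) := by
          have := Real.rpow_le_rpow_of_nonpos hδ0 h (show -1 - α ≤ 0 by linarith)
          gcongr
        _ ≤ _ := mul_le_mul_of_nonneg_right (le_max_right _ _) hp.le
  -- measurability
  have mc := ind_meas K Kcos Real.cos Real.continuous_cos Real.abs_cos_le_one hKloc hKcos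
  have ms := ind_meas K Ksin Real.sin Real.continuous_sin Real.abs_sin_le_one hKloc hKsin
  set R : ℝ → ℝ := fun ω => 2 * (lam + β * indicator (Ioi 0) Kcos ω) /
    ((γ - m * ω ^ 2 + β * ω * indicator (Ioi 0) Ksin ω) ^ 2
      + ω ^ 2 * (lam + β * indicator (Ioi 0) Kcos ω) ^ 2) with hR
  have hRm : Measurable R := by fun_prop
  have hRr : ∀ ω > 0, R ω = r11 ω := fun ω hω => by
    simp only [hR, indicator_of_mem (mem_Ioi.2 hω), hr11 ω hω]
  obtain ⟨hi, hpos⟩ := oneSubCos (3 - α) (by linarith) (by linarith)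
  refine ⟨D * ∫ u in Ioi (0:ℝ), (1 - Real.cos u) * u ^ (-(3 - α)), by positivity, ?_⟩
  rw [← integral_const_mul]
  have hu3 : ∀ u > (0:ℝ), u ^ (-(3 - α)) = u ^ (α - 1) / u ^ 2 := fun u hu => by
    rw [show -(3 - α) = α - 1 - 2 by ring, Real.rpow_sub hu, Real.rpow_two]
  have main : Tendsto (fun t : ℝ => ∫ u in Ioi (0:ℝ),
      (1 - Real.cos u) / u ^ 2 * (t ^ (α - 1) * R (u / t))) atTop
      (nhds (∫ u in Ioi (0:ℝ), D * ((1 - Real.cos u) * u ^ (-(3 - α))))) := by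
    apply tendsto_integral_filter_of_dominated_convergence
      (fun u => E * ((1 - Real.cos u) * u ^ (-(3 - α))))
    · refine Eventually.of_forall (fun t => ?_)
      have : Measurable (fun u : ℝ => R (u / t)) := hRm.comp (measurable_id.div_const t)
      apply Measurable.aestronglyMeasurable
      fun_prop
    · filter_upwards [eventually_gt_atTop 0] with t ht
      refine (ae_restrict_iff' measurableSet_Ioi).2 (ae_of_all _ (fun u hu => ?_))
      have hu0 : 0 < u := hu
      have hut : 0 < u / t := by positivity
      have hcs : 0 ≤ 1 - Real.cos u := by linarith [Real.cos_le_one u]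
      have htp := Real.rpow_pos_of_pos ht (α - 1)
      have hrn := hrnn _ hut
      rw [hRr _ hut, Real.norm_eq_abs, abs_of_nonneg (by positivity), hu3 u hu0]
      have : t ^ (α - 1) * r11 (u / t) ≤ E * u ^ (α - 1) := by
        calc t ^ (α - 1) * r11 (u / t) ≤ t ^ (α - 1) * (E * (u / t) ^ (α - 1)) := by
              gcongr; exact hE _ hut
          _ = E * u ^ (α - 1) := by
              rw [Real.div_rpow hu0.le ht.le]; field_simp
      calc (1 - Real.cos u) / u ^ 2 * (t ^ (α - 1) * r11 (u / t))
          ≤ (1 - Real.cos u) / u ^ 2 * (E * u ^ (α - 1)) := by gcongr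
        _ = _ := by ring
    · exact hi.const_mul E
    · refine (ae_restrict_iff' measurableSet_Ioi).2 (ae_of_all _ (fun u hu => ?_))
      have hu0 : 0 < u := hu
      have hto : Tendsto (fun t : ℝ => u / t) atTop (nhdsWithin 0 (Ioi 0)) := by
        rw [tendsto_nhdsWithin_iff]
        refine ⟨tendsto_const_nhds.div_atTop tendsto_id, ?_⟩
        filter_upwards [eventually_gt_atTop 0] with t ht
        exact div_pos hu0 ht
      have h1 := ((hr.comp hto).mul_const (u ^ (α - 1))).const_mul ((1 - Real.cos u) / u ^ 2)
      rw [show (1 - Real.cos u) / u ^ 2 * (D * u ^ (α - 1))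
        = D * ((1 - Real.cos u) * u ^ (-(3 - α))) by rw [hu3 u hu0]; ring] at h1
      refine h1.congr' ?_
      filter_upwards [eventually_gt_atTop 0] with t ht
      have hut : 0 < u / t := by positivity
      rw [hRr _ hut]
      congr 1
      simp only [Function.comp]
      rw [show α - 1 = -(1 - α) by ring, Real.rpow_neg hu0.le, Real.rpow_neg ht.le,
        Real.div_rpow hu0.le ht.le]
      have := Real.rpow_pos_of_pos hu0 (1 - α)
      field_simp
  refine main.congr' ?_
  filter_upwards [eventually_gt_atTop 0] with t ht
  have sub := integral_comp_mul_left_Ioi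
    (fun u => (1 - Real.cos u) / u ^ 2 * (t ^ (α - 1) * R (u / t))) 0 ht
  rw [mul_zero, smul_eq_mul, eq_inv_mul_iff_mul_eq₀ ht.ne'] at sub
  rw [← sub, ← integral_const_mul, ← integral_const_mul]
  refine setIntegral_congr_fun measurableSet_Ioi (fun ω hω => ?_)
  have hω0 : 0 < ω := hω
  rw [mul_div_cancel_left₀ _ ht.ne', hRr ω hω0, show α - 2 = α - 1 - 1 by ring,
    Real.rpow_sub ht (α - 1) 1, Real.rpow_one]
  field_simp
end

section
/- Let K : (0,∞) → ℝ be locally integrable, positive, eventually decreasing, with K(t) → 0 as t → ∞, and suppose one of the following holds: (a) K is integrable on (0,∞); or (b) t·K(t) → c₁ for some c₁ ∈ (0,∞) as t → ∞; or (c) t^α·K(t) → c_α for some α ∈ (0,1) and c_α ∈ (0,∞) as t → ∞. Let 𝒦cos, 𝒦sin : (0,∞) → ℝ satisfy, for every ω > 0, ∫₀^A K(t)cos(ωt)dt → 𝒦cos(ω) and ∫₀^A K(t)sin(ωt)dt → 𝒦sin(ω) as A → ∞, and assume 𝒦cos(ω) > 0 for all ω > 0. Let m, λ, β, γ > 0 and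 set r₁₁(ω) = 2(λ + β·𝒦cos(ω)) / ((γ − m·ω² + β·ω·𝒦sin(ω))² + ω²·(λ + β·𝒦cos(ω))²). Then r₁₁ is integrable on (0,∞) and ω ↦ ω²·r₁₁(ω) is integrable on (0,∞). -/
open MeasureTheory Filter Set

lemma tail_bound_s7 (K : ℝ → ℝ) (X : ℝ) (hK : AntitoneOn K (Ici X)) (hnn : ∀ t ≥ X, 0 ≤ K t)
    (c : ℝ → ℝ) (hc : Continuous c) (hb : ∀ t, |c t| ≤ 1) (h : ℝ) (hh : 0 < h)
    (hper : ∀ t, c (t + h) = - c t) (Y : ℝ) (hY : X + h ≤ Y) :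
    |∫ t in X..Y, K t * c t| ≤ 3 * h * K X := by
  have hKi : ∀ a b, X ≤ a → X ≤ b → IntervalIntegrable K volume a b := by
    intro a b ha hb
    apply AntitoneOn.intervalIntegrable
    apply hK.mono
    intro x hx
    have := hx.1
    exact le_trans (le_inf ha hb) this
  have hGi : ∀ a b, X + h ≤ a → X + h ≤ b → IntervalIntegrable (fun s => K (s - h)) volume a b := by
    intro a b ha hb
    have := (hKi (a - h) (b - h) (by linarith) (by linarith)).comp_sub_right h
    simpa using this
  have hKc : ∀ a b, X ≤ a → X ≤ b → IntervalIntegrable (fun t => K t * c t) volume a b :=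
    fun a b ha hb => (hKi a b ha hb).mul_continuousOn hc.continuousOn
  have hGc : ∀ a b, X + h ≤ a → X + h ≤ b →
      IntervalIntegrable (fun s => K (s - h) * c s) volume a b :=
    fun a b ha hb => (hGi a b ha hb).mul_continuousOn hc.continuousOn
  have habs : ∀ x y : ℝ, |x * c y| ≤ |x| := by
    intro x y
    rw [abs_mul]
    exact mul_le_of_le_one_right (abs_nonneg _) (hb y)
  have e1 : ∫ s in (X + h)..(Y + h), K (s - h) * c s = - ∫ t in X..Y, K t * c t := by
    rw [← intervalIntegral.integral_comp_add_right (fun s => K (s - h) * c s) h]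
    simp [hper]
  have e2 : ∫ t in X..Y, K t * c t
      = (∫ t in X..(X + h), K t * c t) + ∫ t in (X + h)..Y, K t * c t :=
    (intervalIntegral.integral_add_adjacent_intervals (hKc _ _ le_rfl (by linarith))
      (hKc _ _ (by linarith) (by linarith))).symm
  have e3 : ∫ s in (X + h)..(Y + h), K (s - h) * c s
      = (∫ s in (X + h)..Y, K (s - h) * c s) + ∫ s in Y..(Y + h), K (s - h) * c s :=
    (intervalIntegral.integral_add_adjacent_intervals (hGc _ _ le_rfl (by linarith))
      (hGc _ _ (by linarith) (by linarith))).symm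
  have e4 : (∫ s in (X + h)..Y, K (s - h) * c s) - ∫ t in (X + h)..Y, K t * c t
      = ∫ s in (X + h)..Y, (K (s - h) - K s) * c s := by
    rw [← intervalIntegral.integral_sub (hGc _ _ le_rfl (by linarith))
      (hKc _ _ (by linarith) (by linarith))]
    congr 1; ext s; ring
  have b1 : |∫ t in X..(X + h), K t * c t| ≤ h * K X := by
    have := intervalIntegral.norm_integral_le_of_norm_le_const (a := X) (b := X + h)
      (f := fun t => K t * c t) (C := K X) (by
        intro x hx
        rw [uIoc_of_le (by linarith)] at hx
        refine (habs _ _).trans ?_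
        rw [abs_of_nonneg (hnn x hx.1.le)]
        exact hK (mem_Ici.2 le_rfl) (mem_Ici.2 hx.1.le) hx.1.le)
    rw [Real.norm_eq_abs, show X + h - X = h by ring, abs_of_pos hh] at this
    linarith
  have b3 : |∫ s in Y..(Y + h), K (s - h) * c s| ≤ h * K X := by
    have := intervalIntegral.norm_integral_le_of_norm_le_const (a := Y) (b := Y + h)
      (f := fun s => K (s - h) * c s) (C := K X) (by
        intro x hx
        rw [uIoc_of_le (by linarith)] at hx
        have h1 := hx.1
        refine (habs _ _).trans ?_
        rw [abs_of_nonneg (hnn (x - h) (by linarith))]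
        exact hK (mem_Ici.2 le_rfl) (mem_Ici.2 (by linarith)) (by linarith))
    rw [Real.norm_eq_abs, show Y + h - Y = h by ring, abs_of_pos hh] at this
    linarith
  have b2 : |∫ s in (X + h)..Y, (K (s - h) - K s) * c s| ≤ h * K X := by
    have hle : |∫ s in (X + h)..Y, (K (s - h) - K s) * c s|
        ≤ ∫ s in (X + h)..Y, (K (s - h) - K s) := by
      have := intervalIntegral.norm_integral_le_of_norm_le (μ := volume) (a := X + h) (b := Y)
        (f := fun s => (K (s - h) - K s) * c s) (g := fun s => K (s - h) - K s) hY
        (by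
          refine Filter.Eventually.of_forall ?_
          intro x hx
          have h1 := hx.1
          refine (habs _ _).trans ?_
          rw [abs_of_nonneg]
          have := hK (mem_Ici.2 (by linarith : X ≤ x - h)) (mem_Ici.2 (by linarith : X ≤ x))
            (by linarith)
          linarith)
        ((hGi _ _ le_rfl (by linarith)).sub (hKi _ _ (by linarith) (by linarith)))
      simpa using this
    have f1 : ∫ s in (X + h)..Y, (K (s - h) - K s)
        = (∫ s in (X + h)..Y, K (s - h)) - ∫ s in (X + h)..Y, K s :=
      intervalIntegral.integral_sub (hGi _ _ le_rfl (by linarith))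
        (hKi _ _ (by linarith) (by linarith))
    have f2 : ∫ s in (X + h)..Y, K (s - h) = ∫ s in X..(Y - h), K s := by
      rw [intervalIntegral.integral_comp_sub_right (fun s => K s) h]; simp
    have f3 := intervalIntegral.integral_add_adjacent_intervals (hKi X (X + h) le_rfl (by linarith))
      (hKi (X + h) Y (by linarith) (by linarith))
    have f4 := intervalIntegral.integral_add_adjacent_intervals
      (hKi X (Y - h) le_rfl (by linarith))
      (hKi (Y - h) Y (by linarith) (by linarith))
    have f5 : 0 ≤ ∫ s in (Y - h)..Y, K s :=
      intervalIntegral.integral_nonneg (by linarith) (fun u hu => hnn u (by linarith [hu.1]))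
    have f6 : ∫ s in X..(X + h), K s ≤ ∫ s in X..(X + h), K X :=
      intervalIntegral.integral_mono_on (by linarith) (hKi _ _ le_rfl (by linarith)) (by simp)
        (fun x hx => hK (mem_Ici.2 le_rfl) (mem_Ici.2 hx.1) hx.1)
    rw [intervalIntegral.integral_const] at f6
    simp only [smul_eq_mul] at f6
    have : (X + h - X) * K X = h * K X := by ring
    linarith
  rw [abs_le] at *
  constructor <;> nlinarith [b1.1, b1.2, b2.1, b2.2, b3.1, b3.2]

lemma lim_bound (K : ℝ → ℝ) (hKloc : ∀ A > 0, IntegrableOn K (Ioc 0 A))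
    (hKpos : ∀ t > 0, 0 < K t) (X : ℝ) (hX : 0 < X) (hK : AntitoneOn K (Ici X))
    (c : ℝ → ℝ) (hc : Continuous c) (hb : ∀ t, |c t| ≤ 1) (h : ℝ) (hh : 0 < h)
    (hper : ∀ t, c (t + h) = - c t) (L : ℝ)
    (hL : Tendsto (fun A => ∫ t in (0:ℝ)..A, K t * c t) atTop (nhds L)) :
    |L| ≤ (∫ t in (0:ℝ)..X, K t) + 3 * h * K X := by
  refine le_of_tendsto hL.abs ?_
  filter_upwards [eventually_ge_atTop (X + h)] with Y hY
  have hKi : ∀ b > 0, IntervalIntegrable K volume 0 b := fun b hb =>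
    (intervalIntegrable_iff_integrableOn_Ioc_of_le hb.le).2 (hKloc b hb)
  have hi : ∀ b > 0, IntervalIntegrable (fun t => K t * c t) volume 0 b := fun b hb =>
    (hKi b hb).mul_continuousOn hc.continuousOn
  have hY0 : 0 < Y := by linarith
  rw [← intervalIntegral.integral_add_adjacent_intervals (hi X hX)
    ((hi X hX).symm.trans (hi Y hY0))]
  refine (abs_add_le _ _).trans (add_le_add ?_ ?_)
  · rw [← Real.norm_eq_abs]
    refine intervalIntegral.norm_integral_le_of_norm_le (μ := volume) hX.le
      (Filter.Eventually.of_forall ?_) (hKi X hX)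
    intro x hx
    rw [Real.norm_eq_abs, abs_mul, abs_of_pos (hKpos x hx.1)]
    exact mul_le_of_le_one_right (hKpos x hx.1).le (hb x)
  · exact tail_bound_s7 K X hK (fun t ht => (hKpos t (by linarith)).le) c hc hb h hh hper Y hY

lemma decay (K : ℝ → ℝ) 
    (hKpos : ∀ t > 0, 0 < K t)
    (hKdec : ∃ T > 0, AntitoneOn K (Ici T))
    (hKcase : IntegrableOn K (Ioi 0) ∨
      (∃ c₁ > 0, Tendsto (fun t => t * K t) atTop (nhds c₁)) ∨
      (∃ α ∈ Set.Ioo (0:ℝ) 1, ∃ cα > 0,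
        Tendsto (fun t => t ^ α * K t) atTop (nhds cα))) :
    ∃ α ∈ Set.Ioo (0:ℝ) 1, ∃ C > 0, ∃ T ≥ 1, AntitoneOn K (Ici T) ∧
      ∀ t ≥ T, K t ≤ C * t ^ (-α) := by
  obtain ⟨T, hT, hanti⟩ := hKdec
  -- it suffices to bound `t ^ α * K t` eventually
  have key : ∀ α ∈ Set.Ioo (0:ℝ) 1, ∀ C > 0, (∀ᶠ t in atTop, t ^ α * K t ≤ C) →
      ∃ α ∈ Set.Ioo (0:ℝ) 1, ∃ C > 0, ∃ T ≥ 1, AntitoneOn K (Ici T) ∧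
      ∀ t ≥ T, K t ≤ C * t ^ (-α) := by
    intro α hα C hC hev
    obtain ⟨S, hS⟩ := eventually_atTop.1 hev
    refine ⟨α, hα, C, hC, max 1 (max S T), le_max_left _ _,
      hanti.mono (Ici_subset_Ici.2 ((le_max_right _ _).trans (le_max_right _ _))), ?_⟩
    intro t ht
    have h1 : 1 ≤ t := (le_max_left _ _).trans ht
    have h2 : S ≤ t := ((le_max_left _ _).trans (le_max_right _ _)).trans ht
    have h3 := hS t h2
    have hp : 0 < t ^ α := Real.rpow_pos_of_pos (by linarith) _
    rw [Real.rpow_neg (by linarith), ← div_eq_mul_inv, le_div_iff₀ hp]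
    linarith
  have key2 : ∀ C > 0, (∀ᶠ t in atTop, t * K t ≤ C) →
      ∃ α ∈ Set.Ioo (0:ℝ) 1, ∃ C > 0, ∃ T ≥ 1, AntitoneOn K (Ici T) ∧
      ∀ t ≥ T, K t ≤ C * t ^ (-α) := by
    intro C hC hev
    refine key (1/2) (by norm_num) C hC ?_
    filter_upwards [hev, eventually_ge_atTop 1] with t ht h1
    refine le_trans ?_ ht
    refine mul_le_mul_of_nonneg_right ?_ (hKpos t (by linarith)).le
    calc t ^ (1/2:ℝ) ≤ t ^ (1:ℝ) := Real.rpow_le_rpow_of_exponent_le h1 (by norm_num)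
      _ = t := Real.rpow_one t
  rcases hKcase with hI | ⟨c, hc, hlim⟩ | ⟨α, hα, c, hc, hlim⟩
  · have hnn : 0 ≤ ∫ t in Ioi (0:ℝ), K t :=
      setIntegral_nonneg measurableSet_Ioi (fun t ht => (hKpos t ht).le)
    refine key2 (2 * (∫ t in Ioi (0:ℝ), K t) + 1) (by linarith) ?_
    filter_upwards [eventually_ge_atTop (2 * T)] with t ht
    have h1 : ∫ s in Ioc (t/2) t, K s ≤ ∫ t in Ioi (0:ℝ), K t := by
      refine setIntegral_mono_set hI ?_ ?_
      · exact (ae_restrict_iff' measurableSet_Ioi).2 (Eventually.of_forall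
          fun x hx => (hKpos x hx).le)
      · exact Eventually.of_forall (fun x hx => lt_of_le_of_lt (by linarith : 0 ≤ t/2) hx.1)
    rw [← intervalIntegral.integral_of_le (by linarith)] at h1
    have hint : IntervalIntegrable K volume (t/2) t := by
      rw [intervalIntegrable_iff_integrableOn_Ioc_of_le (by linarith)]
      exact hI.mono_set (fun x hx => lt_of_le_of_lt (by linarith : 0 ≤ t/2) hx.1)
    have h2 : ∫ s in (t/2)..t, K t ≤ ∫ s in (t/2)..t, K s :=
      intervalIntegral.integral_mono_on (by linarith) (by simp) hint
        (fun x hx => hanti (mem_Ici.2 (by linarith [hx.1])) (mem_Ici.2 (by linarith)) hx.2)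
    rw [intervalIntegral.integral_const, smul_eq_mul] at h2
    linarith
  · refine key2 (c + 1) (by linarith) ?_
    filter_upwards [hlim.eventually (gt_mem_nhds (lt_add_one c))] with t ht using ht.le
  · refine key α hα (c + 1) (by linarith) ?_
    filter_upwards [hlim.eventually (gt_mem_nhds (lt_add_one c))] with t ht using ht.le

lemma main_bound (K : ℝ → ℝ) (hKloc : ∀ A > 0, IntegrableOn K (Ioc 0 A))
    (hKpos : ∀ t > 0, 0 < K t) (α : ℝ) (hα : α ∈ Set.Ioo (0:ℝ) 1) (C : ℝ) (hC : 0 < C) 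
    (T : ℝ) (hT : 1 ≤ T) (hanti : AntitoneOn K (Ici T)) (hdec : ∀ t ≥ T, K t ≤ C * t ^ (-α)) :
    ∃ A > 0, ∃ B > 0, ∀ ω > 0, ∀ c : ℝ → ℝ, Continuous c → (∀ t, |c t| ≤ 1) → 
      (∀ t, c (t + Real.pi / ω) = - c t) → ∀ L : ℝ, 
      Tendsto (fun A => ∫ t in (0:ℝ)..A, K t * c t) atTop (nhds L) → 
      |L| ≤ A + B * ω ^ (α - 1) := by
  obtain ⟨ha0, ha1⟩ := hα
  have hT0 : 0 < T := by linarith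
  have hI0 : 0 ≤ ∫ t in (0:ℝ)..T, K t := by
    rw [intervalIntegral.integral_of_le hT0.le]
    exact setIntegral_nonneg measurableSet_Ioc (fun t ht => (hKpos t ht.1).le)
  set I := ∫ t in (0:ℝ)..T, K t with hI
  set D := C / (1 - α) + 12 * C with hD
  have hD0 : 0 < D := by
    have : 0 < 1 - α := by linarith
    positivity
  have hTp : 0 < T ^ (1 - α) := Real.rpow_pos_of_pos hT0 _
  refine ⟨I + D * T ^ (1 - α), by positivity, D, hD0, ?_⟩
  intro ω hω c hc hb hper L hL
  set X := max T (1 / ω) with hX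
  have hTX : T ≤ X := le_max_left _ _
  have hX0 : 0 < X := by linarith
  have hωX : 1 / ω ≤ X := le_max_right _ _
  have h1 := lim_bound K hKloc hKpos X hX0 (hanti.mono (Ici_subset_Ici.2 hTX)) c hc hb
    (Real.pi / ω) (by positivity) hper L hL
  have hKi : ∀ b > 0, IntervalIntegrable K volume 0 b := fun b hb =>
    (intervalIntegrable_iff_integrableOn_Ioc_of_le hb.le).2 (hKloc b hb)
  have h2 : ∫ t in (0:ℝ)..X, K t ≤ I + C / (1 - α) * X ^ (1 - α) := by
    rw [← intervalIntegral.integral_add_adjacent_intervals (hKi T hT0)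
      ((hKi T hT0).symm.trans (hKi X hX0))]
    have : ∫ t in T..X, K t ≤ ∫ t in T..X, C * t ^ (-α) := by
      refine intervalIntegral.integral_mono_on hTX ((hKi T hT0).symm.trans (hKi X hX0)) ?_
        (fun x hx => hdec x hx.1)
      exact (intervalIntegral.intervalIntegrable_rpow' (by linarith)).const_mul C
    rw [intervalIntegral.integral_const_mul, integral_rpow (Or.inl (by linarith)),
      show -α + 1 = 1 - α by ring] at this
    have h3 : C * ((X ^ (1 - α) - T ^ (1 - α)) / (1 - α)) ≤ C / (1 - α) * X ^ (1 - α) := by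
      have h4 : 0 < 1 - α := by linarith
      have : C * ((X ^ (1 - α) - T ^ (1 - α)) / (1 - α)) 
        = C / (1 - α) * X ^ (1 - α) - C / (1 - α) * T ^ (1 - α) := by ring
      have : 0 ≤ C / (1 - α) * T ^ (1 - α) := by positivity
      linarith
    linarith
  have h3 : 3 * (Real.pi / ω) * K X ≤ 12 * C * X ^ (1 - α) := by
    have hpi : Real.pi / ω ≤ 4 * X := by
      have := Real.pi_lt_four
      calc Real.pi / ω = Real.pi * (1 / ω) := by ring
        _ ≤ 4 * X := by gcongr
    have e : X ^ (1 - α) = X * X ^ (-α) := by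
      rw [sub_eq_add_neg, Real.rpow_add hX0, Real.rpow_one]
    have hk := hdec X hTX
    have hk0 := hKpos X hX0
    calc 3 * (Real.pi / ω) * K X ≤ 3 * (4 * X) * (C * X ^ (-α)) := by gcongr
      _ = 12 * C * X ^ (1 - α) := by rw [e]; ring
  have h4 : X ^ (1 - α) ≤ T ^ (1 - α) + ω ^ (α - 1) := by
    have e : (1 / ω) ^ (1 - α) = ω ^ (α - 1) := by
      rw [one_div, Real.inv_rpow hω.le, ← Real.rpow_neg hω.le]; congr 1; ring
    have hp : 0 < ω ^ (α - 1) := Real.rpow_pos_of_pos hω _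
    rcases le_total T (1 / ω) with hh | hh
    · rw [hX, max_eq_right hh, e]; linarith
    · rw [hX, max_eq_left hh]; linarith
  calc |L| ≤ I + D * X ^ (1 - α) := by rw [hD]; linarith
    _ ≤ I + D * (T ^ (1 - α) + ω ^ (α - 1)) := by gcongr
    _ = _ := by ring

lemma meas_lim (K : ℝ → ℝ) (hKloc : ∀ A > 0, IntegrableOn K (Ioc 0 A))
    (f : ℝ → ℝ) (hf : Continuous f) (hb : ∀ t, |f t| ≤ 1) (L : ℝ → ℝ)
    (hL : ∀ ω > 0, Tendsto (fun A => ∫ t in (0:ℝ)..A, K t * f (ω * t)) atTop (nhds (L ω))) :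
    AEMeasurable L (volume.restrict (Ioi 0)) := by
  refine aemeasurable_of_tendsto_metrizable_ae (u := (atTop : Filter ℕ))
    (f := fun (n : ℕ) ω => ∫ t in (0:ℝ)..((n:ℝ) + 1), K t * f (ω * t)) ?_ ?_
  · intro n
    have hn : (0:ℝ) < n + 1 := by positivity
    have hKi : IntervalIntegrable K volume 0 ((n:ℝ) + 1) :=
      (intervalIntegrable_iff_integrableOn_Ioc_of_le hn.le).2 (hKloc _ hn)
    refine (Continuous.measurable ?_).aemeasurable
    refine intervalIntegral.continuous_of_dominated_interval (bound := fun t => |K t|) ?_ ?_ ?_ ?_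
    · intro ω
      rw [uIoc_of_le hn.le]
      exact (hKi.mul_continuousOn (by fun_prop : ContinuousOn (fun t => f (ω * t)) _)).1.aestronglyMeasurable
    · intro ω
      refine Eventually.of_forall (fun t _ => ?_)
      rw [Real.norm_eq_abs, abs_mul]
      exact mul_le_of_le_one_right (abs_nonneg _) (hb _)
    · exact hKi.abs
    · refine Eventually.of_forall (fun t _ => ?_)
      fun_prop
  · refine (ae_restrict_iff' measurableSet_Ioi).2 (Eventually.of_forall fun ω hω => ?_)
    exact (hL ω hω).comp (tendsto_atTop_add_const_right _ _ tendsto_natCast_atTop_atTop)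

/-- Integrability of the spectral densities `r₁₁` and `ω ↦ ω² r₁₁(ω)` of the
harmonically bounded GLE, under any of the three decay regimes of the memory
kernel: integrable, `K(t) ∼ c₁ t⁻¹`, or `K(t) ∼ c_α t^{−α}` with `α ∈ (0,1)`. -/
theorem spectral_densities_integrable
    (K : ℝ → ℝ)
    (hKloc : ∀ A > 0, IntegrableOn K (Ioc 0 A))
    (hKpos : ∀ t > 0, 0 < K t)
    (hKdec : ∃ T > 0, AntitoneOn K (Ici T))
    (hK0 : Tendsto K atTop (nhds 0))
    (hKcase : IntegrableOn K (Ioi 0) ∨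
      (∃ c₁ > 0, Tendsto (fun t => t * K t) atTop (nhds c₁)) ∨
      (∃ α ∈ Set.Ioo (0:ℝ) 1, ∃ cα > 0,
        Tendsto (fun t => t ^ α * K t) atTop (nhds cα)))
    (Kcos Ksin : ℝ → ℝ)
    (hKcos : ∀ ω > 0, Tendsto (fun A => ∫ t in (0:ℝ)..A, K t * Real.cos (ω * t))
      atTop (nhds (Kcos ω)))
    (hKsin : ∀ ω > 0, Tendsto (fun A => ∫ t in (0:ℝ)..A, K t * Real.sin (ω * t))
      atTop (nhds (Ksin ω)))
    (hKcospos : ∀ ω > 0, 0 < Kcos ω)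
    (m lam β γ : ℝ) (hm : 0 < m) (hlam : 0 < lam) (hβ : 0 < β) (hγ : 0 < γ)
    (r11 : ℝ → ℝ)
    (hr11 : ∀ ω > 0, r11 ω =
      2 * (lam + β * Kcos ω) /
        ((γ - m * ω ^ 2 + β * ω * Ksin ω) ^ 2 + ω ^ 2 * (lam + β * Kcos ω) ^ 2)) :
    IntegrableOn r11 (Ioi 0) ∧ IntegrableOn (fun ω => ω ^ 2 * r11 ω) (Ioi 0) := by
  obtain ⟨α, hα, C, hC, T, hT, hanti, hdec⟩ := decay K hKpos hKdec hKcase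
  obtain ⟨A, hA, B, hB, hbound⟩ := main_bound K hKloc hKpos α hα C hC T hT hanti hdec
  obtain ⟨ha0, ha1⟩ := hα
  have bc : ∀ ω > 0, |Kcos ω| ≤ A + B * ω ^ (α - 1) := fun ω hω =>
    hbound ω hω (fun t => Real.cos (ω * t)) (by fun_prop) (fun t => Real.abs_cos_le_one _)
      (fun t => by
        rw [mul_add, mul_div_cancel₀ _ hω.ne', Real.cos_add_pi]) _ (hKcos ω hω)
  have bs : ∀ ω > 0, |Ksin ω| ≤ A + B * ω ^ (α - 1) := fun ω hω =>
    hbound ω hω (fun t => Real.sin (ω * t)) (by fun_prop) (fun t => Real.abs_sin_le_one _)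
      (fun t => by
        rw [mul_add, mul_div_cancel₀ _ hω.ne', Real.sin_add_pi]) _ (hKsin ω hω)
  have mc := meas_lim K hKloc Real.cos Real.continuous_cos Real.abs_cos_le_one Kcos hKcos
  have ms := meas_lim K hKloc Real.sin Real.continuous_sin Real.abs_sin_le_one Ksin hKsin
  have mr : AEStronglyMeasurable r11 (volume.restrict (Ioi 0)) := by
    have : AEMeasurable (fun ω => 2 * (lam + β * Kcos ω) /
        ((γ - m * ω ^ 2 + β * ω * Ksin ω) ^ 2 + ω ^ 2 * (lam + β * Kcos ω) ^ 2))
        (volume.restrict (Ioi 0)) := by fun_prop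
    refine (this.congr ?_).aestronglyMeasurable
    exact (ae_restrict_iff' measurableSet_Ioi).2
      (Eventually.of_forall fun ω hω => (hr11 ω hω).symm)
  have mr2 : AEStronglyMeasurable (fun ω => ω ^ 2 * r11 ω) (volume.restrict (Ioi 0)) :=
    AEStronglyMeasurable.mul (by fun_prop) mr
  have hCpos : ∀ ω > 0, lam < lam + β * Kcos ω := fun ω hω => by
    have := mul_pos hβ (hKcospos ω hω); linarith
  have rnn : ∀ ω > 0, 0 ≤ r11 ω := fun ω hω => by
    have := hCpos ω hω
    rw [hr11 ω hω]
    have : 0 ≤ lam + β * Kcos ω := by linarith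
    positivity
  have rb : ∀ ω > 0, ω ^ 2 * r11 ω ≤ 2 / lam := fun ω hω => by
    have h1 := hCpos ω hω
    rw [hr11 ω hω]
    set c := lam + β * Kcos ω
    have hc : 0 < c := by linarith
    have hD : 0 < (γ - m * ω ^ 2 + β * ω * Ksin ω) ^ 2 + ω ^ 2 * c ^ 2 := by positivity
    rw [← mul_div_assoc, div_le_div_iff₀ hD hlam]
    have : 0 ≤ 2 * (γ - m * ω ^ 2 + β * ω * Ksin ω) ^ 2 := by positivity
    have : ω ^ 2 * (2 * c) * lam ≤ ω ^ 2 * (2 * c) * c := by gcongr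
    nlinarith
  -- general upper bound from a lower bound on the first square
  have rq : ∀ ω > 0, ∀ q > 0, q ≤ |γ - m * ω ^ 2 + β * ω * Ksin ω| →
      r11 ω ≤ 2 * (lam + β * (A + B * ω ^ (α - 1))) / q ^ 2 := by
    intro ω hω q hq hle
    have h1 := hCpos ω hω
    rw [hr11 ω hω]
    have h2 : Kcos ω ≤ A + B * ω ^ (α - 1) := (le_abs_self _).trans (bc ω hω)
    have h3 : q ^ 2 ≤ (γ - m * ω ^ 2 + β * ω * Ksin ω) ^ 2 := by
      rw [← sq_abs (γ - m * ω ^ 2 + β * ω * Ksin ω)]; gcongr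
    have h4 : 0 ≤ ω ^ 2 * (lam + β * Kcos ω) ^ 2 := by positivity
    have h5 : 0 ≤ lam + β * (A + B * ω ^ (α - 1)) := by positivity
    apply div_le_div₀ (by positivity) (by gcongr) (by positivity) (by linarith)
  have hpw : ∀ R > (0:ℝ), ∀ M : ℝ, IntegrableOn (fun ω : ℝ => M * ω ^ (-2:ℝ)) (Ioi R) :=
    fun R hR M => (integrableOn_Ioi_rpow_of_lt (by norm_num) hR).const_mul M
  have hp2 : ∀ ω > (0:ℝ), ω ^ (-2:ℝ) = 1 / ω ^ 2 := fun ω hω => by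
    rw [Real.rpow_neg hω.le, one_div]; norm_cast
  have split : ∀ R > (0:ℝ), Ioi (0:ℝ) = Ioc 0 R ∪ Ioi R := fun R hR =>
    (Ioc_union_Ioi_eq_Ioi hR.le).symm
  have subs : ∀ R > (0:ℝ), Ioi R ⊆ Ioi (0:ℝ) := fun R hR => Ioi_subset_Ioi hR.le
  constructor
  · -- near zero
    have ht : Tendsto (fun ω : ℝ => m * ω ^ 2 + β * (A * ω + B * ω ^ α)) (nhds 0) (nhds 0) := by
      have : ContinuousAt (fun ω : ℝ => m * ω ^ 2 + β * (A * ω + B * ω ^ α)) 0 := by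
        have : ContinuousAt (fun ω : ℝ => ω ^ α) 0 :=
          Real.continuousAt_rpow_const _ _ (Or.inr ha0.le)
        fun_prop
      have h := this.tendsto
      simpa [Real.zero_rpow ha0.ne'] using h
    have hev := ht.eventually (gt_mem_nhds (half_pos hγ))
    obtain ⟨δ, hδ, hδ'⟩ := Metric.eventually_nhds_iff.1 hev
    have hd2 : 0 < δ / 2 := by positivity
    have hsmall : ∀ ω ∈ Ioc 0 (δ / 2), γ / 2 ≤ |γ - m * ω ^ 2 + β * ω * Ksin ω| := by
      intro ω hω
      have hω0 : 0 < ω := hω.1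
      have h1 := hδ' (y := ω) (by
        rw [Real.dist_eq, sub_zero, abs_of_pos hω0]; linarith [hω.2])
      have h2 : -(A + B * ω ^ (α - 1)) ≤ Ksin ω := (abs_le.1 (bs ω hω0)).1
      have e : ω * ω ^ (α - 1) = ω ^ α := by
        rw [Real.rpow_sub_one hω0.ne']; field_simp
      have h3 : β * ω * (-(A + B * ω ^ (α - 1))) ≤ β * ω * Ksin ω := by gcongr
      have h4 : β * ω * (-(A + B * ω ^ (α - 1))) = - (β * (A * ω + B * ω ^ α)) := by
        rw [← e]; ring
      refine le_trans ?_ (le_abs_self _)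
      linarith
    rw [split _ hd2]
    refine IntegrableOn.union ?_ ?_
    · have hg : IntegrableOn (fun ω : ℝ => 2 * (lam + β * (A + B * ω ^ (α - 1))) / (γ / 2) ^ 2)
          (Ioc 0 (δ / 2)) := by
        rw [← intervalIntegrable_iff_integrableOn_Ioc_of_le hd2.le]
        have h := intervalIntegral.intervalIntegrable_rpow' (a := 0) (b := δ / 2)
          (r := α - 1) (by linarith)
        have hc : ∀ c : ℝ, IntervalIntegrable (fun _ : ℝ => c) volume 0 (δ / 2) := fun c => by simp
        exact (((hc lam).add (((hc A).add (h.const_mul B)).const_mul β)).const_mul 2).div_const _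
      refine Integrable.mono' hg (mr.mono_set Ioc_subset_Ioi_self) ?_
      refine (ae_restrict_iff' measurableSet_Ioc).2 (Eventually.of_forall fun ω hω => ?_)
      rw [Real.norm_eq_abs, abs_of_nonneg (rnn ω hω.1)]
      exact rq ω hω.1 _ (by positivity) (hsmall ω hω)
    · refine Integrable.mono' (hpw _ hd2 (2 / lam)) (mr.mono_set (subs _ hd2)) ?_
      refine (ae_restrict_iff' measurableSet_Ioi).2 (Eventually.of_forall fun ω hω => ?_)
      have hω0 : 0 < ω := hd2.trans hω
      rw [Real.norm_eq_abs, abs_of_nonneg (rnn ω hω0), hp2 ω hω0, mul_one_div,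
        le_div_iff₀ (by positivity), mul_comm]
      exact rb ω hω0
  · -- near infinity
    set M := A + B with hM
    have hM0 : 0 < M := by positivity
    set R := 1 + 2 * (γ + β * M) / m with hR
    have hR1 : 1 ≤ R := by
      have : 0 ≤ 2 * (γ + β * M) / m := by positivity
      linarith
    have hR0 : 0 < R := by linarith
    have hle1 : ∀ ω ∈ Ioi R, A + B * ω ^ (α - 1) ≤ M := by
      intro ω hω
      have h1 : 1 ≤ ω := hR1.trans (le_of_lt hω)
      have : ω ^ (α - 1) ≤ 1 := Real.rpow_le_one_of_one_le_of_nonpos h1 (by linarith)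
      nlinarith
    have hlarge : ∀ ω ∈ Ioi R, m * ω ^ 2 / 2 ≤ |γ - m * ω ^ 2 + β * ω * Ksin ω| := by
      intro ω hω
      have h1 : 1 ≤ ω := hR1.trans (le_of_lt hω)
      have hω0 : 0 < ω := by linarith
      have h2 : Ksin ω ≤ M := ((abs_le.1 (bs ω hω0)).2).trans (hle1 ω hω)
      have h3 : β * ω * Ksin ω ≤ β * ω * M := by gcongr
      have h4 : 2 * (γ + β * M) / m ≤ ω := by
        have : R < ω := hω
        linarith
      rw [div_le_iff₀ hm] at h4
      have h5 : γ ≤ γ * ω := by nlinarith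
      have h6 : 2 * (γ + β * M) * ω ≤ ω * m * ω := by gcongr
      refine le_trans ?_ (neg_le_abs _)
      nlinarith
    rw [split _ hR0]
    refine IntegrableOn.union ?_ ?_
    · have hg : IntegrableOn (fun _ : ℝ => 2 / lam) (Ioc 0 R) := by simp
      refine Integrable.mono' hg (mr2.mono_set Ioc_subset_Ioi_self) ?_
      refine (ae_restrict_iff' measurableSet_Ioc).2 (Eventually.of_forall fun ω hω => ?_)
      rw [Real.norm_eq_abs, abs_of_nonneg (mul_nonneg (sq_nonneg _) (rnn ω hω.1))]
      exact rb ω hω.1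
    · refine Integrable.mono' (hpw _ hR0 (8 * (lam + β * M) / m ^ 2)) (mr2.mono_set (subs _ hR0)) ?_
      refine (ae_restrict_iff' measurableSet_Ioi).2 (Eventually.of_forall fun ω hω => ?_)
      have hω0 : 0 < ω := hR0.trans hω
      rw [Real.norm_eq_abs, abs_of_nonneg (mul_nonneg (sq_nonneg _) (rnn ω hω0)), hp2 ω hω0]
      have h1 := rq ω hω0 _ (by positivity) (hlarge ω hω)
      have h2 := hle1 ω hω
      calc ω ^ 2 * r11 ω
          ≤ ω ^ 2 * (2 * (lam + β * (A + B * ω ^ (α - 1))) / (m * ω ^ 2 / 2) ^ 2) := by gcongr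
        _ ≤ ω ^ 2 * (2 * (lam + β * M) / (m * ω ^ 2 / 2) ^ 2) := by gcongr
        _ = _ := by field_simp; ring
end

section
/- Let K : ℝ → ℝ be even with K restricted to (0,∞) locally integrable, positive, eventually decreasing, tending to 0 at ∞, and satisfying one of: (a) K is integrable on (0,∞); or (b) t·K(t) → c₁ ∈ (0,∞) as t → ∞; or (c) t^α·K(t) → c_α ∈ (0,∞) for some α ∈ (0,1). Let 𝒦cos, 𝒦sin : (0,∞) → ℝ satisfy ∫₀^A K(t)cos(ωt)dt → 𝒦cos(ω) and ∫₀^A K(t)sin(ωt)dt → 𝒦sin(ω) as A → ∞ for every ω > 0. Set K⁺(t) = K(t)·1_{[0,∞)}(t) and, for a Schwartz function φ, (K⁺ ∗ φ)(t) = ∫₀^∞ K(s)·φ(t − s) ds. Then for all Schwartz functions φ, ψ : ℝ → ℂ, ∫_ℝ (K⁺ ∗ φ)(t)·ψ̂(t) dt = ∫_ℝ (𝒦cos(|ω|) − i·sgn(ω)·𝒦sin(|ω|))·φ̂(ω)·ψ(ω) dω, where φ̂(ω) = ∫_ℝ φ(t)e^{−itω}dt. That is, the Fourier transform of K⁺ ∗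 φ in the sense of tempered distributions is the function ω ↦ (𝒦cos(ω) − i𝒦sin(ω))·φ̂(ω). -/
open MeasureTheory Filter Set


lemma ii_ofReal {f : ℝ → ℝ} {a b : ℝ} (h : IntervalIntegrable f volume a b) :
    IntervalIntegrable (fun s => (f s : ℂ)) volume a b :=
  ⟨Integrable.ofReal h.1, Integrable.ofReal h.2⟩

/-- half-period shift bound -/
lemma osc_bound_s10 (f : ℝ → ℝ) (hf : Antitone f) (hpos : ∀ x, 0 ≤ f x) (ω : ℝ) (hω : ω ≠ 0)
    (B A : ℝ) (hBA : B ≤ A) :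
    ‖∫ s in B..A, (f s : ℂ) * Complex.exp (-(Complex.I * (s:ℂ) * (ω:ℂ)))‖ ≤
      3 / 2 * (Real.pi / |ω|) * f B := by
  set h : ℝ := Real.pi / |ω| with hh
  have hωp : 0 < |ω| := abs_pos.mpr hω
  have hh0 : 0 < h := div_pos Real.pi_pos hωp
  set e : ℝ → ℂ := fun s => Complex.exp (-(Complex.I * (s:ℂ) * (ω:ℂ))) with he
  have hen : ∀ s, ‖e s‖ = 1 := by
    intro s
    have : -(Complex.I * (s:ℂ) * (ω:ℂ)) = ((-(s*ω) : ℝ):ℂ) * Complex.I := by push_cast; ring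
    simp only [he]
    rw [this, Complex.norm_exp_ofReal_mul_I]
  have hec : Continuous e := by simp only [he]; fun_prop
  have hes : ∀ s, e (s + h) = - e s := by
    intro s
    simp only [he]
    rcases lt_or_gt_of_ne hω with h0 | h0
    · have h1 : h * ω = -Real.pi := by
        rw [hh, abs_of_neg h0]; field_simp
      have : -(Complex.I * ((s + h : ℝ):ℂ) * (ω:ℂ)) = -(Complex.I * (s:ℂ) * (ω:ℂ)) + Real.pi * Complex.I := by
        have h2 : ((h * ω : ℝ):ℂ) = ((-Real.pi:ℝ):ℂ) := by rw [h1]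
        push_cast at h2 ⊢
        linear_combination (-Complex.I) * h2
      rw [this, Complex.exp_add, Complex.exp_pi_mul_I]; ring
    · have h1 : h * ω = Real.pi := by
        rw [hh, abs_of_pos h0]; field_simp
      have : -(Complex.I * ((s + h : ℝ):ℂ) * (ω:ℂ)) = -(Complex.I * (s:ℂ) * (ω:ℂ)) - Real.pi * Complex.I := by
        have h2 : ((h * ω : ℝ):ℂ) = ((Real.pi:ℝ):ℂ) := by rw [h1]
        push_cast at h2 ⊢
        linear_combination (-Complex.I) * h2
      rw [this, Complex.exp_sub, Complex.exp_pi_mul_I]; ring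
  have hfi : ∀ a b, IntervalIntegrable f volume a b := fun a b => hf.intervalIntegrable
  have hg : Antitone (fun s => f (s + h)) := fun x y hxy => hf (by linarith)
  have hgi : ∀ a b, IntervalIntegrable (fun s => f (s + h)) volume a b := fun a b => hg.intervalIntegrable
  have hfe : ∀ a b, IntervalIntegrable (fun s => (f s : ℂ) * e s) volume a b := fun a b =>
    (ii_ofReal (hfi a b)).mul_continuousOn hec.continuousOn
  have hge : ∀ a b, IntervalIntegrable (fun s => (f (s+h) : ℂ) * e s) volume a b := fun a b =>
    (ii_ofReal (hgi a b)).mul_continuousOn hec.continuousOn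
  have hshift : ∫ s in B..A, (f s : ℂ) * e s = - ∫ s in (B-h)..(A-h), (f (s+h) : ℂ) * e s := by
    have := intervalIntegral.integral_comp_add_right (a := B - h) (b := A - h) (fun s => (f s : ℂ) * e s) h
    simp only [sub_add_cancel, hes] at this
    rw [← this, ← intervalIntegral.integral_neg]
    congr 1; ext s; ring
  have hsplit : ∫ s in (B-h)..(A-h), (f (s+h) : ℂ) * e s =
      (∫ s in (B-h)..B, (f (s+h) : ℂ) * e s) + (∫ s in B..A, (f (s+h) : ℂ) * e s)
        - ∫ s in (A-h)..A, (f (s+h) : ℂ) * e s := by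
    rw [intervalIntegral.integral_add_adjacent_intervals (hge _ _) (hge _ _),
      ← intervalIntegral.integral_add_adjacent_intervals (hge (B-h) (A-h)) (hge (A-h) A)]
    ring
  have hdiff : ∫ s in B..A, ((f s : ℂ) * e s - (f (s+h) : ℂ) * e s) =
      (∫ s in B..A, (f s : ℂ) * e s) - ∫ s in B..A, (f (s+h) : ℂ) * e s :=
    intervalIntegral.integral_sub (hfe _ _) (hge _ _)
  have h2 : 2 * ∫ s in B..A, (f s : ℂ) * e s =
      (∫ s in B..A, ((f s : ℂ) * e s - (f (s+h) : ℂ) * e s)) - (∫ s in (B-h)..B, (f (s+h) : ℂ) * e s)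
       + ∫ s in (A-h)..A, (f (s+h) : ℂ) * e s := by
    rw [hdiff]
    linear_combination hshift - hsplit
  have b2 : ‖∫ s in (B-h)..B, (f (s+h) : ℂ) * e s‖ ≤ h * f B := by
    have := intervalIntegral.norm_integral_le_of_norm_le_const (a := B-h) (b := B) (C := f B)
      (f := fun s => (f (s+h) : ℂ) * e s) (by
        intro x hx
        rw [uIoc_of_le (by linarith)] at hx
        rw [norm_mul, hen, mul_one, Complex.norm_real, Real.norm_of_nonneg (hpos _)]
        exact hf (by linarith [hx.1]))
    rw [show B - (B - h) = h by ring, abs_of_pos hh0] at this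
    linarith
  have b3 : ‖∫ s in (A-h)..A, (f (s+h) : ℂ) * e s‖ ≤ h * f B := by
    have := intervalIntegral.norm_integral_le_of_norm_le_const (a := A-h) (b := A) (C := f B)
      (f := fun s => (f (s+h) : ℂ) * e s) (by
        intro x hx
        rw [uIoc_of_le (by linarith)] at hx
        rw [norm_mul, hen, mul_one, Complex.norm_real, Real.norm_of_nonneg (hpos _)]
        exact hf (by linarith [hx.1]))
    rw [show A - (A - h) = h by ring, abs_of_pos hh0] at this
    linarith
  have b1 : ‖∫ s in B..A, ((f s : ℂ) * e s - (f (s+h) : ℂ) * e s)‖ ≤ h * f B := by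
    have c1 : ‖∫ s in B..A, ((f s : ℂ) * e s - (f (s+h) : ℂ) * e s)‖ ≤ ∫ s in B..A, (f s - f (s+h)) := by
      apply intervalIntegral.norm_integral_le_of_norm_le hBA _ ((hfi _ _).sub (hgi _ _))
      filter_upwards with s _
      rw [← sub_mul, norm_mul, hen, mul_one, ← Complex.ofReal_sub, Complex.norm_real,
        Real.norm_of_nonneg (sub_nonneg.mpr (hf (by linarith)))]
    have c2 : ∫ s in B..A, (f s - f (s+h)) = (∫ s in B..(B+h), f s) - ∫ s in A..(A+h), f s := by
      rw [intervalIntegral.integral_sub (hfi _ _) (hgi _ _), intervalIntegral.integral_comp_add_right]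
      have d1 := intervalIntegral.integral_add_adjacent_intervals (hfi B A) (hfi A (A+h))
      have d2 := intervalIntegral.integral_add_adjacent_intervals (hfi B (B+h)) (hfi (B+h) (A+h))
      linarith
    have c3 : 0 ≤ ∫ s in A..(A+h), f s := intervalIntegral.integral_nonneg (by linarith) (fun u _ => hpos u)
    have c4 : ∫ s in B..(B+h), f s ≤ h * f B := by
      have := intervalIntegral.integral_mono_on (a := B) (b := B+h) (by linarith) (hfi _ _)
        (intervalIntegrable_const (c := f B)) (fun x hx => hf hx.1)
      simpa using this
    linarith
  have h3 : ‖2 * ∫ s in B..A, (f s : ℂ) * e s‖ ≤ 3 * (h * f B) := by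
    rw [h2]
    refine (norm_add_le _ _).trans ?_
    have := norm_sub_le (∫ s in B..A, ((f s : ℂ) * e s - (f (s+h) : ℂ) * e s)) (∫ s in (B-h)..B, (f (s+h) : ℂ) * e s)
    linarith
  rw [norm_mul] at h3
  norm_num at h3
  linarith

lemma exp_norm (s ω : ℝ) : ‖Complex.exp (-(Complex.I * (s:ℂ) * (ω:ℂ)))‖ = 1 := by
  have : -(Complex.I * (s:ℂ) * (ω:ℂ)) = ((-(s*ω) : ℝ):ℂ) * Complex.I := by push_cast; ring
  rw [this, Complex.norm_exp_ofReal_mul_I]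

lemma KA_bound (K : ℝ → ℝ) 
    (hKloc : ∀ A > 0, IntegrableOn K (Ioc 0 A))
    (hKpos : ∀ t > 0, 0 < K t) (T : ℝ) (hT : 0 < T)
    (hKdec : AntitoneOn K (Ici T)) (ω : ℝ) (hω : ω ≠ 0) (A B : ℝ) (hA : 0 ≤ A) (hB : T ≤ B) :
    ‖∫ s in (0:ℝ)..A, (K s : ℂ) * Complex.exp (-(Complex.I * (s:ℂ) * (ω:ℂ)))‖ ≤
      (∫ s in (0:ℝ)..B, K s) + 3 / 2 * (Real.pi / |ω|) * K B := by
  have hKi : ∀ a ≥ 0, IntervalIntegrable K volume 0 a := by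
    intro a ha
    rcases ha.eq_or_lt with h | h
    · rw [← h]
    · rw [intervalIntegrable_iff_integrableOn_Ioc_of_le ha]; exact hKloc a h
  have hec : Continuous (fun s : ℝ => Complex.exp (-(Complex.I * (s:ℂ) * (ω:ℂ)))) := by fun_prop
  have hKe : ∀ a ≥ 0, IntervalIntegrable (fun s => (K s : ℂ) * Complex.exp (-(Complex.I * (s:ℂ) * (ω:ℂ)))) volume 0 a :=
    fun a ha => (ii_ofReal (hKi a ha)).mul_continuousOn hec.continuousOn
  have hB0 : 0 < B := by linarith
  have htriv : ∀ a ≥ 0, ‖∫ s in (0:ℝ)..a, (K s : ℂ) * Complex.exp (-(Complex.I * (s:ℂ) * (ω:ℂ)))‖ ≤ ∫ s in (0:ℝ)..a, K s := by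
    intro a ha
    apply intervalIntegral.norm_integral_le_of_norm_le ha _ (hKi a ha)
    filter_upwards with s hs
    rw [norm_mul, exp_norm, mul_one, Complex.norm_real, Real.norm_of_nonneg (hKpos s hs.1).le]
  have hKB : 0 ≤ 3 / 2 * (Real.pi / |ω|) * K B := by
    have := (hKpos B hB0).le
    have := Real.pi_pos.le
    positivity
  rcases le_total A B with h | h
  · have h1 := intervalIntegral.integral_add_adjacent_intervals (hKi A hA) ((hKi A hA).symm.trans (hKi B hB0.le))
    have h2 : 0 ≤ ∫ s in A..B, K s := by
      rw [intervalIntegral.integral_of_le h]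
      exact setIntegral_nonneg measurableSet_Ioc (fun x hx => (hKpos x (by linarith [hx.1])).le)
    have := htriv A hA
    linarith
  · have h1 := intervalIntegral.integral_add_adjacent_intervals (hKe B hB0.le) ((hKe B hB0.le).symm.trans (hKe A hA))
    have h2 := osc_bound_s10 (fun s => K (max s T)) (fun x y hxy => hKdec (le_max_right x T) (le_max_right y T) (max_le_max_right _ hxy))
      (fun x => (hKpos _ (lt_max_of_lt_right hT)).le) ω hω B A h
    have h3 : ∫ s in B..A, ((fun s => K (max s T)) s : ℂ) * Complex.exp (-(Complex.I * (s:ℂ) * (ω:ℂ))) =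
      ∫ s in B..A, (K s : ℂ) * Complex.exp (-(Complex.I * (s:ℂ) * (ω:ℂ))) := by
      apply intervalIntegral.integral_congr
      intro s hs
      rw [uIcc_of_le h] at hs
      simp only
      rw [max_eq_left (by linarith [hs.1])]
    rw [h3] at h2
    simp only [max_eq_left hB] at h2
    rw [← h1]
    refine (norm_add_le _ _).trans ?_
    have := htriv B hB0.le
    linarith

lemma power_bound (K : ℝ → ℝ) 
    (hKloc : ∀ A > 0, IntegrableOn K (Ioc 0 A))
    (hKpos : ∀ t > 0, 0 < K t) (T : ℝ) (hT : 0 < T)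
    (hKdec : AntitoneOn K (Ici T)) (α : ℝ) (hα : α ∈ Ioo (0:ℝ) 1) (C : ℝ) 
    (hC : ∀ t ≥ T, K t ≤ C * t ^ (-α)) :
    ∃ D1 D2 : ℝ, ∀ A ≥ 0, ∀ ω : ℝ, ω ≠ 0 →
    ‖∫ s in (0:ℝ)..A, (K s : ℂ) * Complex.exp (-(Complex.I * (s:ℂ) * (ω:ℂ)))‖ ≤
      D1 + D2 * |ω| ^ (α - 1) := by
  have hC0 : 0 < C := by
    have h1 := hC T le_rfl
    have h2 := hKpos T hT
    have h3 := Real.rpow_pos_of_pos hT (-α)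
    by_contra h
    nlinarith
  have hM : 0 ≤ ∫ s in (0:ℝ)..T, K s := by
    rw [intervalIntegral.integral_of_le hT.le]
    exact setIntegral_nonneg measurableSet_Ioc (fun x hx => (hKpos x hx.1).le)
  have hp := Real.pi_pos
  have hα1 : 0 < 1 - α := by linarith [hα.2]
  refine ⟨(∫ s in (0:ℝ)..T, K s) + 3/2 * (Real.pi * T) * K T, C / (1 - α) + 3/2 * Real.pi * C, ?_⟩
  intro A hA ω hω
  have hωp : 0 < |ω| := abs_pos.mpr hω
  have hr : 0 < |ω| ^ (α - 1) := Real.rpow_pos_of_pos hωp _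
  have hKT := hKpos T hT
  rcases le_total T (1 / |ω|) with h | h
  · have h1 := KA_bound K hKloc hKpos T hT hKdec ω hω A (1/|ω|) hA h
    have e1 : (1/|ω|) ^ (-α) = |ω| ^ α := by
      rw [one_div, Real.inv_rpow hωp.le, Real.rpow_neg hωp.le, inv_inv]
    have e2 : (1/|ω|) ^ (-α + 1) = |ω| ^ (α - 1) := by
      rw [one_div, Real.inv_rpow hωp.le, ← Real.rpow_neg hωp.le]; congr 1; ring
    have e3 : |ω| ^ (α - 1) = |ω| ^ α / |ω| := by
      rw [Real.rpow_sub hωp, Real.rpow_one]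
    have h2 : 3 / 2 * (Real.pi / |ω|) * K (1/|ω|) ≤ 3/2 * Real.pi * C * |ω| ^ (α - 1) := by
      have := hC _ h
      rw [e1] at this
      calc 3 / 2 * (Real.pi / |ω|) * K (1/|ω|) ≤ 3 / 2 * (Real.pi / |ω|) * (C * |ω| ^ α) := by gcongr
        _ = _ := by rw [e3]; ring
    have hi1 : IntervalIntegrable K volume 0 T := by
      rw [intervalIntegrable_iff_integrableOn_Ioc_of_le hT.le]; exact hKloc T hT
    have hi2 : IntervalIntegrable K volume T (1/|ω|) := by
      rw [intervalIntegrable_iff_integrableOn_Ioc_of_le h]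
      exact (hKloc (1/|ω|) (by positivity)).mono_set (Ioc_subset_Ioc_left hT.le)
    have hi3 : ∀ b, IntervalIntegrable (fun t : ℝ => C * t ^ (-α)) volume 0 b := fun b =>
      (intervalIntegral.intervalIntegrable_rpow' (by linarith [hα.2])).const_mul C
    have h3 : ∫ s in T..(1/|ω|), K s ≤ C / (1 - α) * |ω| ^ (α - 1) := by
      calc ∫ s in T..(1/|ω|), K s ≤ ∫ s in T..(1/|ω|), C * s ^ (-α) :=
            intervalIntegral.integral_mono_on h hi2 ((hi3 T).symm.trans (hi3 _)) (fun x hx => hC x hx.1)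
        _ = C * (((1/|ω|) ^ (-α + 1) - T ^ (-α + 1)) / (-α + 1)) := by
            rw [intervalIntegral.integral_const_mul, integral_rpow (Or.inl (by linarith [hα.2]))]
        _ ≤ C * (((1/|ω|) ^ (-α + 1)) / (-α + 1)) := by
            have := Real.rpow_pos_of_pos hT (-α+1)
            gcongr
            · linarith
            · linarith
        _ = _ := by rw [e2, show -α + 1 = 1 - α by ring]; ring
    rw [← intervalIntegral.integral_add_adjacent_intervals hi1 hi2] at h1
    have : 0 ≤ 3/2 * (Real.pi * T) * K T := by positivity
    linarith
  · have h1 := KA_bound K hKloc hKpos T hT hKdec ω hω A T hA le_rfl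
    have h2 : 3 / 2 * (Real.pi / |ω|) * K T ≤ 3/2 * (Real.pi * T) * K T := by
      have : Real.pi / |ω| ≤ Real.pi * T := by
        rw [div_eq_mul_one_div]; gcongr
      gcongr
    have : 0 ≤ (C / (1 - α) + 3/2 * Real.pi * C) * |ω| ^ (α - 1) := by positivity
    linarith

lemma full_bound (K : ℝ → ℝ) 
    (hKloc : ∀ A > 0, IntegrableOn K (Ioc 0 A))
    (hKpos : ∀ t > 0, 0 < K t)
    (hKdec : ∃ T > 0, AntitoneOn K (Ici T))
    (hKcase : IntegrableOn K (Ioi 0) ∨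
      (∃ c₁ > 0, Tendsto (fun t => t * K t) atTop (nhds c₁)) ∨
      (∃ α ∈ Set.Ioo (0:ℝ) 1, ∃ cα > 0,
        Tendsto (fun t => t ^ α * K t) atTop (nhds cα))) :
    ∃ α ∈ Ioo (0:ℝ) 1, ∃ D1 D2 : ℝ, ∀ A ≥ 0, ∀ ω : ℝ, ω ≠ 0 →
    ‖∫ s in (0:ℝ)..A, (K s : ℂ) * Complex.exp (-(Complex.I * (s:ℂ) * (ω:ℂ)))‖ ≤
      D1 + D2 * |ω| ^ (α - 1) := by
  obtain ⟨T, hT, hdec⟩ := hKdec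
  rcases hKcase with h | ⟨c, hc, h⟩ | ⟨α, hα, c, hc, h⟩
  · refine ⟨1/2, by norm_num, ∫ s in Ioi 0, K s, 0, fun A hA ω hω => ?_⟩
    rw [zero_mul, add_zero, intervalIntegral.integral_of_le hA]
    calc _ ≤ ∫ s in Ioc 0 A, K s := by
          apply norm_integral_le_of_norm_le (h.mono_set Ioc_subset_Ioi_self)
          filter_upwards [ae_restrict_mem measurableSet_Ioc] with s hs
          rw [norm_mul, exp_norm, mul_one, Complex.norm_real, Real.norm_of_nonneg (hKpos s hs.1).le]
      _ ≤ _ := setIntegral_mono_set h (by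
          filter_upwards [ae_restrict_mem measurableSet_Ioi] with s hs
          exact (hKpos s hs).le) (LE.le.eventuallyLE Ioc_subset_Ioi_self)
  · obtain ⟨T1, hT1⟩ := eventually_atTop.mp (h.eventually (gt_mem_nhds (lt_add_one c)))
    refine ⟨1/2, by norm_num, power_bound K hKloc hKpos (max (max T T1) 1) (by positivity) 
      (hdec.mono (Ici_subset_Ici.mpr (by simp))) (1/2) (by norm_num) (c+1) ?_⟩
    intro t ht
    simp only [ge_iff_le, max_le_iff] at ht
    have h1 := hT1 t ht.1.2
    have ht0 : 0 < t := by linarith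
    have h2 : t⁻¹ ≤ t ^ (-(1/2):ℝ) := by
      rw [← Real.rpow_neg_one]
      exact Real.rpow_le_rpow_of_exponent_le ht.2 (by norm_num)
    calc K t = (t * K t) * t⁻¹ := by field_simp
      _ ≤ (c+1) * t ^ (-(1/2):ℝ) := by gcongr
  · obtain ⟨T1, hT1⟩ := eventually_atTop.mp (h.eventually (gt_mem_nhds (lt_add_one c)))
    refine ⟨α, hα, power_bound K hKloc hKpos (max (max T T1) 1) (by positivity) 
      (hdec.mono (Ici_subset_Ici.mpr (by simp))) α hα (c+1) ?_⟩
    intro t ht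
    simp only [ge_iff_le, max_le_iff] at ht
    have h1 := hT1 t ht.1.2
    have ht0 : 0 < t := by linarith
    have h3 := Real.rpow_pos_of_pos ht0 α
    rw [Real.rpow_neg ht0.le, ← div_eq_mul_inv, le_div_iff₀ h3]
    linarith

lemma ft_eq (ψ : SchwartzMap ℝ ℂ) (t : ℝ) :
    (∫ u : ℝ, ψ u * Complex.exp (-(Complex.I * (u : ℂ) * (t : ℂ)))) =
      (FourierTransform.fourier ψ : SchwartzMap ℝ ℂ) (t / (2 * Real.pi)) := by
  rw [SchwartzMap.fourier_coe, Real.fourier_real_eq_integral_exp_smul]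
  congr 1; ext u
  rw [smul_eq_mul, mul_comm]
  congr 2
  have := Real.pi_ne_zero
  push_cast
  have : (Real.pi : ℂ) ≠ 0 := by exact_mod_cast this
  field_simp

lemma ft_integrable (ψ : SchwartzMap ℝ ℂ) :
    Integrable (fun t : ℝ => ∫ u : ℝ, ψ u * Complex.exp (-(Complex.I * (u : ℂ) * (t : ℂ)))) := by
  simp_rw [ft_eq]
  exact (SchwartzMap.integrable (μ := volume) (FourierTransform.fourier ψ : SchwartzMap ℝ ℂ)).comp_div
    (by have := Real.pi_pos; positivity)

lemma ft_continuous (ψ : SchwartzMap ℝ ℂ) :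
    Continuous (fun t : ℝ => ∫ u : ℝ, ψ u * Complex.exp (-(Complex.I * (u : ℂ) * (t : ℂ)))) := by
  simp_rw [ft_eq]
  exact (SchwartzMap.continuous _).comp (by fun_prop)

lemma ft_bound (ψ : SchwartzMap ℝ ℂ) (t : ℝ) :
    ‖∫ u : ℝ, ψ u * Complex.exp (-(Complex.I * (u : ℂ) * (t : ℂ)))‖ ≤ ∫ u, ‖ψ u‖ := by
  apply norm_integral_le_of_norm_le ψ.integrable.norm
  filter_upwards with u
  rw [norm_mul, exp_norm, mul_one]

lemma schwartz_bdd (φ : SchwartzMap ℝ ℂ) : ∃ C : ℝ, 0 ≤ C ∧ ∀ x, ‖φ x‖ ≤ C := by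
  obtain ⟨C, hC⟩ := φ.decay 0 0
  refine ⟨C, hC.1.le, fun x => ?_⟩
  simpa using hC.2 x

/-- Parseval with translation -/
lemma parseval_shift (φ ψ : SchwartzMap ℝ ℂ) (s : ℝ) :
    ∫ t : ℝ, φ (t - s) * (∫ u : ℝ, ψ u * Complex.exp (-(Complex.I * (u : ℂ) * (t : ℂ)))) =
    ∫ ω : ℝ, Complex.exp (-(Complex.I * (s:ℂ) * (ω:ℂ))) *
      ((∫ u : ℝ, φ u * Complex.exp (-(Complex.I * (u : ℂ) * (ω : ℂ)))) * ψ ω) := by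
  have h1 : ∀ ω : ℝ, Complex.exp (-(Complex.I * (s:ℂ) * (ω:ℂ))) *
      ((∫ u : ℝ, φ u * Complex.exp (-(Complex.I * (u : ℂ) * (ω : ℂ)))) * ψ ω) =
      ∫ t : ℝ, φ (t - s) * (ψ ω * Complex.exp (-(Complex.I * (ω : ℂ) * (t : ℂ)))) := by
    intro ω
    rw [← integral_sub_right_eq_self (fun u : ℝ => φ u * Complex.exp (-(Complex.I * (u : ℂ) * (ω : ℂ)))) s,
      mul_comm _ (ψ ω), ← mul_assoc, ← integral_const_mul]
    congr 1; ext t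
    have : Complex.exp (-(Complex.I * (ω : ℂ) * (t : ℂ))) = Complex.exp (-(Complex.I * (s:ℂ) * (ω:ℂ))) *
       Complex.exp (-(Complex.I * ((t - s : ℝ) : ℂ) * (ω : ℂ))) := by
      rw [← Complex.exp_add]; congr 1; push_cast; ring
    rw [this]; ring
  simp_rw [h1, ← integral_const_mul]
  apply integral_integral_swap
  have h2 : Integrable (fun p : ℝ × ℝ => φ (p.1 - s) * ψ p.2) (volume.prod volume) :=
    (φ.integrable.comp_sub_right s).mul_prod ψ.integrable
  have h3 := h2.mul_bdd (c := 1) (g := fun p : ℝ × ℝ => Complex.exp (-(Complex.I * (p.2 : ℂ) * (p.1 : ℂ))))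
    (Continuous.aestronglyMeasurable (by fun_prop)) (by
      filter_upwards with p
      rw [exp_norm])
  refine h3.congr ?_
  filter_upwards with p
  simp only [Function.uncurry]
  ring

lemma truncated (K : ℝ → ℝ) (A : ℝ) (hK : IntegrableOn K (Ioc 0 A)) (φ ψ : SchwartzMap ℝ ℂ) :
      ∫ t : ℝ, (∫ s in Ioc (0:ℝ) A, (K s : ℂ) * φ (t - s)) *
          (∫ u : ℝ, ψ u * Complex.exp (-(Complex.I * (u : ℂ) * (t : ℂ)))) =
        ∫ ω : ℝ, (∫ s in Ioc (0:ℝ) A, (K s : ℂ) * Complex.exp (-(Complex.I * (s:ℂ) * (ω:ℂ)))) *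
          ((∫ u : ℝ, φ u * Complex.exp (-(Complex.I * (u : ℂ) * (ω : ℂ)))) * ψ ω) := by
  have hKc : Integrable (fun s => (K s : ℂ)) (volume.restrict (Ioc 0 A)) := Integrable.ofReal hK
  obtain ⟨C, hC0, hC⟩ := schwartz_bdd φ
  have hP := parseval_shift φ ψ
  have hPi := ft_integrable ψ
  have hF : Integrable (fun ω : ℝ => (∫ u : ℝ, φ u * Complex.exp (-(Complex.I * (u : ℂ) * (ω : ℂ)))) * ψ ω) :=
      ψ.integrable.bdd_mul (ft_continuous φ).aestronglyMeasurable (Eventually.of_forall (ft_bound φ))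
  generalize hPdef : (fun t : ℝ => ∫ u : ℝ, ψ u * Complex.exp (-(Complex.I * (u : ℂ) * (t : ℂ)))) = P at hPi
  generalize hFdef : (fun ω : ℝ => (∫ u : ℝ, φ u * Complex.exp (-(Complex.I * (u : ℂ) * (ω : ℂ)))) * ψ ω) = F at hF
  have hP1 : ∀ t : ℝ, ∫ u : ℝ, ψ u * Complex.exp (-(Complex.I * (u : ℂ) * (t : ℂ))) = P t :=
    fun t => congrFun hPdef t
  have hF1 : ∀ ω : ℝ, (∫ u : ℝ, φ u * Complex.exp (-(Complex.I * (u : ℂ) * (ω : ℂ)))) * ψ ω = F ω :=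
    fun t => congrFun hFdef t
  simp only [hP1, hF1] at hP ⊢
  have i1 : Integrable (Function.uncurry fun (t s : ℝ) => (K s : ℂ) * φ (t - s) * P t)
      (volume.prod (volume.restrict (Ioc 0 A))) := by
    have h3 := (hPi.mul_prod hKc).mul_bdd (c := C) (g := fun p : ℝ × ℝ => φ (p.1 - p.2))
      (Continuous.aestronglyMeasurable (φ.continuous.comp (by fun_prop))) (by
        filter_upwards with p
        exact hC _)
    refine h3.congr ?_
    filter_upwards with p
    simp only [Function.uncurry]
    ring
  have i2 : Integrable (Function.uncurry fun (ω s : ℝ) =>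
      (K s : ℂ) * Complex.exp (-(Complex.I * (s:ℂ) * (ω:ℂ))) * F ω)
      (volume.prod (volume.restrict (Ioc 0 A))) := by
    have h3 := (hF.mul_prod hKc).mul_bdd (c := 1) (g := fun p : ℝ × ℝ => Complex.exp (-(Complex.I * (p.2 : ℂ) * (p.1 : ℂ))))
      (Continuous.aestronglyMeasurable (by fun_prop)) (by
        filter_upwards with p
        rw [exp_norm])
    refine h3.congr ?_
    filter_upwards with p
    simp only [Function.uncurry]
    ring
  simp_rw [← integral_mul_const]
  rw [integral_integral_swap i1, integral_integral_swap i2]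
  congr 1; ext s
  have e1 : ∫ t : ℝ, (K s : ℂ) * φ (t - s) * P t = K s * ∫ t : ℝ, φ (t - s) * P t := by
    rw [← integral_const_mul]; congr 1; ext t; ring
  have e2 : ∫ ω : ℝ, (K s : ℂ) * Complex.exp (-(Complex.I * (s:ℂ) * (ω:ℂ))) * F ω =
      K s * ∫ ω : ℝ, Complex.exp (-(Complex.I * (s:ℂ) * (ω:ℂ))) * F ω := by
    rw [← integral_const_mul]; congr 1; ext t; ring
  rw [e1, e2, hP]

lemma conv_bound (K : ℝ → ℝ) 
    (hKloc : ∀ A > 0, IntegrableOn K (Ioc 0 A))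
    (hKpos : ∀ t > 0, 0 < K t)
    (hKdec : ∃ T > 0, AntitoneOn K (Ici T)) (φ : SchwartzMap ℝ ℂ) :
    ∃ M : ℝ, ∀ t : ℝ, IntegrableOn (fun s => (K s : ℂ) * φ (t - s)) (Ioi 0) ∧
      ∫ s in Ioi 0, ‖(K s : ℂ) * φ (t - s)‖ ≤ M := by
  obtain ⟨T, hT, hdec⟩ := hKdec
  obtain ⟨C, hC0, hC⟩ := schwartz_bdd φ
  have hmeas : AEStronglyMeasurable K (volume.restrict (Ioi 0)) := by
    have : Ioi (0:ℝ) = ⋃ n : ℕ, Ioc (0:ℝ) (n + 1) := by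
      ext x
      simp only [mem_Ioi, mem_iUnion, mem_Ioc]
      constructor
      · intro h
        obtain ⟨n, hn⟩ := exists_nat_ge x
        exact ⟨n, h, by linarith⟩
      · rintro ⟨n, h, _⟩; exact h
    rw [this, aestronglyMeasurable_iUnion_iff]
    intro n
    exact (hKloc _ (by positivity)).aestronglyMeasurable
  set G : ℝ → ℝ → ℝ := fun t s => C * (Ioc 0 T).indicator K s + K T * ‖φ (t - s)‖ with hG
  have hi1 : Integrable (fun s => C * (Ioc 0 T).indicator K s) := 
    ((integrable_indicator_iff measurableSet_Ioc).mpr (hKloc T hT)).const_mul C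
  have hi2 : ∀ t, Integrable (fun s => K T * ‖φ (t - s)‖) := fun t =>
    ((φ.integrable.comp_sub_left t).norm).const_mul _
  have hGi : ∀ t, Integrable (G t) := fun t => hi1.add (hi2 t)
  have hKT := hKpos T hT
  have hle : ∀ t, ∀ s ∈ Ioi (0:ℝ), ‖(K s : ℂ) * φ (t - s)‖ ≤ G t s := by
    intro t s hs
    rw [norm_mul, Complex.norm_real, Real.norm_of_nonneg (hKpos s hs).le]
    have hKs := hKpos s hs
    simp only [hG]
    by_cases h : s ≤ T
    · have hmem : s ∈ Ioc 0 T := ⟨hs, h⟩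
      rw [indicator_of_mem hmem]
      have : K s * ‖φ (t - s)‖ ≤ K s * C := by gcongr; exact hC _
      have : 0 ≤ K T * ‖φ (t-s)‖ := by positivity
      linarith
    · rw [indicator_of_notMem (fun h' => h h'.2)]
      have : K s ≤ K T := hdec (le_refl T) (not_le.mp h).le (not_le.mp h).le
      have : K s * ‖φ (t - s)‖ ≤ K T * ‖φ (t-s)‖ := by gcongr
      linarith
  have hGpos : ∀ t s, 0 ≤ G t s := by
    intro t s
    have : 0 ≤ (Ioc 0 T).indicator K s := indicator_nonneg (fun x hx => (hKpos x hx.1).le) s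
    simp only [hG]; positivity
  refine ⟨(∫ s, C * (Ioc 0 T).indicator K s) + K T * ∫ s, ‖φ s‖, fun t => ?_⟩
  have hint : IntegrableOn (fun s => (K s : ℂ) * φ (t - s)) (Ioi 0) := by
    refine Integrable.mono' (hGi t).integrableOn ?_ ?_
    · exact (Complex.continuous_ofReal.comp_aestronglyMeasurable hmeas).mul
        (Continuous.aestronglyMeasurable (φ.continuous.comp (by fun_prop)))
    · filter_upwards [ae_restrict_mem measurableSet_Ioi] with s hs using hle t s hs
  refine ⟨hint, ?_⟩
  calc ∫ s in Ioi 0, ‖(K s : ℂ) * φ (t - s)‖ ≤ ∫ s in Ioi 0, G t s :=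
        setIntegral_mono_on hint.norm (hGi t).integrableOn measurableSet_Ioi (hle t)
    _ ≤ ∫ s, G t s := setIntegral_le_integral (hGi t) (Eventually.of_forall (hGpos t))
    _ = _ := by
      simp only [hG]
      rw [integral_add hi1 (hi2 t), integral_const_mul (K T), integral_sub_left_eq_self (fun s => ‖φ s‖)]

lemma rpow_schwartz (ψ : SchwartzMap ℝ ℂ) (α : ℝ) (hα : α ∈ Ioo (0:ℝ) 1) :
    Integrable (fun ω : ℝ => |ω| ^ (α - 1) * ‖ψ ω‖) := by
  obtain ⟨C, hC0, hC⟩ := schwartz_bdd ψ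
  have hm : Measurable (fun ω : ℝ => |ω| ^ (α - 1)) := by fun_prop
  have hi0 : IntervalIntegrable (fun ω : ℝ => |ω| ^ (α - 1)) volume 0 1 := by
    refine (intervalIntegral.intervalIntegrable_rpow' (a := 0) (b := 1) (r := α - 1) (by linarith [hα.1])).congr ?_
    intro x hx
    rw [uIoc_of_le (by norm_num)] at hx
    simp only [abs_of_pos hx.1]
  have hi1 : IntervalIntegrable (fun ω : ℝ => |ω| ^ (α - 1)) volume (-1) 0 := by
    have := ((IntervalIntegrable.iff_comp_neg (by simp)).mp hi0).symm
    simpa using this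
  have hi : IntegrableOn (fun ω : ℝ => |ω| ^ (α - 1)) (Ioc (-1) 1) := by
    rw [← intervalIntegrable_iff_integrableOn_Ioc_of_le (by norm_num)]
    exact hi1.trans hi0
  rw [← integrableOn_univ, ← union_compl_self (Ioc (-1:ℝ) 1)]
  refine IntegrableOn.union ?_ ?_
  · refine Integrable.mul_bdd (c := C) hi ψ.continuous.norm.aestronglyMeasurable ?_
    filter_upwards with x
    simpa using hC x
  · refine Integrable.mono' ψ.integrable.norm.integrableOn
      (hm.aestronglyMeasurable.mul ψ.continuous.norm.aestronglyMeasurable) ?_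
    filter_upwards [ae_restrict_mem measurableSet_Ioc.compl] with x hx
    have h1 : 1 ≤ |x| := by
      simp only [mem_compl_iff, mem_Ioc, not_and_or, not_lt, not_le] at hx
      rw [le_abs]
      rcases hx with h | h
      · right; linarith
      · left; linarith
    have h2 : |x| ^ (α - 1) ≤ 1 := Real.rpow_le_one_of_one_le_of_nonpos h1 (by linarith [hα.2])
    have h3 : 0 ≤ |x| ^ (α - 1) := by positivity
    rw [Real.norm_of_nonneg (by positivity)]
    nlinarith [norm_nonneg (ψ x)]

lemma KA_tendsto (K : ℝ → ℝ)
    (hKloc : ∀ A > 0, IntegrableOn K (Ioc 0 A))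
    (Kcos Ksin : ℝ → ℝ)
    (hKcos : ∀ ω > 0, Tendsto (fun A => ∫ t in (0:ℝ)..A, K t * Real.cos (ω * t))
      atTop (nhds (Kcos ω)))
    (hKsin : ∀ ω > 0, Tendsto (fun A => ∫ t in (0:ℝ)..A, K t * Real.sin (ω * t))
      atTop (nhds (Ksin ω))) (ω : ℝ) (hω : ω ≠ 0) :
    Tendsto (fun A => ∫ s in (0:ℝ)..A, (K s : ℂ) * Complex.exp (-(Complex.I * (s:ℂ) * (ω:ℂ)))) atTop
      (nhds ((Kcos |ω| : ℂ) - Complex.I * (Real.sign ω : ℂ) * (Ksin |ω| : ℂ))) := by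
  have hωp : 0 < |ω| := abs_pos.mpr hω
  have h1 := (Complex.continuous_ofReal.tendsto _).comp (hKcos _ hωp)
  have h2 := (Complex.continuous_ofReal.tendsto _).comp (hKsin _ hωp)
  refine (h1.sub (h2.const_mul (Complex.I * (Real.sign ω : ℂ)))).congr' ?_
  filter_upwards [eventually_gt_atTop 0] with A hA
  have hKi : IntervalIntegrable K volume 0 A := by
    rw [intervalIntegrable_iff_integrableOn_Ioc_of_le hA.le]; exact hKloc A hA
  have hc : IntervalIntegrable (fun t => K t * Real.cos (|ω| * t)) volume 0 A :=
    hKi.mul_continuousOn (Continuous.continuousOn (by fun_prop))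
  have hs : IntervalIntegrable (fun t => K t * Real.sin (|ω| * t)) volume 0 A :=
    hKi.mul_continuousOn (Continuous.continuousOn (by fun_prop))
  simp only [Function.comp_apply]
  rw [← intervalIntegral.integral_ofReal, ← intervalIntegral.integral_ofReal,
    ← intervalIntegral.integral_const_mul, ← intervalIntegral.integral_sub (ii_ofReal hc) ((ii_ofReal hs).const_mul _)]
  congr 1; ext t
  have e : Complex.exp (-(Complex.I * (t:ℂ) * (ω:ℂ))) = Complex.cos ((ω * t : ℝ):ℂ) - Complex.I * Complex.sin ((ω * t : ℝ):ℂ) := by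
    rw [show -(Complex.I * (t:ℂ) * (ω:ℂ)) = (-((ω * t : ℝ):ℂ)) * Complex.I by push_cast; ring,
      Complex.exp_mul_I, Complex.cos_neg, Complex.sin_neg]
    ring
  rw [e]
  rcases lt_or_gt_of_ne hω with h | h
  · rw [abs_of_neg h, Real.sign_of_neg h, neg_mul, Real.cos_neg, Real.sin_neg]
    push_cast; ring
  · rw [abs_of_pos h, Real.sign_of_pos h]
    push_cast; ring

/-- The Fourier transform of `K⁺ ∗ φ` in the sense of tempered distributions
is `ω ↦ (𝒦cos(ω) − i𝒦sin(ω)) φ̂(ω)`: for all Schwartz functions `φ, ψ`,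
`∫ (K⁺ ∗ φ)(t) ψ̂(t) dt = ∫ (𝒦cos(|ω|) − i·sgn(ω)·𝒦sin(|ω|)) φ̂(ω) ψ(ω) dω`. -/
theorem causal_kernel_convolution_fourier_transform
    (K : ℝ → ℝ) (hKeven : ∀ t, K (-t) = K t)
    (hKloc : ∀ A > 0, IntegrableOn K (Ioc 0 A))
    (hKpos : ∀ t > 0, 0 < K t)
    (hKdec : ∃ T > 0, AntitoneOn K (Ici T))
    (hK0 : Tendsto K atTop (nhds 0))
    (hKcase : IntegrableOn K (Ioi 0) ∨
      (∃ c₁ > 0, Tendsto (fun t => t * K t) atTop (nhds c₁)) ∨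
      (∃ α ∈ Set.Ioo (0:ℝ) 1, ∃ cα > 0,
        Tendsto (fun t => t ^ α * K t) atTop (nhds cα)))
    (Kcos Ksin : ℝ → ℝ)
    (hKcos : ∀ ω > 0, Tendsto (fun A => ∫ t in (0:ℝ)..A, K t * Real.cos (ω * t))
      atTop (nhds (Kcos ω)))
    (hKsin : ∀ ω > 0, Tendsto (fun A => ∫ t in (0:ℝ)..A, K t * Real.sin (ω * t))
      atTop (nhds (Ksin ω))) :
    ∀ φ ψ : SchwartzMap ℝ ℂ,
      ∫ t : ℝ, (∫ s in Ioi (0:ℝ), (K s : ℂ) * φ (t - s)) *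
          (∫ u : ℝ, ψ u * Complex.exp (-(Complex.I * (u : ℂ) * (t : ℂ)))) =
        ∫ ω : ℝ, ((Kcos |ω| : ℂ) - Complex.I * (Real.sign ω : ℂ) * (Ksin |ω| : ℂ)) *
          (∫ u : ℝ, φ u * Complex.exp (-(Complex.I * (u : ℂ) * (ω : ℂ)))) * ψ ω := by
  intro φ ψ
  have hK_dec := hKdec
  obtain ⟨M, hM⟩ := conv_bound K hKloc hKpos hKdec φ
  obtain ⟨α, hα, D1, D2, hD⟩ := full_bound K hKloc hKpos hKdec hKcase
  have hmF : Continuous (fun ω : ℝ => ∫ u : ℝ, φ u * Complex.exp (-(Complex.I * (u : ℂ) * (ω : ℂ)))) :=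
    ft_continuous φ
  have hKc : ∀ A > 0, Integrable (fun s => (K s : ℂ)) (volume.restrict (Ioc 0 A)) :=
    fun A hA => Integrable.ofReal (hKloc A hA)
  -- left-hand side
  have hL : Tendsto (fun A : ℝ => ∫ t : ℝ, (∫ s in Ioc (0:ℝ) A, (K s : ℂ) * φ (t - s)) *
          (∫ u : ℝ, ψ u * Complex.exp (-(Complex.I * (u : ℂ) * (t : ℂ))))) atTop
      (nhds (∫ t : ℝ, (∫ s in Ioi (0:ℝ), (K s : ℂ) * φ (t - s)) *
          (∫ u : ℝ, ψ u * Complex.exp (-(Complex.I * (u : ℂ) * (t : ℂ)))))) := by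
    apply tendsto_integral_filter_of_dominated_convergence
      (fun t : ℝ => M * ‖∫ u : ℝ, ψ u * Complex.exp (-(Complex.I * (u : ℂ) * (t : ℂ)))‖)
    · filter_upwards [eventually_gt_atTop 0] with A hA
      refine AEStronglyMeasurable.mul ?_ (ft_continuous ψ).aestronglyMeasurable
      have : AEStronglyMeasurable (fun p : ℝ × ℝ => (K p.2 : ℂ) * φ (p.1 - p.2))
          (volume.prod (volume.restrict (Ioc 0 A))) :=
        (hKc A hA).aestronglyMeasurable.comp_snd.mul
          (Continuous.aestronglyMeasurable (φ.continuous.comp (by fun_prop)))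
      exact this.integral_prod_right'
    · filter_upwards [eventually_gt_atTop 0] with A hA
      filter_upwards with t
      rw [norm_mul]
      gcongr
      refine (norm_integral_le_integral_norm _).trans (le_trans ?_ (hM t).2)
      exact setIntegral_mono_set (hM t).1.norm (Eventually.of_forall fun _ => norm_nonneg _)
        (LE.le.eventuallyLE Ioc_subset_Ioi_self)
    · exact (ft_integrable ψ).norm.const_mul M
    · filter_upwards with t
      refine Tendsto.mul_const _ ?_
      refine (intervalIntegral_tendsto_integral_Ioi 0 (hM t).1 tendsto_id).congr' ?_
      filter_upwards [eventually_gt_atTop 0] with A hA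
      rw [id, intervalIntegral.integral_of_le hA.le]
  have hR : Tendsto (fun A : ℝ => ∫ ω : ℝ, (∫ s in Ioc (0:ℝ) A, (K s : ℂ) * Complex.exp (-(Complex.I * (s:ℂ) * (ω:ℂ)))) *
          ((∫ u : ℝ, φ u * Complex.exp (-(Complex.I * (u : ℂ) * (ω : ℂ)))) * ψ ω)) atTop
      (nhds (∫ ω : ℝ, ((Kcos |ω| : ℂ) - Complex.I * (Real.sign ω : ℂ) * (Ksin |ω| : ℂ)) *
          ((∫ u : ℝ, φ u * Complex.exp (-(Complex.I * (u : ℂ) * (ω : ℂ)))) * ψ ω))) := by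
    have hne : ∀ᵐ ω : ℝ, ω ≠ 0 := by
      simp [ae_iff]
    apply tendsto_integral_filter_of_dominated_convergence
      (fun ω : ℝ => (∫ u, ‖φ u‖) * (D1 * ‖ψ ω‖ + D2 * (|ω| ^ (α - 1) * ‖ψ ω‖)))
    · filter_upwards [eventually_gt_atTop 0] with A hA
      refine AEStronglyMeasurable.mul ?_ (hmF.mul ψ.continuous).aestronglyMeasurable
      have : AEStronglyMeasurable (fun p : ℝ × ℝ => (K p.2 : ℂ) * Complex.exp (-(Complex.I * (p.2:ℂ) * (p.1:ℂ))))
          (volume.prod (volume.restrict (Ioc 0 A))) :=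
        (hKc A hA).aestronglyMeasurable.comp_snd.mul
          (Continuous.aestronglyMeasurable (by fun_prop))
      exact this.integral_prod_right'
    · filter_upwards [eventually_gt_atTop 0] with A hA
      filter_upwards [hne] with ω hω
      have h1 := hD A hA.le ω hω
      rw [intervalIntegral.integral_of_le hA.le] at h1
      rw [norm_mul, norm_mul]
      calc _ ≤ (D1 + D2 * |ω| ^ (α - 1)) * ((∫ u, ‖φ u‖) * ‖ψ ω‖) := by
            have h2 := ft_bound φ ω
            have h3 := (norm_nonneg _).trans h1
            gcongr
        _ = _ := by ring
    · exact ((ψ.integrable.norm.const_mul D1).add ((rpow_schwartz ψ α hα).const_mul D2)).const_mul _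
    · filter_upwards [hne] with ω hω
      refine Tendsto.mul_const _ ?_
      refine (KA_tendsto K hKloc Kcos Ksin hKcos hKsin ω hω).congr' ?_
      filter_upwards [eventually_gt_atTop 0] with A hA
      rw [intervalIntegral.integral_of_le hA.le]
  have hassoc : ∀ ω : ℝ, ((Kcos |ω| : ℂ) - Complex.I * (Real.sign ω : ℂ) * (Ksin |ω| : ℂ)) *
          (∫ u : ℝ, φ u * Complex.exp (-(Complex.I * (u : ℂ) * (ω : ℂ)))) * ψ ω =
      ((Kcos |ω| : ℂ) - Complex.I * (Real.sign ω : ℂ) * (Ksin |ω| : ℂ)) *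
          ((∫ u : ℝ, φ u * Complex.exp (-(Complex.I * (u : ℂ) * (ω : ℂ)))) * ψ ω) :=
    fun ω => mul_assoc _ _ _
  simp only [hassoc]
  refine tendsto_nhds_unique hL (hR.congr' ?_)
  filter_upwards [eventually_gt_atTop 0] with A hA
  exact (truncated K A (hKloc A hA) φ ψ).symm
end

section
/- Let μ be a positive Borel measure on [0,∞) with μ({0}) = 0, μ([0,1]) < ∞ and ∫₁^∞ x^{−1/2} μ(dx) < ∞, and let γ, λ, m, β > 0. Let w(z) = e^{−z²} + (2iz/√π)·e^{−z²}·∫₀¹ e^{s²z²} ds be the Faddeeva function and p̃(z) = (√π/2)·∫₀^∞ x^{−1/2}·w(−z/(2√x)) μ(dx) (defined for Im z ≤ 0, z ≠ 0). Let Ω⁺ = {z ∈ ℂ : Im z ≥ 0, z ≠ 0} and define, for z ∈ Ω⁺, q̃₂(z) = λ·z + β·z·p̃(−z) + i·(γ − m·z²). Then q̃₂ is analytic on Ω⁺ and q̃₂(z) ≠ 0 for every z ∈ Ω⁺. -/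
open MeasureTheory Filter Set

/-- The punctured closed upper half-plane `ℂ⁺∖{0} = {z : Im z ≥ 0, z ≠ 0}`. -/
def upperHalfPunctured : Set ℂ := {z : ℂ | 0 ≤ z.im ∧ z ≠ 0}

/-- The integrand of the Laplace-type representation of the Faddeeva function. -/
noncomputable def fadG (z : ℂ) (t : ℝ) : ℂ := Complex.exp (-1 * (t : ℂ) ^ 2 + (2 * Complex.I * z) * t)

noncomputable def fadI (z : ℂ) : ℂ := ∫ t in Ioi (0:ℝ), fadG z t

lemma fadG_integrable (z : ℂ) : Integrable (fadG z) := by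
  have := integrable_cexp_quadratic' (b := -1) (by simp) (2 * Complex.I * z) 0
  refine this.congr (ae_of_all _ fun t => ?_)
  simp [fadG]

lemma fadG_cont (z : ℂ) : Continuous (fadG z) := by
  unfold fadG; fun_prop

lemma fadG_norm (z : ℂ) (t : ℝ) : ‖fadG z t‖ = Real.exp (-t ^ 2 - 2 * z.im * t) := by
  rw [fadG, Complex.norm_exp]
  congr 1
  simp [pow_two]
  ring

lemma fadI_deriv_aux (z : ℂ) :
    IntegrableOn (fun t : ℝ => 2 * Complex.I * t * fadG z t) (Ioi 0) ∧
    HasDerivAt fadI (∫ t in Ioi (0:ℝ), 2 * Complex.I * t * fadG z t) z := by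
  have hb : Integrable (fun t : ℝ => Real.exp (-t ^ 2 + (2 * ‖z‖ + 4) * t)) := by
    have := (integrable_cexp_quadratic' (b := -1) (by simp) ((2 * ‖z‖ + 4 : ℝ) : ℂ) 0).norm
    refine this.congr (ae_of_all _ fun t => ?_)
    simp only [Complex.norm_exp]
    congr 1
    simp [pow_two]
  refine hasDerivAt_integral_of_dominated_loc_of_deriv_le
    (F := fadG) (F' := fun z t => 2 * Complex.I * t * fadG z t)
    (bound := fun t => Real.exp (-t ^ 2 + (2 * ‖z‖ + 4) * t))
    (Metric.ball_mem_nhds z one_pos) ?_ (fadG_integrable z).integrableOn ?_ ?_ hb.integrableOn ?_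
  · exact Eventually.of_forall fun x => (fadG_cont x).aestronglyMeasurable
  · have := fadG_cont z
    exact Continuous.aestronglyMeasurable (by fun_prop)
  · refine (ae_restrict_iff' measurableSet_Ioi).2 (ae_of_all _ fun t ht x hx => ?_)
    have ht : 0 < t := ht
    rw [norm_mul, fadG_norm]
    have h1 : ‖2 * Complex.I * (t : ℂ)‖ = 2 * t := by simp [abs_of_pos ht]
    have h2 : 2 * t ≤ Real.exp (2 * t) := by linarith [Real.add_one_le_exp (2 * t)]
    have h3 : ‖x‖ ≤ ‖z‖ + 1 := by
      have := norm_sub_norm_le x z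
      rw [Metric.mem_ball, dist_eq_norm] at hx
      linarith
    have h4 := (abs_le.1 (Complex.abs_im_le_norm x)).1
    rw [h1]
    calc _ ≤ Real.exp (2 * t) * Real.exp (-t ^ 2 - 2 * x.im * t) := by gcongr
      _ = Real.exp (2 * t + (-t ^ 2 - 2 * x.im * t)) := (Real.exp_add _ _).symm
      _ ≤ _ := Real.exp_le_exp.2 (by nlinarith)
  · refine ae_of_all _ fun t x hx => ?_
    unfold fadG
    have h : HasDerivAt (fun x : ℂ => -1 * (t : ℂ) ^ 2 + (2 * Complex.I * x) * t)
        (2 * Complex.I * t) x := by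
      have := (((hasDerivAt_id x).const_mul (2 * Complex.I)).mul_const (t : ℂ)).const_add
        (-1 * (t : ℂ) ^ 2)
      simpa using this
    have := h.cexp
    rwa [mul_comm (Complex.exp _)] at this

lemma fad_parts (z : ℂ) :
    ∫ t in Ioi (0:ℝ), 2 * Complex.I * t * fadG z t = Complex.I - 2 * z * fadI z := by
  have hint : IntegrableOn (fun t : ℝ => Complex.I * (2 * Complex.I * t * fadG z t)
      + 2 * Complex.I * z * fadG z t) (Ioi 0) :=
    ((fadI_deriv_aux z).1.const_mul _).add ((fadG_integrable z).integrableOn.const_mul _)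
  have htend : Tendsto (fadG z) atTop (nhds 0) := by
    have := cexp_neg_quadratic_isLittleO_rpow_atTop (a := -1) (by simp) (2 * Complex.I * z) 0
    simp only [Real.rpow_zero] at this
    exact (Asymptotics.isLittleO_one_iff ℝ).1 this
  have key := integral_Ioi_of_hasDerivAt_of_tendsto' (a := 0) (f := fadG z) (m := 0)
    (fun t _ => by
      have h : HasDerivAt (fun t : ℝ => -1 * (t : ℂ) ^ 2 + (2 * Complex.I * z) * t)
          (-2 * t + 2 * Complex.I * z) t := by
        have h0 : HasDerivAt (fun t : ℂ => -1 * t ^ 2 + (2 * Complex.I * z) * t)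
          (-2 * t + 2 * Complex.I * z) (t : ℂ) := by
          have := (((hasDerivAt_id (t : ℂ)).pow 2).const_mul (-1)).add
            ((hasDerivAt_id (t : ℂ)).const_mul (2 * Complex.I * z))
          refine this.congr_deriv ?_
          simp
        exact h0.comp_ofReal
      have := h.cexp
      refine this.congr_deriv ?_
      show _ = Complex.I * (2 * Complex.I * t * fadG z t) + 2 * Complex.I * z * fadG z t
      unfold fadG
      linear_combination (-2 * (t : ℂ) * Complex.exp (-1 * (t : ℂ) ^ 2 + (2 * Complex.I * z) * t)) * Complex.I_sq)
    hint htend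
  rw [integral_add ((fadI_deriv_aux z).1.const_mul _)
    ((fadG_integrable z).integrableOn.const_mul _), integral_const_mul, integral_const_mul] at key
  have h0 : fadG z 0 = 1 := by simp [fadG]
  rw [h0] at key
  change _ + 2 * Complex.I * z * fadI z = _ at key
  linear_combination (-Complex.I) * key + ((∫ t in Ioi (0:ℝ), 2 * Complex.I * t * fadG z t) + 2 * z * fadI z) * Complex.I_sq

lemma fadI_deriv (z : ℂ) : HasDerivAt fadI (Complex.I - 2 * z * fadI z) z := by
  rw [← fad_parts]; exact (fadI_deriv_aux z).2

lemma sqrtpi_ne : (Real.sqrt Real.pi : ℂ) ≠ 0 := by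
  exact_mod_cast (Real.sqrt_pos.2 Real.pi_pos).ne'

lemma fadI_zero : fadI 0 = (Real.sqrt Real.pi : ℂ) / 2 := by
  have h := integral_gaussian_Ioi 1
  have : fadI 0 = ∫ t in Ioi (0:ℝ), ((Real.exp (-1 * t ^ 2) : ℝ) : ℂ) := by
    unfold fadI fadG
    congr 1; ext t; push_cast; simp
  rw [this, integral_complex_ofReal, h]
  simp

/-- The Faddeeva function in closed form. -/
lemma fad_eq (z : ℂ) : Complex.exp (-z ^ 2) +
        (2 * Complex.I * z / (Real.sqrt Real.pi : ℂ)) * Complex.exp (-z ^ 2) *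
          ∫ s in (0:ℝ)..1, Complex.exp ((s : ℂ) ^ 2 * z ^ 2)
      = 2 / (Real.sqrt Real.pi : ℂ) * fadI z := by
  have hd : ∀ s : ℝ, HasDerivAt (fun s : ℝ => Complex.exp ((s : ℂ) ^ 2 * z ^ 2) * fadI (s * z))
      (Complex.I * z * Complex.exp ((s : ℂ) ^ 2 * z ^ 2)) s := by
    intro s
    have h1 : HasDerivAt (fun s : ℂ => s ^ 2 * z ^ 2) (2 * s * z ^ 2) (s : ℂ) := by
      simpa using ((hasDerivAt_id (s : ℂ)).pow 2).mul_const (z ^ 2)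
    have h2 : HasDerivAt (fun s : ℂ => s * z) z (s : ℂ) := by
      simpa using (hasDerivAt_id (s : ℂ)).mul_const z
    have h3 := (h1.cexp.mul ((fadI_deriv ((s : ℂ) * z)).comp (s : ℂ) h2)).comp_ofReal
    refine h3.congr_deriv ?_
    simp only [Function.comp]
    ring
  have hc : Continuous (fun s : ℝ => Complex.I * z * Complex.exp ((s : ℂ) ^ 2 * z ^ 2)) := by
    fun_prop
  have key := intervalIntegral.integral_eq_sub_of_hasDerivAt (a := 0) (b := 1)
    (fun s _ => hd s) (hc.intervalIntegrable _ _)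
  rw [intervalIntegral.integral_const_mul] at key
  simp only [Complex.ofReal_one, Complex.ofReal_zero, one_pow, one_mul, zero_mul, ne_eq,
    OfNat.ofNat_ne_zero, not_false_eq_true, zero_pow, Complex.exp_zero, fadI_zero] at key
  have hp := sqrtpi_ne
  have he : Complex.exp (-z ^ 2) * Complex.exp (z ^ 2) = 1 := by
    rw [← Complex.exp_add]; simp
  have : (2 * Complex.I * z / (Real.sqrt Real.pi : ℂ)) * Complex.exp (-z ^ 2) *
          (∫ s in (0:ℝ)..1, Complex.exp ((s : ℂ) ^ 2 * z ^ 2))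
        = 2 / (Real.sqrt Real.pi : ℂ) * Complex.exp (-z ^ 2) * (Complex.I * z *
          ∫ s in (0:ℝ)..1, Complex.exp ((s : ℂ) ^ 2 * z ^ 2)) := by ring
  rw [this, key]
  field_simp
  linear_combination (2 * fadI z) * he

lemma fadI_bound1 {z : ℂ} (hz : 0 ≤ z.im) : ‖fadI z‖ ≤ Real.sqrt Real.pi / 2 := by
  have h := integral_gaussian_Ioi 1
  rw [div_one] at h
  rw [← h]
  refine norm_integral_le_of_norm_le (integrable_exp_neg_mul_sq one_pos).integrableOn ?_
  refine (ae_restrict_iff' measurableSet_Ioi).2 (ae_of_all _ fun t ht => ?_)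
  have ht : 0 < t := ht
  rw [fadG_norm]
  exact Real.exp_le_exp.2 (by nlinarith [mul_nonneg hz ht.le])

lemma fadI_bound2 : ∃ K : ℝ, 0 < K ∧ ∀ z : ℂ, 0 ≤ z.im → ‖z * fadI z‖ ≤ K := by
  set K0 := ∫ t in Ioi (0:ℝ), 2 * (t * Real.exp (-1 * t ^ 2)) with hK0
  have hK0' : 0 ≤ K0 := setIntegral_nonneg measurableSet_Ioi fun t ht => by
    have ht : 0 < t := ht
    positivity
  refine ⟨1 + K0, by linarith, fun z hz => ?_⟩
  have h1 : ‖∫ t in Ioi (0:ℝ), 2 * Complex.I * t * fadG z t‖ ≤ K0 := by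
    refine norm_integral_le_of_norm_le
      ((integrable_mul_exp_neg_mul_sq one_pos).integrableOn.const_mul 2) ?_
    refine (ae_restrict_iff' measurableSet_Ioi).2 (ae_of_all _ fun t ht => ?_)
    have ht : 0 < t := ht
    rw [norm_mul, fadG_norm]
    have h1 : ‖2 * Complex.I * (t : ℂ)‖ = 2 * t := by simp [abs_of_pos ht]
    rw [h1, mul_assoc]
    gcongr
    nlinarith [mul_nonneg hz ht.le]
  rw [fad_parts] at h1
  have h2 : 2 * (z * fadI z) = Complex.I - (Complex.I - 2 * z * fadI z) := by ring
  have h3 : ‖2 * (z * fadI z)‖ ≤ 1 + K0 := by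
    rw [h2]
    refine (norm_sub_le _ _).trans ?_
    simpa using h1
  rw [norm_mul] at h3
  have := norm_nonneg (z * fadI z)
  simp at h3
  rw [norm_mul]
  rw [norm_mul] at this
  linarith

/-- Reflection formula. -/
lemma fadI_reflect (z : ℂ) :
    fadI z = Real.sqrt Real.pi * Complex.exp (-z ^ 2) - fadI (-z) := by
  have h1 := fad_eq z
  have h2 := fad_eq (-z)
  have hp := sqrtpi_ne
  simp only [neg_sq] at h2
  have h3 : 2 * Complex.exp (-z ^ 2) = 2 / (Real.sqrt Real.pi : ℂ) * (fadI z + fadI (-z)) := by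
    linear_combination h1 + h2
  field_simp at h3
  linear_combination -h3

/-- Uniform bound on the enlarged sector. -/
lemma fadI_bound : ∃ K : ℝ, 0 < K ∧ ∀ z : ℂ, -(|z.re| / 2) ≤ z.im →
    ‖fadI z‖ ≤ K ∧ ‖z‖ * ‖fadI z‖ ≤ K := by
  obtain ⟨K, hK, h⟩ := fadI_bound2
  have hp := Real.sqrt_pos.2 Real.pi_pos
  refine ⟨K + 4 * Real.sqrt Real.pi, by positivity, fun z hz => ?_⟩
  rcases le_total 0 z.im with h0 | h0
  · refine ⟨(fadI_bound1 h0).trans (by linarith), ?_⟩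
    rw [← norm_mul]
    exact (h z h0).trans (by linarith)
  · have hn : 0 ≤ (-z).im := by simpa using h0
    have e1 := fadI_bound1 hn
    have e2 := h _ hn
    rw [norm_mul, norm_neg] at e2
    have hsq : ‖z‖ ^ 2 = z.re ^ 2 + z.im ^ 2 := by
      rw [Complex.sq_norm, Complex.normSq_apply]; ring
    have hexp : ‖Complex.exp (-z ^ 2)‖ = Real.exp (-(z.re ^ 2 - z.im ^ 2)) := by
      rw [Complex.norm_exp]; congr 1; simp [pow_two]
    have hle : 4 * z.im ^ 2 ≤ z.re ^ 2 := by
      nlinarith [sq_abs z.re, abs_nonneg z.re]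
    set E := Real.exp (-(z.re ^ 2 - z.im ^ 2)) with hE
    have hE0 : 0 < E := Real.exp_pos _
    have hE1 : E ≤ 1 := Real.exp_le_one_iff.2 (by nlinarith [sq_nonneg z.im])
    have hE2 : ‖z‖ * E ≤ 2 := by
      have : E * Real.exp (z.re ^ 2 - z.im ^ 2) = 1 := by
        rw [hE, ← Real.exp_add]; simp
      have h5 := Real.add_one_le_exp (z.re ^ 2 - z.im ^ 2)
      have h6 : ‖z‖ ≤ 2 * Real.exp (z.re ^ 2 - z.im ^ 2) := by
        nlinarith [sq_nonneg (‖z‖ - 1), sq_nonneg z.im]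
      nlinarith
    have hb : ‖fadI z‖ ≤ Real.sqrt Real.pi * E + ‖fadI (-z)‖ := by
      rw [fadI_reflect z]
      refine (norm_sub_le _ _).trans ?_
      rw [norm_mul, hexp]
      simp [abs_of_pos hp]
    constructor
    · nlinarith
    · have := mul_le_mul_of_nonneg_left hb (norm_nonneg z)
      nlinarith

lemma fadI_re_real (x : ℝ) : 0 ≤ (fadI x).re := by
  have h := fad_eq x
  have hp := Real.sqrt_pos.2 Real.pi_pos
  have e1 : (∫ s in (0:ℝ)..1, Complex.exp ((s : ℂ) ^ 2 * (x : ℂ) ^ 2))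
      = ((∫ s in (0:ℝ)..1, Real.exp (s ^ 2 * x ^ 2) : ℝ) : ℂ) := by
    rw [← intervalIntegral.integral_ofReal]
    push_cast; rfl
  have e2 : Complex.exp (-(x : ℂ) ^ 2) = ((Real.exp (-x ^ 2) : ℝ) : ℂ) := by push_cast; rfl
  rw [e1, e2] at h
  set J := ∫ s in (0:ℝ)..1, Real.exp (s ^ 2 * x ^ 2)
  have h2 : fadI x = ((Real.sqrt Real.pi / 2 * Real.exp (-x ^ 2) : ℝ) : ℂ)
      + ((x * Real.exp (-x ^ 2) * J : ℝ) : ℂ) * Complex.I := by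
    have hpp := sqrtpi_ne
    push_cast
    push_cast at h
    field_simp at h
    field_simp
    linear_combination -h
  rw [h2]
  simp only [Complex.add_re, Complex.ofReal_re, Complex.re_ofReal_mul, Complex.I_re]
  have := Real.exp_pos (-x ^ 2)
  simp
  positivity

lemma fadI_diff : Differentiable ℂ fadI := fun z => (fadI_deriv z).differentiableAt

lemma fadI_re_nonneg {z : ℂ} (hz : 0 ≤ z.im) : 0 ≤ (fadI z).re := by
  set f : ℂ → ℂ := fun u => Complex.exp (-fadI (Complex.I * u)) with hf
  have hdf : Differentiable ℂ f := by
    have := fadI_diff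
    rw [hf]
    fun_prop
  have hbd : ∀ u : ℂ, 0 ≤ u.re → ‖f u‖ ≤ Real.exp (Real.sqrt Real.pi / 2) := by
    intro u hu
    rw [hf]
    simp only [Complex.norm_exp]
    apply Real.exp_le_exp.2
    refine (Complex.re_le_norm _).trans ?_
    rw [norm_neg]
    exact fadI_bound1 (by simpa using hu)
  have key := PhragmenLindelof.right_half_plane_of_bounded_on_real (f := f) (C := 1)
    (z := -Complex.I * z) hdf.diffContOnCl ?_ ?_ ?_ (by simpa using hz)
  · simp only [hf, Complex.norm_exp] at key
    have := Real.exp_le_one_iff.1 key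
    have e : Complex.I * (-Complex.I * z) = z := by linear_combination (-z) * Complex.I_sq
    rw [e] at this
    simpa using this
  · refine ⟨1, by norm_num, 0, ?_⟩
    refine Asymptotics.IsBigO.of_bound (Real.exp (Real.sqrt Real.pi / 2)) ?_
    refine Filter.eventually_inf_principal.2 (Eventually.of_forall fun u hu => ?_)
    simpa using hbd u (le_of_lt hu)
  · refine ⟨Real.exp (Real.sqrt Real.pi / 2), ?_⟩
    rw [Filter.eventually_map]
    filter_upwards [eventually_ge_atTop 0] with x hx
    exact hbd x (by simpa using hx)
  · intro x
    simp only [hf, Complex.norm_exp]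
    apply Real.exp_le_one_iff.2
    have e : Complex.I * ((x : ℂ) * Complex.I) = ((-x : ℝ) : ℂ) := by
      push_cast; linear_combination (x : ℂ) * Complex.I_sq
    rw [e]
    simpa using fadI_re_real (-x)

/-- The integrand defining `p̃(-z)`. -/
noncomputable def fadF (z : ℂ) (x : ℝ) : ℂ :=
  ((1 / Real.sqrt x : ℝ) : ℂ) *
    (2 / (Real.sqrt Real.pi : ℂ) * fadI (z / (2 * (Real.sqrt x : ℂ))))

noncomputable def fadB (x : ℝ) : ℝ :=
  (Icc (0:ℝ) 1).indicator (fun _ => (1:ℝ)) x + (Ici (1:ℝ)).indicator (fun x => 1 / Real.sqrt x) x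

def fadU : Set ℂ := {z : ℂ | -(|z.re| / 2) < z.im}

lemma fadU_open : IsOpen fadU := by
  unfold fadU
  exact isOpen_lt (by fun_prop) (by fun_prop)

lemma fadU_ne {z : ℂ} (hz : z ∈ fadU) : z ≠ 0 := by
  rintro rfl
  simp [fadU] at hz

lemma fadU_mem {z : ℂ} (hz : z ∈ upperHalfPunctured) : z ∈ fadU := by
  obtain ⟨h1, h2⟩ := hz
  show -(|z.re| / 2) < z.im
  by_contra hcon
  push Not at hcon
  have h3 := abs_nonneg z.re
  have h4 : |z.re| = 0 := by linarith
  exact h2 (Complex.ext (abs_eq_zero.1 h4) (by simp; linarith))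

lemma fadF_bound {ε : ℝ} (hε : 0 < ε) : ∃ M : ℝ, 0 < M ∧ ∀ z ∈ fadU, ε ≤ ‖z‖ →
    ∀ x : ℝ, 0 ≤ x → ‖fadF z x‖ ≤ M * fadB x := by
  obtain ⟨K, hK, hb⟩ := fadI_bound
  have hp := Real.sqrt_pos.2 Real.pi_pos
  refine ⟨2 / Real.sqrt Real.pi * (K + 2 * K / ε), by positivity, fun z hz hzε x hx => ?_⟩
  have hz' : -(|z.re| / 2) < z.im := hz
  have hi1 : 0 ≤ (Icc (0:ℝ) 1).indicator (fun _ => (1:ℝ)) x :=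
    indicator_nonneg (fun _ _ => zero_le_one) x
  have hi2 : 0 ≤ (Ici (1:ℝ)).indicator (fun x => 1 / Real.sqrt x) x :=
    indicator_nonneg (fun _ _ => by positivity) x
  rcases hx.eq_or_lt with rfl | hx
  · have : fadF z 0 = 0 := by simp [fadF]
    rw [this, norm_zero]
    unfold fadB
    positivity
  have hs := Real.sqrt_pos.2 hx
  set r : ℝ := Real.sqrt x with hr
  have hζ : z / (2 * (r : ℂ)) = ((1 / (2 * r) : ℝ) : ℂ) * z := by
    push_cast; ring
  have hn : ‖fadF z x‖ = 1 / r * (2 / Real.sqrt Real.pi * ‖fadI (z / (2 * (r : ℂ)))‖) := by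
    unfold fadF
    rw [← hr]
    simp [abs_of_pos hs, abs_of_pos hp]
  obtain ⟨b1, b2⟩ := hb (z / (2 * (r : ℂ))) (by
    rw [hζ, Complex.re_ofReal_mul, Complex.im_ofReal_mul, abs_mul,
      abs_of_pos (by positivity : 0 < 1 / (2 * r))]
    have : 0 < 1 / (2 * r) := by positivity
    nlinarith)
  rw [hn]
  have hnz : ‖z / (2 * (r : ℂ))‖ = ‖z‖ / (2 * r) := by simp [abs_of_pos hs]
  rw [hnz] at b2
  set A := ‖fadI (z / (2 * (r : ℂ)))‖ with hA
  have hA0 : 0 ≤ A := norm_nonneg _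
  rw [mul_left_comm, mul_assoc]
  refine mul_le_mul_of_nonneg_left ?_ (by positivity)
  have hpos : 0 < 2 * K / ε := by positivity
  rcases le_total x 1 with h1 | h1
  · have e1 : 1 ≤ fadB x := by
      unfold fadB
      have : (Icc (0:ℝ) 1).indicator (fun _ => (1:ℝ)) x = 1 :=
        indicator_of_mem (show x ∈ Icc (0:ℝ) 1 from ⟨hx.le, h1⟩) _
      linarith
    have e2 : 1 / r * A ≤ 2 * K / ε := by
      rw [le_div_iff₀ hε]
      have h3 : ε / (2 * r) * A ≤ K := by
        refine le_trans ?_ b2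
        gcongr
      calc 1 / r * A * ε = 2 * (ε / (2 * r) * A) := by field_simp
        _ ≤ 2 * K := by linarith
    nlinarith
  · have e1 : 1 / r ≤ fadB x := by
      unfold fadB
      have : (Ici (1:ℝ)).indicator (fun x => 1 / Real.sqrt x) x = 1 / r :=
        indicator_of_mem (show x ∈ Ici (1:ℝ) from h1) _
      linarith
    have hr' : 0 < 1 / r := by positivity
    calc 1 / r * A ≤ 1 / r * K := by gcongr
      _ ≤ fadB x * (K + 2 * K / ε) :=
          mul_le_mul e1 (by linarith) hK.le (hr'.le.trans e1)
      _ = _ := mul_comm _ _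

lemma fadB_int (μ : Measure ℝ) (hμ01 : μ (Icc (0:ℝ) 1) < ⊤)
    (hμint : IntegrableOn (fun x : ℝ => 1 / Real.sqrt x) (Ici 1) μ) :
    Integrable fadB (μ.restrict (Ici 0)) := by
  refine Integrable.restrict ?_
  unfold fadB
  refine Integrable.add ?_ (hμint.integrable_indicator measurableSet_Ici)
  exact (integrableOn_const hμ01.ne).integrable_indicator measurableSet_Icc

lemma fadF_meas (z : ℂ) : Measurable (fadF z) := by
  have := fadI_diff.continuous.measurable
  unfold fadF
  fun_prop

lemma fadF_diff (x : ℝ) : Differentiable ℂ (fun z => fadF z x) := by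
  have := fadI_diff
  unfold fadF
  fun_prop

lemma fadF_integral_diff (μ : Measure ℝ) (hμ01 : μ (Icc (0:ℝ) 1) < ⊤)
    (hμint : IntegrableOn (fun x : ℝ => 1 / Real.sqrt x) (Ici 1) μ) {z : ℂ} (hz : z ∈ fadU) :
    Integrable (fadF z) (μ.restrict (Ici 0)) ∧
    DifferentiableAt ℂ (fun z => ∫ x in Ici (0:ℝ), fadF z x ∂μ) z := by
  have hz0 : 0 < ‖z‖ := norm_pos_iff.2 (fadU_ne hz)
  obtain ⟨M, hM, hb⟩ := fadF_bound (half_pos hz0)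
  have hB := fadB_int μ hμ01 hμint
  obtain ⟨ρ, hρ, hρU⟩ := Metric.isOpen_iff.1 fadU_open z hz
  set r := min (ρ / 2) (‖z‖ / 4) with hr
  have hr0 : 0 < r := by positivity
  have hrρ : r ≤ ρ / 2 := min_le_left _ _
  have hrz : r ≤ ‖z‖ / 4 := min_le_right _ _
  have hin : Integrable (fadF z) (μ.restrict (Ici 0)) := by
    refine (hB.const_mul M).mono' (fadF_meas z).aestronglyMeasurable ?_
    refine (ae_restrict_iff' measurableSet_Ici).2 (ae_of_all _ fun x hx => ?_)
    exact hb z hz (by linarith) x hx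
  refine ⟨hin, ?_⟩
  have hmd : Measurable (fun x => deriv (fun z => fadF z x) z) := by
    have h : (fun x : ℝ => deriv (fun z => fadF z x) z) = fun x : ℝ =>
        ((1 / Real.sqrt x : ℝ) : ℂ) * (2 / (Real.sqrt Real.pi : ℂ) *
        ((Complex.I - 2 * (z / (2 * (Real.sqrt x : ℂ))) * fadI (z / (2 * (Real.sqrt x : ℂ)))) *
          (1 / (2 * (Real.sqrt x : ℂ))))) := by
      ext x
      refine HasDerivAt.deriv ?_
      unfold fadF
      refine HasDerivAt.const_mul _ (HasDerivAt.const_mul _ ?_)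
      exact (fadI_deriv (z / (2 * (Real.sqrt x : ℂ)))).comp z ((hasDerivAt_id z).div_const _)
    rw [h]
    have := fadI_diff.continuous.measurable
    fun_prop
  have key := hasDerivAt_integral_of_dominated_loc_of_deriv_le
    (μ := μ.restrict (Ici 0)) (F := fadF) (F' := fun z x => deriv (fun z => fadF z x) z)
    (bound := fun x => M * fadB x / r) (Metric.ball_mem_nhds z hr0)
    (Eventually.of_forall fun y => (fadF_meas y).aestronglyMeasurable) hin
    hmd.aestronglyMeasurable ?_ ((hB.const_mul M).div_const r) ?_
  · exact key.2.differentiableAt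
  · refine (ae_restrict_iff' measurableSet_Ici).2 (ae_of_all _ fun x hx y hy => ?_)
    refine Complex.norm_deriv_le_of_forall_mem_sphere_norm_le hr0
      (fadF_diff x).diffContOnCl fun v hv => ?_
    rw [Metric.mem_ball] at hy
    rw [mem_sphere_iff_norm, ← dist_eq_norm] at hv
    have hd : dist v z < 2 * r := by linarith [dist_triangle v y z]
    refine hb v (hρU (by rw [Metric.mem_ball]; linarith)) ?_ x hx
    have h2 : ‖z‖ - ‖v‖ ≤ dist v z := by
      rw [dist_comm, dist_eq_norm]; exact norm_sub_norm_le z v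
    linarith
  · exact ae_of_all _ fun x y _ => (fadF_diff x y).hasDerivAt

lemma fadF_re_nonneg {z : ℂ} (hz : 0 ≤ z.im) (x : ℝ) : 0 ≤ (fadF z x).re := by
  have hζ : z / (2 * (Real.sqrt x : ℂ)) = ((1 / (2 * Real.sqrt x) : ℝ) : ℂ) * z := by
    push_cast; ring
  have h1 : 0 ≤ (fadI (z / (2 * (Real.sqrt x : ℂ)))).re := by
    apply fadI_re_nonneg
    rw [hζ, Complex.im_ofReal_mul]
    positivity
  have h2 : fadF z x = ((1 / Real.sqrt x * (2 / Real.sqrt Real.pi) : ℝ) : ℂ) *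
      fadI (z / (2 * (Real.sqrt x : ℂ))) := by
    unfold fadF; push_cast; ring
  rw [h2, Complex.re_ofReal_mul]
  positivity

/-- The function `q̃₂(z) = λz + βz·p̃(−z) + i(γ − mz²)`, with
`p̃(z) = (√π/2)∫₀^∞ x^{−1/2} w(−z/(2√x)) μ(dx)` and `w` the Faddeeva
function, is analytic and non-vanishing on the punctured closed upper
half-plane. -/
theorem q2tilde_analytic_nonvanishing
    (μ : Measure ℝ) (γ lam m β : ℝ)
    (hγ : 0 < γ) (hlam : 0 < lam) (hm : 0 < m) (hβ : 0 < β)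
    (hμ0 : μ {0} = 0)
    (hμ01 : μ (Icc (0:ℝ) 1) < ⊤)
    (hμint : IntegrableOn (fun x : ℝ => 1 / Real.sqrt x) (Ici 1) μ)
    (w : ℂ → ℂ)
    (hw : ∀ z : ℂ, w z =
      Complex.exp (-z ^ 2) +
        (2 * Complex.I * z / (Real.sqrt Real.pi : ℂ)) * Complex.exp (-z ^ 2) *
          ∫ s in (0:ℝ)..1, Complex.exp ((s : ℂ) ^ 2 * z ^ 2))
    (ptilde qtilde₂ : ℂ → ℂ)
    (hptilde : ∀ z : ℂ, ptilde z =
      ((Real.sqrt Real.pi / 2 : ℝ) : ℂ) *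
        ∫ x in Ici (0:ℝ), ((1 / Real.sqrt x : ℝ) : ℂ) *
          w (-z / (2 * (Real.sqrt x : ℂ))) ∂μ)
    (hqtilde₂ : ∀ z : ℂ, qtilde₂ z =
      (lam : ℂ) * z + (β : ℂ) * z * ptilde (-z) +
        Complex.I * ((γ : ℂ) - (m : ℂ) * z ^ 2)) :
    (∀ z ∈ upperHalfPunctured, AnalyticAt ℂ qtilde₂ z) ∧
    (∀ z ∈ upperHalfPunctured, qtilde₂ z ≠ 0) := by
  have hq : qtilde₂ = fun z => (lam : ℂ) * z + (β : ℂ) * z *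
      (((Real.sqrt Real.pi / 2 : ℝ) : ℂ) * ∫ x in Ici (0:ℝ), fadF z x ∂μ) +
        Complex.I * ((γ : ℂ) - (m : ℂ) * z ^ 2) := by
    ext z
    rw [hqtilde₂, hptilde]
    simp only [hw, fad_eq, fadF, neg_neg]
  refine ⟨fun z hz => ?_, fun z hz h0 => ?_⟩
  · have hd : DifferentiableOn ℂ qtilde₂ fadU := by
      intro y hy
      refine DifferentiableAt.differentiableWithinAt ?_
      have h := (fadF_integral_diff μ hμ01 hμint hy).2
      rw [hq]
      fun_prop
    exact hd.analyticAt (fadU_open.mem_nhds (fadU_mem hz))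
  · have hin := (fadF_integral_diff μ hμ01 hμint (fadU_mem hz)).1
    obtain ⟨hz1, hz2⟩ := hz
    set J := ∫ x in Ici (0:ℝ), fadF z x ∂μ with hJ
    have hJre : 0 ≤ J.re := by
      have h1 : ∫ x in Ici (0:ℝ), (fadF z x).re ∂μ = J.re := integral_re hin
      rw [← h1]
      exact integral_nonneg fun x => fadF_re_nonneg hz1 x
    have hN : 0 < Complex.normSq z := Complex.normSq_pos.2 hz2
    have hq0 : (lam : ℂ) * z + (β : ℂ) * z * (((Real.sqrt Real.pi / 2 : ℝ) : ℂ) * J) +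
        Complex.I * ((γ : ℂ) - (m : ℂ) * z ^ 2) = 0 := by
      rw [hq] at h0; exact h0
    have hr : ((starRingEnd ℂ) z * ((lam : ℂ) * z +
        (β : ℂ) * z * (((Real.sqrt Real.pi / 2 : ℝ) : ℂ) * J) +
        Complex.I * ((γ : ℂ) - (m : ℂ) * z ^ 2))).re
        = Complex.normSq z * (lam + β * (Real.sqrt Real.pi / 2) * J.re) + γ * z.im
          + m * Complex.normSq z * z.im := by
      simp [Complex.normSq_apply, pow_two, -Complex.ofReal_div]
      ring
    rw [hq0, mul_zero, Complex.zero_re] at hr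
    have hp := Real.sqrt_pos.2 Real.pi_pos
    have h1 : 0 ≤ β * (Real.sqrt Real.pi / 2) * J.re := by positivity
    have h2 : 0 < Complex.normSq z * (lam + β * (Real.sqrt Real.pi / 2) * J.re) := by
      positivity
    have h3 : 0 ≤ γ * z.im := by positivity
    have h4 : 0 ≤ m * Complex.normSq z * z.im := by positivity
    linarith
end
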